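/- arXiv:0712.3142 — 2 statements merged into one kernel-verified Lean document; each statement's English description precedes it below -/
import Mathlib

section
/- Let d ≥ 2 and let v: [0,∞) → ℝ be continuous such that V(x) := v(|x|) satisfies ∫ e^{V(x)} dx = 1; let μ(dx) = e^{V(x)} dx. Set h := ∫₀^∞ s^{d-1} e^{v(s)} ds, φ(r) := (1/h) ∫₀^r s^{d-1} e^{v(s)} ds, Φ₀(r) := (2π)^{-d/2} ∫_{{|x| < r}} e^{-|x|²/2} dx, and define α(x) := max{ |x|² / Φ₀^{-1}(φ(|x|))², Φ₀'(Φ₀^{-1}(φ(|x|)))² / φ'(|x|)² }, where Φ₀'(r) = d·ω_d·(2π)^{-d/2} r^{d-1} e^{-r²/2} with ω_d the volume of the unit ball in ℝ^d, and φ'(r) = r^{d-1} e^{v(r)}/h. Then for every f ∈ C_c^∞(ℝ^d) with ∫ f² dμ = 1, one has ∫ f² log f² dμ ≤ 2 ∫ α(x) |∇f(x)|² μ(dx). -/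
open MeasureTheory Real Set

/-- `h = ∫₀^∞ s^{d-1} e^{v(s)} ds`. -/
noncomputable def hRad (d : ℕ) (v : ℝ → ℝ) : ℝ :=
  ∫ s in Ioi (0:ℝ), s ^ (d - 1) * Real.exp (v s)

/-- `φ(r) = (1/h) ∫₀^r s^{d-1} e^{v(s)} ds`. -/
noncomputable def phiRad (d : ℕ) (v : ℝ → ℝ) (r : ℝ) : ℝ :=
  (hRad d v)⁻¹ * ∫ s in (0:ℝ)..r, s ^ (d - 1) * Real.exp (v s)

/-- `φ'(r) = r^{d-1} e^{v(r)} / h`. -/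
noncomputable def phiRadDeriv (d : ℕ) (v : ℝ → ℝ) (r : ℝ) : ℝ :=
  r ^ (d - 1) * Real.exp (v r) / hRad d v

/-- The radial distribution function of the standard Gaussian measure on `ℝ^d`. -/
noncomputable def Phi0 (d : ℕ) (r : ℝ) : ℝ :=
  (2 * Real.pi) ^ (-(d:ℝ)/2) *
    ∫ x in Metric.ball (0 : EuclideanSpace ℝ (Fin d)) r, Real.exp (-‖x‖^2/2)

/-- The inverse of the strictly increasing bijection `Φ₀ : [0,∞) → [0,1)`. -/
noncomputable def Phi0Inv (d : ℕ) (u : ℝ) : ℝ := sInf {r : ℝ | 0 ≤ r ∧ u ≤ Phi0 d r}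

/-- The volume `ω_d` of the unit ball in `ℝ^d`. -/
noncomputable def omegad (d : ℕ) : ℝ :=
  (volume (Metric.ball (0 : EuclideanSpace ℝ (Fin d)) 1)).toReal

/-- `Φ₀'(r) = d ω_d (2π)^{-d/2} r^{d-1} e^{-r²/2}`. -/
noncomputable def Phi0Deriv (d : ℕ) (r : ℝ) : ℝ :=
  d * omegad d * (2 * Real.pi) ^ (-(d:ℝ)/2) * r ^ (d - 1) * Real.exp (-r^2/2)

/-- The weight `α(x) = max{ |x|²/Φ₀^{-1}(φ(|x|))², Φ₀'(Φ₀^{-1}(φ(|x|)))²/φ'(|x|)² }`. -/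
noncomputable def alphaRad (d : ℕ) (v : ℝ → ℝ) (x : EuclideanSpace ℝ (Fin d)) : ℝ :=
  max (‖x‖ ^ 2 / (Phi0Inv d (phiRad d v ‖x‖)) ^ 2)
    ((Phi0Deriv d (Phi0Inv d (phiRad d v ‖x‖))) ^ 2 / (phiRadDeriv d v ‖x‖) ^ 2)

open Filter Topology

lemma aux_inverse (p : ℝ → ℝ) (hp : Continuous p) (c : ℝ) (hc : 0 < c) (hpc : ∀ x, c ≤ p x) (a : ℝ) :
    ∃ K : ℝ → ℝ, (∀ y, (∫ t in a..(K y), p t) = y) ∧ (∀ x, K (∫ t in a..x, p t) = x) ∧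
      StrictMono K ∧ ∀ y, HasDerivAt K (p (K y))⁻¹ y := by
  set G : ℝ → ℝ := fun x => ∫ t in a..x, p t with hG
  have hder : ∀ x, HasDerivAt G (p x) x := fun x =>
    intervalIntegral.integral_hasDerivAt_right (hp.intervalIntegrable _ _)
      hp.aestronglyMeasurable.stronglyMeasurableAtFilter hp.continuousAt
  have hmono : StrictMono G := strictMono_of_deriv_pos fun x => by
    rw [(hder x).deriv]; exact hc.trans_le (hpc x)
  have hGc : Continuous G := continuous_iff_continuousAt.2 fun x => (hder x).continuousAt
  have hdiff : ∀ x y, x ≤ y → c * (y - x) ≤ G y - G x := by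
    intro x y hxy
    have : Monotone (fun x => G x - c * x) := by
      apply monotone_of_hasDerivAt_nonneg (f' := fun x => p x - c)
      · intro x
        have := (hder x).sub ((hasDerivAt_id x).const_mul c)
        exact this.congr_deriv (by simp)
      · intro x; simpa using hpc x
    have := this hxy
    simp only at this
    linarith
  have htop : Tendsto G atTop atTop := by
    have h1 : Tendsto (fun x => G 0 + c * x) atTop atTop :=
      tendsto_atTop_add_const_left _ _ (tendsto_id.const_mul_atTop hc)
    refine tendsto_atTop_mono' _ ?_ h1
    filter_upwards [eventually_ge_atTop 0] with x hx
    have := hdiff 0 x hx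
    simp at this; linarith
  have hbot : Tendsto G atBot atBot := by
    have h1 : Tendsto (fun x => G 0 + c * x) atBot atBot :=
      tendsto_atBot_add_const_left _ _ (tendsto_id.const_mul_atBot hc)
    refine tendsto_atBot_mono' _ ?_ h1
    filter_upwards [eventually_le_atBot 0] with x hx
    have := hdiff x 0 hx
    simp at this; linarith
  have hsurj : Function.Surjective G := hGc.surjective htop hbot
  let e := hmono.orderIsoOfSurjective G hsurj
  have he : ∀ x, e x = G x := fun x => rfl
  have h1 : ∀ y, G (e.symm y) = y := fun y => by rw [← he]; simp
  refine ⟨e.symm, h1, fun x => ?_, e.symm.strictMono, fun y => ?_⟩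
  · change e.symm (G x) = x
    rw [← he]; simp
  · exact HasDerivAt.of_local_left_inverse e.symm.continuous.continuousAt (hder _)
      (hc.trans_le (hpc _)).ne' (Eventually.of_forall h1)

lemma lsi_interval (R : ℝ) (hR : 0 < R) (u u' : ℝ → ℝ) (hu : ∀ x, HasDerivAt u (u' x) x)
    (hu'c : Continuous u') (c : ℝ) (hc : 0 < c) (huc : ∀ x, c ≤ u x) :
    (∫ x in (-R)..R, u x * log (u x) * exp (-x^2/2)) -
      (∫ x in (-R)..R, u x * exp (-x^2/2)) *
        log ((∫ x in (-R)..R, u x * exp (-x^2/2)) / ∫ x in (-R)..R, exp (-x^2/2)) ≤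
      1/2 * ∫ x in (-R)..R, (u' x)^2 / u x * exp (-x^2/2) := by
  have hucont : Continuous u := continuous_iff_continuousAt.2 fun x => (hu x).continuousAt
  have hupos : ∀ x, 0 < u x := fun x => hc.trans_le (huc x)
  have hRR : -R < R := by linarith
  set p : ℝ → ℝ := fun x => exp (-(min (x^2) (R^2))/2) with hp
  have hpc : Continuous p := by fun_prop
  have hplow : ∀ x, exp (-R^2/2) ≤ p x := fun x => by
    apply exp_le_exp.2
    have := min_le_right (x^2) (R^2); linarith
  have hpeq : ∀ x ∈ Icc (-R) R, p x = exp (-x^2/2) := by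
    intro x hx
    simp only [hp]
    rw [min_eq_left (sq_le_sq' hx.1 hx.2)]
  obtain ⟨K, hK1, hK2, hKm, hKd⟩ := aux_inverse p hpc _ (exp_pos _) hplow (-R)
  set Z := ∫ x in (-R)..R, exp (-x^2/2) with hZ
  set A := ∫ x in (-R)..R, u x * exp (-x^2/2) with hA
  have hZpos : 0 < Z := intervalIntegral.intervalIntegral_pos_of_pos
    (Continuous.intervalIntegrable (by fun_prop) _ _) (fun x => exp_pos _) hRR
  have hApos : 0 < A := intervalIntegral.intervalIntegral_pos_of_pos
    (Continuous.intervalIntegrable (by fun_prop) _ _) (fun x => mul_pos (hupos x) (exp_pos _)) hRR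
  set M := A / Z with hM
  have hMpos : 0 < M := div_pos hApos hZpos
  set U : ℝ → ℝ := fun x => ∫ t in (-R)..x, u t * exp (-t^2/2) with hU
  have hUd : ∀ x, HasDerivAt U (u x * exp (-x^2/2)) x := fun x => by
    have hcc : Continuous fun t => u t * exp (-t^2/2) := by fun_prop
    exact intervalIntegral.integral_hasDerivAt_right (hcc.intervalIntegrable _ _)
      hcc.aestronglyMeasurable.stronglyMeasurableAtFilter hcc.continuousAt
  have hUm : StrictMono U := strictMono_of_deriv_pos fun x => by
    rw [(hUd x).deriv]; exact mul_pos (hupos x) (exp_pos _)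
  set T : ℝ → ℝ := fun x => K (U x / M) with hT
  have hpZ : (∫ t in (-R)..R, p t) = Z := by
    apply intervalIntegral.integral_congr
    intro x hx
    rw [uIcc_of_le hRR.le] at hx
    exact hpeq x hx
  have hT0 : T (-R) = -R := by
    have := hK2 (-R)
    simpa [hT, hU] using this
  have hT1 : T R = R := by
    have := hK2 R
    rw [hpZ] at this
    simp only [hT, hU]
    rw [← hA, hM]
    rw [div_div_cancel₀ hApos.ne']; exact this
  have hTm : StrictMono T := fun x y hxy => hKm (div_lt_div_of_pos_right (hUm hxy) hMpos)
  have hTmem : ∀ x ∈ Icc (-R) R, T x ∈ Icc (-R) R := fun x hx =>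
    ⟨hT0 ▸ hTm.monotone hx.1, hT1 ▸ hTm.monotone hx.2⟩
  set T' : ℝ → ℝ := fun x => (p (T x))⁻¹ * (u x * exp (-x^2/2) / M) with hT'
  have hTd : ∀ x, HasDerivAt T (T' x) x := fun x =>
    HasDerivAt.comp x (hKd (U x / M)) ((hUd x).div_const M)
  have hTc : Continuous T := continuous_iff_continuousAt.2 fun x => (hTd x).continuousAt
  have hpne : ∀ x, p (T x) ≠ 0 := fun x => (exp_pos _).ne'
  have hT'c : Continuous T' := by
    simp only [hT']
    exact ((hpc.comp hTc).inv₀ hpne).mul (by fun_prop)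
  have hT'pos : ∀ x, 0 < T' x := fun x =>
    mul_pos (inv_pos.2 (exp_pos _)) (div_pos (mul_pos (hupos x) (exp_pos _)) hMpos)
  have hpt : ∀ x ∈ Icc (-R) R, u x * log (u x) * exp (-x^2/2) - u x * exp (-x^2/2) * log M ≤
      (u x * ((T' x - 1) * exp (-x^2/2) + (T x - x) * (-x * exp (-x^2/2)))
        + u' x * ((T x - x) * exp (-x^2/2))) + 1/2 * ((u' x)^2 / u x * exp (-x^2/2)) := by
    intro x hx
    have e1 : log (u x) - log M = log (T' x) - (T x)^2/2 + x^2/2 := by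
      have : T' x = exp ((T x)^2/2 - x^2/2) * (u x / M) := by
        simp only [hT']
        rw [hpeq _ (hTmem x hx), ← exp_neg, sub_eq_add_neg, exp_add]
        ring_nf
      rw [this, log_mul (exp_pos _).ne' (div_pos (hupos x) hMpos).ne', log_exp,
        log_div (hupos x).ne' hMpos.ne']
      ring
    have e2 : log (T' x) ≤ T' x - 1 := log_le_sub_one_of_pos (hT'pos x)
    have e3 : 0 ≤ (u' x + u x * (T x - x))^2 / (2 * u x) := by
      have := hupos x; positivity
    have e4 : (u' x + u x * (T x - x))^2 / (2 * u x) =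
        1/2 * ((u' x)^2 / u x) + u' x * (T x - x) + u x * (T x - x)^2/2 := by
      have := (hupos x).ne'
      field_simp; ring
    have e5 : u x * (log (u x) - log M) ≤ u x * (T' x - 1 - (T x)^2/2 + x^2/2) := by
      rw [e1]
      exact mul_le_mul_of_nonneg_left (by linarith) (hupos x).le
    have e6 : u x * (log (u x) - log M) ≤ u x * ((T' x - 1) + (T x - x) * (-x)) + u' x * (T x - x)
      + 1/2 * ((u' x)^2 / u x) := by nlinarith
    have := mul_le_mul_of_nonneg_right e6 (exp_pos (-x^2/2)).le
    nlinarith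
  have hlogc : Continuous fun x => log (u x) := hucont.log fun x => (hupos x).ne'
  have hqc : Continuous fun x => (u' x)^2 / u x := (hu'c.pow 2).div hucont fun x => (hupos x).ne'
  have hibp : ∫ x in (-R)..R, (u x * ((T' x - 1) * exp (-x^2/2) + (T x - x) * (-x * exp (-x^2/2)))
        + u' x * ((T x - x) * exp (-x^2/2))) = 0 := by
    have hd : ∀ x ∈ uIcc (-R) R, HasDerivAt (fun x => u x * ((T x - x) * exp (-x^2/2)))
      (u x * ((T' x - 1) * exp (-x^2/2) + (T x - x) * (-x * exp (-x^2/2)))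
        + u' x * ((T x - x) * exp (-x^2/2))) x := by
      intro x _
      have he : HasDerivAt (fun x : ℝ => exp (-x^2/2)) (-x * exp (-x^2/2)) x := by
        have : HasDerivAt (fun x : ℝ => -x^2/2) (-x) x := by
          have := ((hasDerivAt_pow 2 x).neg).div_const 2
          refine this.congr_deriv ?_
          simp; ring
        have := this.exp
        rwa [mul_comm] at this
      have := (hu x).mul (((hTd x).sub (hasDerivAt_id x)).mul he)
      refine this.congr_deriv ?_
      simp; ring
    rw [intervalIntegral.integral_eq_sub_of_hasDerivAt hd
      (Continuous.intervalIntegrable (by fun_prop) _ _), hT0, hT1]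
    simp
  have hLHS : (∫ x in (-R)..R, u x * log (u x) * exp (-x^2/2)) - A * log M =
      ∫ x in (-R)..R, (u x * log (u x) * exp (-x^2/2) - u x * exp (-x^2/2) * log M) := by
    rw [intervalIntegral.integral_sub (Continuous.intervalIntegrable (by fun_prop) _ _)
      (Continuous.intervalIntegrable (by fun_prop) _ _), intervalIntegral.integral_mul_const]
  rw [hLHS]
  refine (intervalIntegral.integral_mono_on hRR.le (Continuous.intervalIntegrable (by fun_prop) _ _)
    (Continuous.intervalIntegrable (by fun_prop) _ _) hpt).trans ?_
  rw [intervalIntegral.integral_add (Continuous.intervalIntegrable (by fun_prop) _ _)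
      (Continuous.intervalIntegrable (by fun_prop) _ _), hibp, intervalIntegral.integral_const_mul]
  simp

lemma lsi_real (u u' : ℝ → ℝ) (hu : ∀ x, HasDerivAt u (u' x) x)
    (hu'c : Continuous u') (c C L : ℝ) (hc : 0 < c) (huc : ∀ x, c ≤ u x) (huC : ∀ x, u x ≤ C)
    (hu'L : ∀ x, |u' x| ≤ L) :
    (∫ x, u x * log (u x) ∂(ProbabilityTheory.gaussianReal 0 1)) -
      (∫ x, u x ∂(ProbabilityTheory.gaussianReal 0 1)) *
        log (∫ x, u x ∂(ProbabilityTheory.gaussianReal 0 1)) ≤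
      1/2 * ∫ x, (u' x)^2 / u x ∂(ProbabilityTheory.gaussianReal 0 1) := by
  have hucont : Continuous u := continuous_iff_continuousAt.2 fun x => (hu x).continuousAt
  have hupos : ∀ x, 0 < u x := fun x => hc.trans_le (huc x)
  have hlogc : Continuous fun x => log (u x) := hucont.log fun x => (hupos x).ne'
  have hqc : Continuous fun x => (u' x)^2 / u x := (hu'c.pow 2).div hucont fun x => (hupos x).ne'
  have hgi : Integrable (fun x : ℝ => exp (-x^2/2)) := by
    have := integrable_exp_neg_mul_sq (b := 1/2) (by norm_num)
    refine this.congr (Eventually.of_forall fun x => ?_)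
    simp only; ring_nf
  have key : ∀ F : ℝ → ℝ, Continuous F → (∃ B, ∀ x, |F x| ≤ B) →
      Integrable (fun x => F x * exp (-x^2/2)) := by
    rintro F hF ⟨B, hB⟩
    exact hgi.bdd_mul hF.aestronglyMeasurable (c := B) (Eventually.of_forall fun x => by simpa using hB x)
  have lim : ∀ F : ℝ → ℝ, Integrable F →
      Tendsto (fun R : ℝ => ∫ x in (-R)..R, F x) atTop (𝓝 (∫ x, F x)) := fun F hF =>
    intervalIntegral_tendsto_integral hF tendsto_neg_atTop_atBot tendsto_id
  have hb1 : Integrable (fun x => u x * exp (-x^2/2)) :=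
    key u hucont ⟨C, fun x => by rw [abs_of_pos (hupos x)]; exact huC x⟩
  have hb2 : Integrable (fun x => u x * log (u x) * exp (-x^2/2)) := by
    apply key _ (by fun_prop)
    obtain ⟨B, hB⟩ := (isCompact_Icc (a := c) (b := C)).exists_bound_of_continuousOn
      (f := fun t => t * log t) (by exact Real.continuous_mul_log.continuousOn)
    exact ⟨B, fun x => hB (u x) ⟨huc x, huC x⟩⟩
  have hb3 : Integrable (fun x => (u' x)^2 / u x * exp (-x^2/2)) := by
    apply key _ hqc
    refine ⟨L^2 / c, fun x => ?_⟩
    rw [abs_of_nonneg (div_nonneg (sq_nonneg _) (hupos x).le)]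
    have := hu'L x
    have h0 := abs_nonneg (u' x)
    rw [← sq_abs (u' x)]
    gcongr
    exact huc x
  have hintg : ∀ F : ℝ → ℝ, ∫ x, F x ∂(ProbabilityTheory.gaussianReal 0 1) =
      (∫ x, F x * exp (-x^2/2)) / √(2 * π) := by
    intro F
    rw [ProbabilityTheory.integral_gaussianReal_eq_integral_smul (by simp), ← integral_div]
    congr 1; ext x
    simp [ProbabilityTheory.gaussianPDFReal]
    ring
  have hZ : ∫ x : ℝ, exp (-x^2/2) = √(2 * π) := by
    have := integral_gaussian (1/2)
    rw [show (2 * π) = π / (1/2) by ring, ← this]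
    congr 1; ext x; ring_nf
  have hZpos : 0 < √(2 * π) := by positivity
  have hApos : 0 < ∫ x, u x * exp (-x^2/2) := by
    calc 0 < c * √(2 * π) := by positivity
      _ = ∫ x, c * exp (-x^2/2) := by rw [integral_const_mul, hZ]
      _ ≤ _ := integral_mono (hgi.const_mul c) hb1 fun x =>
        mul_le_mul_of_nonneg_right (huc x) (exp_pos _).le
  rw [hintg, hintg, hintg]
  have hlim := le_of_tendsto_of_tendsto
    (((lim _ hb2).sub ((lim _ hb1).mul (Tendsto.log ((lim _ hb1).div (lim _ hgi) (by rw [hZ]; exact hZpos.ne'))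
      (by rw [hZ]; exact (div_pos hApos hZpos).ne')))))
    ((lim _ hb3).const_mul (1/2)) (by
      filter_upwards [eventually_gt_atTop 0] with R hR
      exact lsi_interval R hR u u' hu hu'c c hc huc)
  rw [hZ] at hlim
  have hfin := div_le_div_of_nonneg_right hlim hZpos.le
  rw [sub_div, mul_div_right_comm, mul_div_assoc (1/2)] at hfin
  exact hfin

/-- product Gaussian measure -/
noncomputable abbrev gPi (n : ℕ) : Measure (Fin n → ℝ) :=
  Measure.pi (fun _ => ProbabilityTheory.gaussianReal 0 1)

/-- The linear map `(x,y) ↦ Fin.cons x y`. -/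
noncomputable def consL (n : ℕ) : ℝ × (Fin n → ℝ) →L[ℝ] (Fin (n+1) → ℝ) :=
  ContinuousLinearMap.pi (Fin.cases (ContinuousLinearMap.fst ℝ ℝ (Fin n → ℝ))
    (fun i => (ContinuousLinearMap.proj i).comp (ContinuousLinearMap.snd ℝ ℝ (Fin n → ℝ))))

lemma consL_apply (n : ℕ) (p : ℝ × (Fin n → ℝ)) : consL n p = Fin.cons p.1 p.2 := by
  ext i
  refine Fin.cases ?_ (fun i => ?_) i <;> simp [consL]

lemma consL_e0 (n : ℕ) : consL n (1, 0) = Pi.single 0 1 := by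
  rw [consL_apply]; ext i
  refine Fin.cases ?_ (fun i => ?_) i <;> simp

lemma consL_es (n : ℕ) (i : Fin n) : consL n (0, Pi.single i 1) = Pi.single i.succ 1 := by
  rw [consL_apply]; ext j
  refine Fin.cases ?_ (fun j => ?_) j
  · simp
  · simp [Pi.single_apply]

lemma gPi_succ_integral (n : ℕ) (F : (Fin (n+1) → ℝ) → ℝ) :
    ∫ z, F z ∂(gPi (n+1)) =
      ∫ p, F (consL n p) ∂((ProbabilityTheory.gaussianReal 0 1).prod (gPi n)) := by
  have := (measurePreserving_piFinSuccAbove (n := n) (α := fun _ => ℝ)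
    (fun _ => ProbabilityTheory.gaussianReal 0 1) 0).symm
  rw [← this.integral_comp (MeasurableEquiv.measurableEmbedding _)]
  refine integral_congr_ae (Eventually.of_forall fun p => ?_)
  simp only [consL_apply]
  congr 1
  change Fin.insertNth (α := fun _ => ℝ) 0 p.1 p.2 = _
  ext i
  refine Fin.cases ?_ (fun i => ?_) i <;> simp

lemma gPi_succ_integral' (n : ℕ) (F : (Fin (n+1) → ℝ) → ℝ) (hF : Continuous F)
    (B : ℝ) (hB : ∀ z, |F z| ≤ B) :
    ∫ z, F z ∂(gPi (n+1)) =
      ∫ x, ∫ y, F (consL n (x, y)) ∂(gPi n) ∂(ProbabilityTheory.gaussianReal 0 1) := by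
  rw [gPi_succ_integral, integral_prod]
  exact Integrable.of_bound (by fun_prop) B (Eventually.of_forall fun p => hB _)

lemma cs_aux {α : Type*} [MeasurableSpace α] (μ : Measure α) (a u : α → ℝ) (hu : ∀ x, 0 < u x)
    (hm : 0 < ∫ x, u x ∂μ) (hiu : Integrable u μ) (hia : Integrable a μ)
    (hq : Integrable (fun x => (a x)^2 / u x) μ) :
    (∫ x, a x ∂μ)^2 / (∫ x, u x ∂μ) ≤ ∫ x, (a x)^2 / u x ∂μ := by
  set m := ∫ x, u x ∂μ
  set b := ∫ x, a x ∂μ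
  have h0 : 0 ≤ ∫ x, ((a x)^2 / u x - 2 * (b/m) * a x + (b/m)^2 * u x) ∂μ := by
    apply integral_nonneg
    intro x
    have : (a x)^2 / u x - 2 * (b/m) * a x + (b/m)^2 * u x = (a x - (b/m) * u x)^2 / u x := by
      have := (hu x).ne'
      field_simp; ring
    simp only [Pi.zero_apply]
    rw [this]
    exact div_nonneg (sq_nonneg _) (hu x).le
  rw [integral_add (f := fun x => (a x)^2 / u x - 2 * (b/m) * a x) (hq.sub (hia.const_mul _)) (hiu.const_mul _), integral_sub hq (hia.const_mul _),
    integral_const_mul, integral_const_mul] at h0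
  change 0 ≤ _ - 2 * (b/m) * b + (b/m)^2 * m at h0
  have : 2 * (b/m) * b - (b/m)^2 * m = b^2/m := by
    field_simp; ring
  linarith

lemma lsi_pi (n : ℕ) : ∀ (u : (Fin n → ℝ) → ℝ), ContDiff ℝ 1 u → ∀ (c C L : ℝ), 0 < c →
    (∀ x, c ≤ u x) → (∀ x, u x ≤ C) → (∀ x, ‖fderiv ℝ u x‖ ≤ L) →
    (∫ x, u x * log (u x) ∂(gPi n)) - (∫ x, u x ∂(gPi n)) * log (∫ x, u x ∂(gPi n)) ≤
      1/2 * ∫ x, (∑ i, (fderiv ℝ u x (Pi.single i 1))^2) / u x ∂(gPi n) := by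
  induction n with
  | zero =>
    intro u hu c C L hc huc huC huL
    have h0 : gPi 0 = Measure.dirac 0 := by
      rw [gPi, Measure.pi_of_empty _ 0]
    rw [h0]
    simp
  | succ n ih =>
    intro u hu c C L hc huc huC huL
    have hupos : ∀ x, 0 < u x := fun x => hc.trans_le (huc x)
    have hucont : Continuous u := hu.continuous
    have hud : Differentiable ℝ u := hu.differentiable (by norm_num)
    have hfc : Continuous (fderiv ℝ u) := hu.continuous_fderiv (by norm_num)
    have hlogc : Continuous fun x => log (u x) := hucont.log fun x => (hupos x).ne'
    have hqc : ∀ w, Continuous fun x => (fderiv ℝ u x w)^2 / u x := fun w =>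
      ((hfc.clm_apply continuous_const).pow 2).div hucont fun x => (hupos x).ne'
    have hL0 : 0 ≤ L := (norm_nonneg _).trans (huL 0)
    have hdb : ∀ x w, |fderiv ℝ u x w| ≤ L * ‖w‖ := fun x w =>
      ((fderiv ℝ u x).le_opNorm w).trans (mul_le_mul_of_nonneg_right (huL x) (norm_nonneg _))
    have hqb : ∀ x w, |(fderiv ℝ u x w)^2 / u x| ≤ (L * ‖w‖)^2 / c := fun x w => by
      rw [abs_of_nonneg (div_nonneg (sq_nonneg _) (hupos x).le), ← sq_abs]
      have := hdb x w
      gcongr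
      exact huc x
    obtain ⟨B, hB⟩ := (isCompact_Icc (a := c) (b := C)).exists_bound_of_continuousOn
      (f := fun t => t * log t) (by exact Real.continuous_mul_log.continuousOn)
    have hub : ∀ x, |u x| ≤ C := fun x => by rw [abs_of_pos (hupos x)]; exact huC x
    have hulb : ∀ x, |u x * log (u x)| ≤ B := fun x => hB (u x) ⟨huc x, huC x⟩
    set Q := consL n with hQ
    set γ := ProbabilityTheory.gaussianReal 0 1 with hγ
    have inty : ∀ F : (Fin (n+1) → ℝ) → ℝ, Continuous F → ∀ B, (∀ z, |F z| ≤ B) → ∀ x,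
        Integrable (fun y => F (Q (x, y))) (gPi n) := fun F hF B hB x =>
      Integrable.of_bound (by fun_prop) B (Eventually.of_forall fun p => hB _)
    have intx : ∀ F : (Fin (n+1) → ℝ) → ℝ, Continuous F → ∀ B, (∀ z, |F z| ≤ B) →
        Integrable (fun x => ∫ y, F (Q (x, y)) ∂(gPi n)) γ := fun F hF B hB => by
      have : Integrable (fun p => F (Q p)) (γ.prod (gPi n)) :=
        Integrable.of_bound (by fun_prop) B (Eventually.of_forall fun p => hB _)
      exact this.integral_prod_left
    have conty : ∀ F : (Fin (n+1) → ℝ) → ℝ, Continuous F → ∀ B, (∀ z, |F z| ≤ B) →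
        Continuous (fun x => ∫ y, F (Q (x, y)) ∂(gPi n)) := fun F hF B hB =>
      continuous_of_dominated (bound := fun _ => B) (fun x => (inty F hF B hB x).aestronglyMeasurable)
        (fun x => Eventually.of_forall fun y => hB _) (integrable_const _)
        (Eventually.of_forall fun y => by fun_prop)
    set e0 : Fin (n+1) → ℝ := Pi.single 0 1 with he0
    set m : ℝ → ℝ := fun x => ∫ y, u (Q (x, y)) ∂(gPi n) with hm
    set m' : ℝ → ℝ := fun x => ∫ y, fderiv ℝ u (Q (x, y)) e0 ∂(gPi n) with hm'
    have hmc : ∀ x, c ≤ m x := fun x => by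
      have := integral_mono (integrable_const c) (inty u hucont C hub x) (fun y => huc (Q (x, y)))
      simpa using this
    have hmC : ∀ x, m x ≤ C := fun x => by
      have := integral_mono (inty u hucont C hub x) (integrable_const C) (fun y => huC (Q (x, y)))
      simpa using this
    have hmL : ∀ x, |m' x| ≤ L * ‖e0‖ := fun x => by
      have := norm_integral_le_of_norm_le_const (μ := gPi n) (C := L * ‖e0‖)
        (f := fun y => fderiv ℝ u (Q (x, y)) e0) (Eventually.of_forall fun y => hdb _ _)
      simpa using this
    have hfe : Continuous fun z => fderiv ℝ u z e0 := hfc.clm_apply continuous_const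
    have hm'c : Continuous m' := conty _ hfe _ (fun z => hdb z e0)
    have hmd : ∀ x, HasDerivAt m (m' x) x := by
      intro x
      refine (hasDerivAt_integral_of_dominated_loc_of_deriv_le (μ := gPi n)
        (F := fun x y => u (Q (x, y))) (F' := fun x y => fderiv ℝ u (Q (x, y)) e0)
        (bound := fun _ => L * ‖e0‖) (s := univ) univ_mem
        (Eventually.of_forall fun x => (inty u hucont C hub x).aestronglyMeasurable)
        (inty u hucont C hub x) (inty _ hfe _ (fun z => hdb z e0) x).aestronglyMeasurable
        (Eventually.of_forall fun y x _ => hdb _ _) (integrable_const _)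
        (Eventually.of_forall fun y x _ => ?_)).2
      have h1 : HasDerivAt (fun x : ℝ => (x, y)) (1, 0) x :=
        (hasDerivAt_id x).prodMk (hasDerivAt_const x y)
      have h2 := Q.hasFDerivAt.comp_hasDerivAt x h1
      rw [hQ, consL_e0] at h2
      exact (hud _).hasFDerivAt.comp_hasDerivAt x h2
    have step1 := lsi_real m m' hmd hm'c c C _ hc hmc hmC hmL
    have hmint : ∫ z, u z ∂(gPi (n+1)) = ∫ x, m x ∂γ := gPi_succ_integral' n u hucont C hub
    have step2 : ∀ x, m' x^2 / m x ≤ ∫ y, (fderiv ℝ u (Q (x, y)) e0)^2 / u (Q (x,y)) ∂(gPi n) :=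
      fun x => cs_aux (gPi n) _ _ (fun y => hupos _) (hc.trans_le (hmc x)) (inty u hucont C hub x)
        (inty _ hfe _ (fun z => hdb z e0) x) (inty _ (hqc e0) _ (fun z => hqb z e0) x)
    have hmcont : Continuous m := conty u hucont C hub
    have hmpos : ∀ x, 0 < m x := fun x => hc.trans_le (hmc x)
    have step2' : ∫ x, m' x^2 / m x ∂γ ≤
        ∫ z, (fderiv ℝ u z e0)^2 / u z ∂(gPi (n+1)) := by
      rw [gPi_succ_integral' n _ (hqc e0) _ (fun z => hqb z e0)]
      refine integral_mono ?_ (intx _ (hqc e0) _ (fun z => hqb z e0)) step2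
      refine Integrable.of_bound (C := (L * ‖e0‖)^2 / c) ?_ (Eventually.of_forall fun x => ?_)
      · exact ((hm'c.pow 2).div hmcont fun x => (hmpos x).ne').aestronglyMeasurable
      · rw [Real.norm_eq_abs, abs_of_nonneg (div_nonneg (sq_nonneg _) (hmpos x).le), ← sq_abs]
        have := hmL x
        gcongr
        exact hmc x
    have hsumc : Continuous fun z => (∑ i : Fin n, (fderiv ℝ u z (Pi.single i.succ 1))^2) / u z :=
      (continuous_finsetSum _ fun i _ => (hfc.clm_apply continuous_const).pow 2).div hucont
        fun x => (hupos x).ne'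
    have hsumb : ∃ D, ∀ z, |(∑ i : Fin n, (fderiv ℝ u z (Pi.single i.succ 1))^2) / u z| ≤ D := by
      refine ⟨∑ i : Fin n, (L * ‖(Pi.single i.succ 1 : Fin (n+1) → ℝ)‖)^2 / c, fun z => ?_⟩
      rw [Finset.sum_div]
      exact (Finset.abs_sum_le_sum_abs _ _).trans (Finset.sum_le_sum fun i _ => hqb z _)
    obtain ⟨D, hD⟩ := hsumb
    have step3 : ∀ x, (∫ y, u (Q (x,y)) * log (u (Q (x,y))) ∂(gPi n)) - m x * log (m x) ≤
        1/2 * ∫ y, (∑ i : Fin n, (fderiv ℝ u (Q (x,y)) (Pi.single i.succ 1))^2) / u (Q (x,y)) ∂(gPi n) := by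
      intro x
      set J := Q.comp (ContinuousLinearMap.inr ℝ ℝ (Fin n → ℝ)) with hJ
      have hfd : ∀ y, HasFDerivAt (fun y => u (Q (x,y))) ((fderiv ℝ u (Q (x,y))).comp J) y := by
        intro y
        have h2 : HasFDerivAt (fun y => Q (x, y)) J y :=
          Q.hasFDerivAt.comp y (hasFDerivAt_prodMk_right x y)
        exact (hud _).hasFDerivAt.comp y h2
      have := ih (fun y => u (Q (x,y))) (by
          have : ContDiff ℝ 1 (fun y : Fin n → ℝ => Q (x, y)) := Q.contDiff.comp (by fun_prop)
          exact hu.comp this) c C (L * ‖J‖) hc (fun y => huc _) (fun y => huC _) (fun y => by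
          rw [(hfd y).fderiv]
          exact ((fderiv ℝ u (Q (x,y))).opNorm_comp_le J).trans
            (mul_le_mul_of_nonneg_right (huL _) (norm_nonneg _)))
      refine this.trans (le_of_eq ?_)
      congr 2; ext y
      congr 2; ext i
      rw [(hfd y).fderiv]
      simp only [ContinuousLinearMap.comp_apply, hJ, ContinuousLinearMap.inr_apply]
      rw [hQ, consL_es]
    have hmlog : Integrable (fun x => m x * log (m x)) γ := by
      refine Integrable.of_bound (C := B) ?_ (Eventually.of_forall fun x => hB (m x) ⟨hmc x, hmC x⟩)
      exact (Real.continuous_mul_log.comp hmcont).aestronglyMeasurable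
    have hulc : Continuous fun z => u z * log (u z) := by fun_prop
    have step3' : (∫ z, u z * log (u z) ∂(gPi (n+1))) - ∫ x, m x * log (m x) ∂γ ≤
        1/2 * ∫ z, (∑ i : Fin n, (fderiv ℝ u z (Pi.single i.succ 1))^2) / u z ∂(gPi (n+1)) := by
      rw [gPi_succ_integral' n _ hulc B hulb, gPi_succ_integral' n _ hsumc D hD,
        ← integral_sub (intx _ hulc B hulb) hmlog, ← integral_const_mul]
      exact integral_mono ((intx _ hulc B hulb).sub hmlog) ((intx _ hsumc D hD).const_mul _) step3
    rw [hmint]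
    have hsplit : ∫ z, (∑ i, (fderiv ℝ u z (Pi.single i 1))^2) / u z ∂(gPi (n+1)) =
        (∫ z, (fderiv ℝ u z e0)^2 / u z ∂(gPi (n+1))) +
        ∫ z, (∑ i : Fin n, (fderiv ℝ u z (Pi.single i.succ 1))^2) / u z ∂(gPi (n+1)) := by
      rw [← integral_add]
      · congr 1; ext z
        rw [Fin.sum_univ_succ, add_div]
      · exact Integrable.of_bound (hqc e0).aestronglyMeasurable _ (Eventually.of_forall fun z => hqb z e0)
      · exact Integrable.of_bound hsumc.aestronglyMeasurable _ (Eventually.of_forall hD)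
    rw [hsplit]
    linarith

lemma gPi_density (n : ℕ) : gPi n = volume.withDensity
    (fun x : Fin n → ℝ => ENNReal.ofReal (∏ i, ProbabilityTheory.gaussianPDFReal 0 1 (x i))) := by
  refine Measure.pi_eq fun s hs => ?_
  rw [withDensity_apply _ (MeasurableSet.univ_pi hs), volume_pi, Measure.restrict_pi_pi,
    ← ofReal_integral_eq_lintegral_ofReal, integral_fintype_prod_eq_prod,
    ENNReal.ofReal_prod_of_nonneg]
  · refine Finset.prod_congr rfl fun i _ => ?_
    rw [ProbabilityTheory.gaussianReal_apply_eq_integral 0 (by simp)]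
  · intro i _
    exact integral_nonneg fun x => ProbabilityTheory.gaussianPDFReal_nonneg _ _ _
  · exact Integrable.fintype_prod fun i =>
      (ProbabilityTheory.integrable_gaussianPDFReal 0 1).restrict
  · exact Eventually.of_forall fun x => Finset.prod_nonneg fun i _ =>
      ProbabilityTheory.gaussianPDFReal_nonneg _ _ _

/-- Gaussian measure on Euclidean space. -/
noncomputable def gE (d : ℕ) : Measure (EuclideanSpace ℝ (Fin d)) := (gPi d).map (WithLp.toLp 2)

instance (d : ℕ) : IsProbabilityMeasure (gE d) :=
  Measure.isProbabilityMeasure_map (Measurable.aemeasurable (by fun_prop))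

lemma gE_density (d : ℕ) : gE d = volume.withDensity
    (fun x => ENNReal.ofReal ((2 * π) ^ (-(d:ℝ)/2) * exp (-‖x‖^2/2))) := by
  ext s hs
  rw [gE, Measure.map_apply (by fun_prop) hs, gPi_density, withDensity_apply _ hs,
    withDensity_apply _ ((by fun_prop : Measurable (WithLp.toLp 2)) hs),
    ← (PiLp.volume_preserving_toLp (Fin d)).setLIntegral_comp_preimage hs (by fun_prop)]
  refine lintegral_congr fun x => ?_
  congr 1
  simp only [ProbabilityTheory.gaussianPDFReal, EuclideanSpace.norm_sq_eq]
  rw [Finset.prod_mul_distrib, ← exp_sum, Finset.prod_const]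
  congr 1
  · have h2 : (√(2 * π * ((1 : NNReal) : ℝ)))⁻¹ = (2 * π) ^ (-(1:ℝ)/2) := by
      rw [NNReal.coe_one, mul_one, Real.sqrt_eq_rpow, ← rpow_neg (by positivity)]
      norm_num
    rw [h2, Finset.card_univ, Fintype.card_fin, ← rpow_natCast, ← rpow_mul (by positivity)]
    congr 1; ring
  · simp [neg_div, Finset.sum_div]

lemma gE_integral (d : ℕ) (F : EuclideanSpace ℝ (Fin d) → ℝ) :
    ∫ x, F x ∂(gE d) = ∫ z, F (WithLp.toLp 2 z) ∂(gPi d) := by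
  rw [gE]
  exact MeasurableEmbedding.integral_map (MeasurableEquiv.toLp 2 (Fin d → ℝ)).measurableEmbedding F

lemma lsi_E_eps (d : ℕ) (g : EuclideanSpace ℝ (Fin d) → ℝ) (hg : ContDiff ℝ 1 g) (B L : ℝ)
    (hB : ∀ x, |g x| ≤ B) (hL : ∀ x, ‖fderiv ℝ g x‖ ≤ L) (ε : ℝ) (hε : 0 < ε) :
    (∫ x, (g x ^ 2 + ε) * log (g x ^ 2 + ε) ∂(gE d)) -
      (∫ x, (g x ^ 2 + ε) ∂(gE d)) * log (∫ x, (g x ^ 2 + ε) ∂(gE d)) ≤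
      2 * ∫ x, ‖fderiv ℝ g x‖ ^ 2 ∂(gE d) := by
  set J : (Fin d → ℝ) →L[ℝ] EuclideanSpace ℝ (Fin d) :=
    (PiLp.continuousLinearEquiv 2 ℝ (fun _ : Fin d => ℝ)).symm.toContinuousLinearMap with hJ
  have hJa : ∀ z, J z = WithLp.toLp 2 z := fun z => rfl
  have hJs : ∀ i, J (Pi.single i 1) = EuclideanSpace.basisFun (Fin d) ℝ i := fun i => by
    rw [hJa]; simp [EuclideanSpace.single]
  have hB0 : 0 ≤ B := (abs_nonneg _).trans (hB 0)
  have hL0 : 0 ≤ L := (norm_nonneg _).trans (hL 0)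
  have hgd : Differentiable ℝ g := hg.differentiable (by norm_num)
  have hfc : Continuous (fderiv ℝ g) := hg.continuous_fderiv (by norm_num)
  simp only [gE_integral, ← hJa]
  set u : (Fin d → ℝ) → ℝ := fun z => g (J z) ^ 2 + ε with hu
  have hud : ∀ z, HasFDerivAt u ((2 * g (J z)) • (fderiv ℝ g (J z)).comp J) z := by
    intro z
    have h1 : HasFDerivAt (fun z => g (J z)) ((fderiv ℝ g (J z)).comp J) z :=
      (hgd _).hasFDerivAt.comp z J.hasFDerivAt
    have := (h1.pow 2).add_const ε
    refine this.congr_fderiv ?_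
    ext; simp
  have hcd : ContDiff ℝ 1 u := ((hg.comp J.contDiff).pow 2).add contDiff_const
  have := lsi_pi d u hcd ε (B^2 + ε) (2 * B * (L * ‖J‖)) hε (fun z => by
    simp only [hu]; nlinarith [sq_nonneg (g (J z))]) (fun z => by
    simp only [hu]; rw [← sq_abs]; have := hB (J z); gcongr) (fun z => by
    rw [(hud z).fderiv, norm_smul]
    have h1 : ‖2 * g (J z)‖ ≤ 2 * B := by
      rw [norm_mul]; simpa using hB (J z)
    have h2 : ‖(fderiv ℝ g (J z)).comp J‖ ≤ L * ‖J‖ :=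
      ((fderiv ℝ g (J z)).opNorm_comp_le J).trans
            (mul_le_mul_of_nonneg_right (hL _) (norm_nonneg _))
    gcongr)
  refine this.trans ?_
  have hb : ∀ z, (∑ i, (fderiv ℝ u z (Pi.single i 1))^2) / u z ≤ 4 * ‖fderiv ℝ g (J z)‖^2 := by
    intro z
    have hpos : 0 < u z := by simp only [hu]; positivity
    rw [div_le_iff₀ hpos, (hud z).fderiv]
    have e1 : ∑ i, (((2 * g (J z)) • (fderiv ℝ g (J z)).comp J) (Pi.single i 1))^2 =
        4 * g (J z)^2 * ‖fderiv ℝ g (J z)‖^2 := by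
      rw [(EuclideanSpace.basisFun (Fin d) ℝ).norm_dual, Finset.mul_sum]
      refine Finset.sum_congr rfl fun i _ => ?_
      simp only [_root_.smul_apply, ContinuousLinearMap.comp_apply, hJs, smul_eq_mul, norm_eq_abs, sq_abs]
      ring
    rw [e1]
    simp only [hu]
    nlinarith [mul_nonneg hε.le (sq_nonneg ‖fderiv ℝ g (J z)‖)]
  have hintg : Integrable (fun z => 4 * ‖fderiv ℝ g (J z)‖^2) (gPi d) :=
    Integrable.of_bound (C := 4 * L^2) (by fun_prop) (Eventually.of_forall fun z => by
      rw [Real.norm_of_nonneg (by positivity)]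
      have := hL (J z)
      gcongr)
  have hnn : ∀ z, 0 ≤ (∑ i, (fderiv ℝ u z (Pi.single i 1))^2) / u z := fun z => by
    have : 0 ≤ u z := by simp only [hu]; positivity
    positivity
  have := integral_mono_of_nonneg (Eventually.of_forall hnn) hintg (Eventually.of_forall hb)
  rw [integral_const_mul] at this
  linarith

/-- Gaussian log-Sobolev inequality. -/
lemma lsi_E (d : ℕ) (g : EuclideanSpace ℝ (Fin d) → ℝ) (hg : ContDiff ℝ 1 g) (B L : ℝ)
    (hB : ∀ x, |g x| ≤ B) (hL : ∀ x, ‖fderiv ℝ g x‖ ≤ L) :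
    (∫ x, g x ^ 2 * log (g x ^ 2) ∂(gE d)) -
      (∫ x, g x ^ 2 ∂(gE d)) * log (∫ x, g x ^ 2 ∂(gE d)) ≤
      2 * ∫ x, ‖fderiv ℝ g x‖ ^ 2 ∂(gE d) := by
  obtain ⟨D, hD⟩ := (isCompact_Icc (a := 0) (b := B^2 + 1)).exists_bound_of_continuousOn
      (f := fun t => t * log t) (by exact Real.continuous_mul_log.continuousOn)
  have hgc := hg.continuous
  set ε : ℕ → ℝ := fun n => 1 / ((n:ℝ) + 1) with hεdef
  have hε0 : ∀ n, 0 < ε n := fun n => by positivity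
  have hε1 : ∀ n, ε n ≤ 1 := fun n => by
    simp only [hεdef]; rw [div_le_one (by positivity)]; linarith [(Nat.cast_nonneg n : (0:ℝ) ≤ n)]
  have hεl : Tendsto ε atTop (𝓝 0) := tendsto_one_div_add_atTop_nhds_zero_nat
  have hg2 : ∀ x, g x ^ 2 ≤ B^2 := fun x => by
    rw [← sq_abs]; have := hB x; gcongr
  have hl : ∀ x, Tendsto (fun n => g x ^ 2 + ε n) atTop (𝓝 (g x ^ 2)) := fun x => by
    simpa using hεl.const_add (g x ^2)
  have l1 : Tendsto (fun n => ∫ x, (g x ^ 2 + ε n) * log (g x ^ 2 + ε n) ∂(gE d)) atTop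
      (𝓝 (∫ x, g x ^ 2 * log (g x ^ 2) ∂(gE d))) := by
    refine tendsto_integral_of_dominated_convergence (fun _ => D) (fun n => ?_) (integrable_const _)
      (fun n => Eventually.of_forall fun x => hD _ ⟨?_, ?_⟩) (Eventually.of_forall fun x => ?_)
    · exact (Real.continuous_mul_log.comp (by fun_prop : Continuous fun x => g x ^2 + ε n)).aestronglyMeasurable
    · have := hε0 n; positivity
    · linarith [hg2 x, hε1 n]
    · exact (Real.continuous_mul_log.tendsto _).comp (hl x)
  have l2 : Tendsto (fun n => ∫ x, (g x ^ 2 + ε n) ∂(gE d)) atTop (𝓝 (∫ x, g x ^ 2 ∂(gE d))) := by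
    refine tendsto_integral_of_dominated_convergence (fun _ => B^2 + 1) (fun n => ?_) (integrable_const _)
      (fun n => Eventually.of_forall fun x => ?_) (Eventually.of_forall fun x => hl x)
    · exact (by fun_prop : Continuous fun x => g x ^2 + ε n).aestronglyMeasurable
    · rw [Real.norm_of_nonneg (by have := hε0 n; positivity)]
      linarith [hg2 x, hε1 n]
  have l3 := l1.sub ((Real.continuous_mul_log.tendsto _).comp l2)
  exact le_of_tendsto l3 (Eventually.of_forall fun n => lsi_E_eps d g hg B L hB hL (ε n) (hε0 n))

lemma radial_inverse (k : ℕ) (p : ℝ → ℝ) (hp : ContinuousOn p (Ici 0)) (hpos : ∀ t, 0 ≤ t → 0 < p t)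
    (hintg : IntegrableOn (fun t => t ^ k * p t) (Ioi 0))
    (htot : ∫ t in Ioi (0:ℝ), t ^ k * p t = 1) :
    ∃ K : ℝ → ℝ, (∀ y ∈ Ioo (0:ℝ) 1, 0 < K y ∧ (∫ t in (0:ℝ)..(K y), t ^ k * p t) = y ∧
        HasDerivAt K ((K y) ^ k * p (K y))⁻¹ y) ∧
      (∀ r, 0 < r → (∫ t in (0:ℝ)..r, t ^ k * p t) ∈ Ioo (0:ℝ) 1 ∧
        K (∫ t in (0:ℝ)..r, t ^ k * p t) = r ∧
        HasDerivAt (fun r => ∫ t in (0:ℝ)..r, t ^ k * p t) (r ^ k * p r) r) := by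
  set a : ℝ → ℝ := fun t => t ^ k * p t with ha
  set A : ℝ → ℝ := fun r => ∫ t in (0:ℝ)..r, a t with hA
  have hapos : ∀ t, 0 < t → 0 < a t := fun t ht => mul_pos (pow_pos ht k) (hpos t ht.le)
  have hac : ContinuousOn a (Ici 0) := (continuousOn_id.pow k).mul hp
  have hac' : ContinuousOn a (Ioi 0) := hac.mono Ioi_subset_Ici_self
  have hii : ∀ r, 0 ≤ r → IntervalIntegrable a volume 0 r := fun r hr =>
    (intervalIntegrable_iff_integrableOn_Ioc_of_le hr).2 (hintg.mono_set Ioc_subset_Ioi_self)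
  have hd : ∀ r, 0 < r → HasDerivAt A (a r) r := fun r hr =>
    intervalIntegral.integral_hasDerivAt_right (hii r hr.le)
      (hac'.stronglyMeasurableAtFilter isOpen_Ioi r hr) (hac'.continuousAt (Ioi_mem_nhds hr))
  have hmono : StrictMonoOn A (Ioi 0) := by
    apply strictMonoOn_of_deriv_pos (convex_Ioi 0)
    · exact fun r hr => (hd r hr).continuousAt.continuousWithinAt
    · intro r hr
      rw [interior_Ioi] at hr
      rw [(hd r hr).deriv]; exact hapos r hr
  have hA0 : ∀ r, 0 < r → 0 < A r := fun r hr =>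
    intervalIntegral.intervalIntegral_pos_of_pos_on (hii r hr.le) (fun t ht => hapos t ht.1) hr
  have hA1 : ∀ r, 0 < r → A r ≤ 1 := fun r hr => by
    simp only [hA]
    rw [← htot, intervalIntegral.integral_of_le hr.le]
    refine setIntegral_mono_set hintg ?_ (Eventually.of_forall Ioc_subset_Ioi_self)
    filter_upwards [ae_restrict_mem measurableSet_Ioi] with t ht
    exact (hapos t ht).le
  have hAI : ∀ r, 0 < r → A r ∈ Ioo (0:ℝ) 1 := fun r hr =>
    ⟨hA0 r hr, (hmono hr (by simp; linarith : r + 1 ∈ Ioi (0:ℝ)) (by linarith)).trans_le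
      (hA1 (r+1) (by linarith))⟩
  have hlim : Tendsto A atTop (𝓝 1) := by
    rw [← htot]; exact intervalIntegral_tendsto_integral_Ioi 0 hintg tendsto_id
  have hsurj : ∀ y ∈ Ioo (0:ℝ) 1, ∃ r, 0 < r ∧ A r = y := by
    intro y hy
    obtain ⟨N, hN1, hN2⟩ := ((hlim.eventually (lt_mem_nhds hy.2)).and (eventually_gt_atTop 0)).exists
    have hc : ContinuousOn A (Icc 0 N) := by
      have := intervalIntegral.continuousOn_primitive_interval (f := a) (a := 0) (b := N) (μ := volume)
        (by rw [uIcc_of_le hN2.le]; exact (hac.mono Icc_subset_Ici_self).integrableOn_Icc)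
      rwa [uIcc_of_le hN2.le] at this
    have := intermediate_value_Ioo hN2.le hc
    have h0 : A 0 = 0 := by simp [hA]
    rw [h0] at this
    obtain ⟨r, hr, hry⟩ := this ⟨hy.1, hN1⟩
    exact ⟨r, hr.1, hry⟩
  choose! K hK1 hK2 using hsurj
  have hKA : ∀ r, 0 < r → K (A r) = r := fun r hr =>
    hmono.injOn (hK1 _ (hAI r hr)) hr (hK2 _ (hAI r hr))
  have hKm : MonotoneOn K (Ioo 0 1) := fun x hx y hy hxy => by
    by_contra! h
    have := hmono (hK1 y hy) (hK1 x hx) h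
    rw [hK2 x hx, hK2 y hy] at this
    linarith
  have himg : K '' Ioo 0 1 = Ioi 0 := by
    ext r; constructor
    · rintro ⟨y, hy, rfl⟩; exact hK1 y hy
    · intro hr; exact ⟨A r, hAI r hr, hKA r hr⟩
  refine ⟨K, fun y hy => ⟨hK1 y hy, hK2 y hy, ?_⟩, fun r hr => ⟨hAI r hr, hKA r hr, hd r hr⟩⟩
  refine HasDerivAt.of_local_left_inverse ?_ (hd _ (hK1 y hy)) (hapos _ (hK1 y hy)).ne' ?_
  · exact continuousAt_of_monotoneOn_of_image_mem_nhds hKm (isOpen_Ioo.mem_nhds hy)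
      (by rw [himg]; exact Ioi_mem_nhds (hK1 y hy))
  · filter_upwards [isOpen_Ioo.mem_nhds hy] with z hz using hK2 z hz

lemma radial_map (k : ℕ) (p q : ℝ → ℝ) (hp : ContinuousOn p (Ici 0)) (hppos : ∀ t, 0 ≤ t → 0 < p t)
    (hpint : IntegrableOn (fun t => t ^ k * p t) (Ioi 0))
    (hptot : ∫ t in Ioi (0:ℝ), t ^ k * p t = 1)
    (hq : ContinuousOn q (Ici 0)) (hqpos : ∀ t, 0 ≤ t → 0 < q t)
    (hqint : IntegrableOn (fun t => t ^ k * q t) (Ioi 0))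
    (hqtot : ∫ t in Ioi (0:ℝ), t ^ k * q t = 1) :
    ∃ s : ℝ → ℝ, (∀ r, 0 < r → 0 < s r ∧
        (∫ t in (0:ℝ)..(s r), t ^ k * p t) = (∫ t in (0:ℝ)..r, t ^ k * q t) ∧
        HasDerivAt s (r ^ k * q r / ((s r) ^ k * p (s r))) r) ∧
      StrictMonoOn s (Ioi 0) ∧ s '' Ioi 0 = Ioi 0 ∧
      ∀ r₁, 0 < r₁ → ∃ C, ∀ r, 0 < r → r ≤ r₁ → s r ≤ C * r ∧
        r ^ k * q r / ((s r) ^ k * p (s r)) ≤ C := by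
  obtain ⟨K, hK1, hK2⟩ := radial_inverse k p hp hppos hpint hptot
  obtain ⟨H, hH1, hH2⟩ := radial_inverse k q hq hqpos hqint hqtot
  set A : ℝ → ℝ := fun r => ∫ t in (0:ℝ)..r, t ^ k * p t with hA
  set B : ℝ → ℝ := fun r => ∫ t in (0:ℝ)..r, t ^ k * q t with hB
  have hs0 : ∀ r, 0 < r → 0 < K (B r) := fun r hr => (hK1 _ (hH2 r hr).1).1
  have hsA : ∀ r, 0 < r → A (K (B r)) = B r := fun r hr => (hK1 _ (hH2 r hr).1).2.1
  have hsd : ∀ r, 0 < r → HasDerivAt (fun r => K (B r))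
      (r ^ k * q r / ((K (B r)) ^ k * p (K (B r)))) r := fun r hr => by
    refine (HasDerivAt.comp r (hK1 _ (hH2 r hr).1).2.2 (hH2 r hr).2.2).congr_deriv ?_
    rw [div_eq_inv_mul]
  have hsm : StrictMonoOn (fun r => K (B r)) (Ioi 0) := by
    apply strictMonoOn_of_deriv_pos (convex_Ioi 0)
    · exact fun r hr => (hsd r hr).continuousAt.continuousWithinAt
    · intro r hr
      rw [interior_Ioi] at hr
      have hr : 0 < r := hr
      rw [(hsd r hr).deriv]
      have := hs0 r hr
      have := hqpos r hr.le
      have := hppos _ (hs0 r hr).le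
      positivity
  refine ⟨fun r => K (B r), fun r hr => ⟨hs0 r hr, hsA r hr, hsd r hr⟩, hsm, ?_, ?_⟩
  · ext t; constructor
    · rintro ⟨r, hr, rfl⟩; exact hs0 r hr
    · intro ht
      have h1 := (hK2 t ht).1
      refine ⟨H (A t), (hH1 _ h1).1, ?_⟩
      change K (B (H (A t))) = t
      have e1 : B (H (A t)) = A t := (hH1 _ h1).2.1
      rw [e1]; exact (hK2 t ht).2.1
  · intro r₁ hr₁
    set s₁ := K (B r₁)
    have hs₁ : 0 < s₁ := hs0 r₁ hr₁
    have bd : ∀ (p : ℝ → ℝ), ContinuousOn p (Ici 0) → (∀ t, 0 ≤ t → 0 < p t) → ∀ R, 0 < R →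
        ∃ m M, 0 < m ∧ ∀ t ∈ Icc 0 R, m ≤ p t ∧ p t ≤ M := by
      intro p hp hpos R hR
      have hc := hp.mono (Icc_subset_Ici_self : Icc 0 R ⊆ Ici 0)
      obtain ⟨x, hx, hxm⟩ := isCompact_Icc.exists_isMinOn (nonempty_Icc.2 hR.le) hc
      obtain ⟨z, hz, hzm⟩ := isCompact_Icc.exists_isMaxOn (nonempty_Icc.2 hR.le) hc
      exact ⟨p x, p z, hpos x hx.1, fun t ht => ⟨hxm ht, hzm ht⟩⟩
    obtain ⟨m1, M1, hm1, h1⟩ := bd p hp hppos s₁ hs₁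
    obtain ⟨m2, M2, hm2, h2⟩ := bd q hq hqpos r₁ hr₁
    set m := min m1 m2
    set M := max M1 M2
    have hm : 0 < m := lt_min hm1 hm2
    have hmM : m ≤ M := by
      have := h1 0 ⟨le_rfl, hs₁.le⟩
      exact (min_le_left _ _).trans (this.1.trans (this.2.trans (le_max_left _ _)))
    have hM : 0 < M := hm.trans_le hmM
    have ib : ∀ (p : ℝ → ℝ), IntegrableOn (fun t => t ^ k * p t) (Ioi 0) → ∀ R, 0 < R →
        (∀ t ∈ Icc 0 R, m ≤ p t ∧ p t ≤ M) →
        m * (R ^ (k+1) / (k+1)) ≤ (∫ t in (0:ℝ)..R, t ^ k * p t) ∧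
        (∫ t in (0:ℝ)..R, t ^ k * p t) ≤ M * (R ^ (k+1) / (k+1)) := by
      intro p hpi R hR hb
      have hii : IntervalIntegrable (fun t => t ^ k * p t) volume 0 R :=
        (intervalIntegrable_iff_integrableOn_Ioc_of_le hR.le).2 (hpi.mono_set Ioc_subset_Ioi_self)
      have e : ∀ c : ℝ, c * (R ^ (k+1) / (k+1)) = ∫ t in (0:ℝ)..R, t ^ k * c := fun c => by
        rw [intervalIntegral.integral_mul_const, integral_pow]; simp; ring
      rw [e, e]
      constructor
      · refine intervalIntegral.integral_mono_on hR.le (Continuous.intervalIntegrable (by fun_prop) _ _) hii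
          fun t ht => mul_le_mul_of_nonneg_left (hb t ht).1 (pow_nonneg ht.1 k)
      · refine intervalIntegral.integral_mono_on hR.le hii (Continuous.intervalIntegrable (by fun_prop) _ _)
          fun t ht => mul_le_mul_of_nonneg_left (hb t ht).2 (pow_nonneg ht.1 k)
    set κ := M / m
    have hκ1 : 1 ≤ κ := (one_le_div hm).2 hmM
    refine ⟨κ ^ (k+1), fun r hr hrr => ?_⟩
    have hsle : K (B r) ≤ s₁ := hsm.monotoneOn hr hr₁ hrr
    have hsp := hs0 r hr
    have b1 := ib p hpint (K (B r)) hsp (fun t ht =>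
      ⟨(min_le_left _ _).trans (h1 t ⟨ht.1, ht.2.trans hsle⟩).1,
        (h1 t ⟨ht.1, ht.2.trans hsle⟩).2.trans (le_max_left _ _)⟩)
    have b2 := ib q hqint r hr (fun t ht =>
      ⟨(min_le_right _ _).trans (h2 t ⟨ht.1, ht.2.trans hrr⟩).1,
        (h2 t ⟨ht.1, ht.2.trans hrr⟩).2.trans (le_max_right _ _)⟩)
    have hAB := hsA r hr
    simp only [hA] at hAB
    rw [hAB] at b1
    have hk1 : (0:ℝ) < k + 1 := by positivity
    have cmp : ∀ x y : ℝ, 0 < x → 0 < y → m * (x ^ (k+1) / (k+1)) ≤ M * (y ^ (k+1) / (k+1)) →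
        x ≤ κ * y := by
      intro x y hx hy hxy
      have h3 : x ^ (k+1) ≤ κ * y ^ (k+1) := by
        have e1 : m * x ^ (k+1) ≤ M * y ^ (k+1) := by
          have := mul_le_mul_of_nonneg_right hxy hk1.le
          have e : ∀ z w : ℝ, z * (w / (k+1)) * (k+1) = z * w := fun z w => by field_simp
          rwa [e, e] at this
        simp only [κ]
        rw [div_mul_eq_mul_div, le_div_iff₀ hm]; linarith
      have h4 : κ * y ^ (k+1) ≤ (κ * y) ^ (k+1) := by
        rw [mul_pow]
        refine mul_le_mul_of_nonneg_right ?_ (by positivity)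
        exact le_self_pow₀ hκ1 (by simp)
      exact le_of_pow_le_pow_left₀ (by simp) (by positivity) (h3.trans h4)
    have c1 : K (B r) ≤ κ * r := cmp _ _ hsp hr (b1.1.trans b2.2)
    have c2 : r ≤ κ * K (B r) := cmp _ _ hr hsp (b2.1.trans b1.2)
    have hκk : κ ≤ κ ^ (k+1) := le_self_pow₀ hκ1 (by simp)
    refine ⟨c1.trans (mul_le_mul_of_nonneg_right hκk hr.le), ?_⟩
    have hpl := (h1 (K (B r)) ⟨hsp.le, hsle⟩).1
    have hqu := (h2 r ⟨hr.le, hrr⟩).2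
    have hpp := hppos _ hsp.le
    rw [div_le_iff₀ (by positivity)]
    calc r ^ k * q r ≤ (κ * K (B r)) ^ k * M := by
          have : q r ≤ M := hqu.trans (le_max_right _ _)
          have h0 := (hqpos r hr.le).le
          gcongr
      _ = κ ^ (k+1) * (K (B r) ^ k * m) := by
          have : M = κ * m := by simp only [κ]; field_simp
          rw [this]; ring
      _ ≤ κ ^ (k+1) * (K (B r) ^ k * p (K (B r))) := by
          have : m ≤ p (K (B r)) := (min_le_left _ _).trans hpl
          gcongr

lemma polar_lintegral (d : ℕ) [Nontrivial (EuclideanSpace ℝ (Fin d))]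
    (F : EuclideanSpace ℝ (Fin d) → ENNReal) (hF : Measurable F) :
    ∫⁻ x, F x = ∫⁻ θ : Metric.sphere (0 : EuclideanSpace ℝ (Fin d)) 1, (∫⁻ r in Ioi (0:ℝ),
      ENNReal.ofReal (r ^ (d - 1)) * F (r • (θ : EuclideanSpace ℝ (Fin d))))
      ∂(volume : Measure (EuclideanSpace ℝ (Fin d))).toSphere := by
  let E := EuclideanSpace ℝ (Fin d)
  have hdim : Module.finrank ℝ E = d := by simp [E]
  have hmp := (volume : Measure E).measurePreserving_homeomorphUnitSphereProd
  rw [hdim] at hmp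
  have hm2 : Measurable (fun z : Metric.sphere (0:E) 1 × Ioi (0:ℝ) => F (z.2.1 • z.1.1)) := by
    have : Measurable (fun z : Metric.sphere (0:E) 1 × Ioi (0:ℝ) => (z.2.1 • z.1.1 : E)) := by
      fun_prop
    exact hF.comp this
  have e1 : ∫⁻ x, F x = ∫⁻ z, F (z.2.1 • z.1.1) ∂((volume : Measure E).toSphere.prod
      (Measure.volumeIoiPow (d - 1))) := by
    rw [← hmp.lintegral_comp hm2]
    have : ∀ x : ({0}ᶜ : Set E), (((homeomorphUnitSphereProd E) x).2.1 •
        ((homeomorphUnitSphereProd E) x).1.1) = x.1 := fun x => by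
      have := homeomorphUnitSphereProd_symm_apply_coe E (homeomorphUnitSphereProd E x)
      rw [← this]; simp
    simp only [this]
    rw [lintegral_subtype_comap (measurableSet_singleton _).compl, restrict_compl_singleton]
  rw [e1, lintegral_prod _ hm2.aemeasurable]
  refine lintegral_congr fun θ => ?_
  have hm3 : Measurable (fun y : Ioi (0:ℝ) => F (y.1 • θ.1)) := by
    have : Measurable (fun y : Ioi (0:ℝ) => (y.1 • θ.1 : E)) := by fun_prop
    exact hF.comp this
  rw [Measure.volumeIoiPow]
  refine (lintegral_withDensity_eq_lintegral_mul _ (by fun_prop) hm3).trans ?_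
  exact lintegral_subtype_comap (μ := volume) measurableSet_Ioi
    (f := fun r : ℝ => ENNReal.ofReal (r ^ (d - 1)) * F (r • θ.1))

/-- radial map -/
noncomputable def Smap {d : ℕ} (s : ℝ → ℝ) (y : EuclideanSpace ℝ (Fin d)) : EuclideanSpace ℝ (Fin d) :=
  (s ‖y‖ / ‖y‖) • y

lemma Smap_meas {d : ℕ} (s : ℝ → ℝ) (hs : ContinuousOn s (Ioi 0)) :
    Measurable (Smap (d := d) s) := by
  apply measurable_of_continuousOn_compl_singleton 0
  have h1 : ContinuousOn (fun y : EuclideanSpace ℝ (Fin d) => ‖y‖) {0}ᶜ := continuous_norm.continuousOn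
  have h2 : ContinuousOn (fun y : EuclideanSpace ℝ (Fin d) => s ‖y‖) {0}ᶜ :=
    hs.comp h1 fun y hy => by simpa using hy
  exact (h2.div h1 fun y hy => by simpa using hy).smul continuousOn_id

lemma push_map (d : ℕ) [Nontrivial (EuclideanSpace ℝ (Fin d))] (p q s : ℝ → ℝ)
    (hp : ContinuousOn p (Ici 0)) (hppos : ∀ t, 0 ≤ t → 0 < p t)
    (hq : ContinuousOn q (Ici 0)) (hqpos : ∀ t, 0 ≤ t → 0 < q t)
    (hs0 : ∀ r, 0 < r → 0 < s r)
    (hsd : ∀ r, 0 < r → HasDerivAt s (r ^ (d-1) * q r / ((s r) ^ (d-1) * p (s r))) r)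
    (hinj : InjOn s (Ioi 0)) (himg : s '' Ioi 0 = Ioi 0) :
    Measure.map (Smap s)
      (volume.withDensity fun y : EuclideanSpace ℝ (Fin d) => ENNReal.ofReal (q ‖y‖)) =
      volume.withDensity fun x : EuclideanSpace ℝ (Fin d) => ENNReal.ofReal (p ‖x‖) := by
  have hsc : ContinuousOn s (Ioi 0) := fun r hr => (hsd r hr).continuousAt.continuousWithinAt
  have hSm := Smap_meas (d := d) s hsc
  have hpm : Measurable fun x : EuclideanSpace ℝ (Fin d) => ENNReal.ofReal (p ‖x‖) :=
    (hp.comp_continuous continuous_norm (fun x => norm_nonneg x)).measurable.ennreal_ofReal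
  have hqm : Measurable fun x : EuclideanSpace ℝ (Fin d) => ENNReal.ofReal (q ‖x‖) :=
    (hq.comp_continuous continuous_norm (fun x => norm_nonneg x)).measurable.ennreal_ofReal
  ext t ht
  rw [Measure.map_apply hSm ht, withDensity_apply _ (hSm ht), withDensity_apply _ ht,
    ← lintegral_indicator (hSm ht), ← lintegral_indicator ht,
    polar_lintegral d _ (hqm.indicator (hSm ht)), polar_lintegral d _ (hpm.indicator ht)]
  refine lintegral_congr fun θ => ?_
  have hθ : ‖(θ : EuclideanSpace ℝ (Fin d))‖ = 1 := by simp
  have key := lintegral_image_eq_lintegral_abs_deriv_mul measurableSet_Ioi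
    (fun r hr => (hsd r hr).hasDerivWithinAt) hinj (fun r => ENNReal.ofReal (r ^ (d-1)) *
      t.indicator (fun x => ENNReal.ofReal (p ‖x‖)) (r • (θ : EuclideanSpace ℝ (Fin d))))
  rw [himg] at key
  rw [key]
  refine setLIntegral_congr_fun measurableSet_Ioi fun r hr => ?_
  have hr : 0 < r := hr
  have hn : ∀ r, 0 < r → ‖r • (θ : EuclideanSpace ℝ (Fin d))‖ = r := fun r hr => by
    rw [norm_smul, hθ, Real.norm_of_nonneg hr.le, mul_one]
  have hS : Smap s (r • (θ : EuclideanSpace ℝ (Fin d))) = s r • (θ : EuclideanSpace ℝ (Fin d)) := by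
    rw [Smap, hn r hr, smul_smul, div_mul_cancel₀ _ hr.ne']
  have hsr := hs0 r hr
  have hpp := hppos _ hsr.le
  have hqq := hqpos _ hr.le
  by_cases h : s r • (θ : EuclideanSpace ℝ (Fin d)) ∈ t
  · have h' : r • (θ : EuclideanSpace ℝ (Fin d)) ∈ Smap s ⁻¹' t := by rw [mem_preimage, hS]; exact h
    rw [indicator_of_mem h, indicator_of_mem h', hn r hr, hn _ hsr, ← ENNReal.ofReal_mul (by positivity), ← ENNReal.ofReal_mul (by positivity),
      ← ENNReal.ofReal_mul (by positivity), abs_of_pos (by positivity)]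
    congr 1
    field_simp
  · have h' : r • (θ : EuclideanSpace ℝ (Fin d)) ∉ Smap s ⁻¹' t := by rw [mem_preimage, hS]; exact h
    rw [indicator_of_notMem h, indicator_of_notMem h']
    simp

lemma radial_package (d : ℕ) (hd : 2 ≤ d)
    (v : ℝ → ℝ) (hv : ContinuousOn v (Ici 0))
    (hV1 : ∫ x : EuclideanSpace ℝ (Fin d), Real.exp (v ‖x‖) = 1) :
    ∃ s s' : ℝ → ℝ, (∀ r, 0 < r → 0 < s r ∧ 0 ≤ s' r ∧ HasDerivAt s (s' r) r) ∧
      ContinuousOn s' (Ioi 0) ∧ StrictMonoOn s (Ioi 0) ∧ s '' Ioi 0 = Ioi 0 ∧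
      (∀ r₁, 0 < r₁ → ∃ C, ∀ r, 0 < r → r ≤ r₁ → s r ≤ C * r ∧ s' r ≤ C) ∧
      Measure.map (Smap s) (gE d) = volume.withDensity
        (fun x : EuclideanSpace ℝ (Fin d) => ENNReal.ofReal (Real.exp (v ‖x‖))) ∧
      (∀ y : EuclideanSpace ℝ (Fin d), y ≠ 0 →
        alphaRad d v (Smap s y) = max ((s ‖y‖ / ‖y‖) ^ 2) ((s' ‖y‖) ^ 2)) ∧
      Measurable (alphaRad d v) := by
  have hd0 : 0 < d := by omega
  have : Nonempty (Fin d) := ⟨⟨0, hd0⟩⟩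
  have : Nontrivial (EuclideanSpace ℝ (Fin d)) := inferInstance
  have hdim : Module.finrank ℝ (EuclideanSpace ℝ (Fin d)) = d := by simp
  set c : ℝ := (2 * π) ^ (-(d:ℝ)/2) with hc
  have hcpos : 0 < c := by positivity
  set k := d - 1 with hk
  set A : ℝ := d * omegad d with hA
  have hpolar : ∀ F : ℝ → ℝ, ∫ x : EuclideanSpace ℝ (Fin d), F ‖x‖ =
      A * ∫ t in Ioi (0:ℝ), t ^ k * F t := fun F => by
    rw [integral_fun_norm_addHaar, hdim]
    simp only [nsmul_eq_mul, smul_eq_mul, hA, omegad, Measure.real, mul_assoc, hk]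
  have hpolari : ∀ F : ℝ → ℝ, Integrable (fun x : EuclideanSpace ℝ (Fin d) => F ‖x‖) ↔
      IntegrableOn (fun t => t ^ k * F t) (Ioi 0) := fun F => by
    rw [integrable_fun_norm_addHaar volume (f := F), hdim]
    simp only [smul_eq_mul, hk]
  have hh : A * hRad d v = 1 := by
    rw [← hV1, hpolar (fun t => Real.exp (v t))]; rfl
  have hA0 : A ≠ 0 := left_ne_zero_of_mul_eq_one hh
  have hApos : 0 < A := lt_of_le_of_ne (by rw [hA, omegad]; positivity) hA0.symm
  have hhpos : 0 < hRad d v := by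
    by_contra hcon
    nlinarith
  have hAh : A = (hRad d v)⁻¹ := eq_inv_of_mul_eq_one_left hh
  set p : ℝ → ℝ := fun t => A * Real.exp (v t) with hp
  set q : ℝ → ℝ := fun t => A * (c * Real.exp (-t^2/2)) with hq
  have hpc : ContinuousOn p (Ici 0) := continuousOn_const.mul (Real.continuous_exp.comp_continuousOn hv)
  have hqc : Continuous q := by fun_prop
  have hppos : ∀ t, 0 ≤ t → 0 < p t := fun t _ => by positivity
  have hqpos : ∀ t, 0 ≤ t → 0 < q t := fun t _ => by positivity
  have hvi : Integrable fun x : EuclideanSpace ℝ (Fin d) => Real.exp (v ‖x‖) := by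
    by_contra hcon
    rw [integral_undef hcon] at hV1
    norm_num at hV1
  have hgl : ∫⁻ x : EuclideanSpace ℝ (Fin d), ENNReal.ofReal (c * Real.exp (-‖x‖^2/2)) = 1 := by
    have := measure_univ (μ := gE d)
    rwa [gE_density, withDensity_apply _ MeasurableSet.univ, Measure.restrict_univ] at this
  have hgi : Integrable fun x : EuclideanSpace ℝ (Fin d) => c * Real.exp (-‖x‖^2/2) := by
    refine ⟨by fun_prop, ?_⟩
    rw [hasFiniteIntegral_iff_ofReal (Eventually.of_forall fun x => by positivity), hgl]
    simp
  have hg1 : ∫ x : EuclideanSpace ℝ (Fin d), c * Real.exp (-‖x‖^2/2) = 1 := by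
    rw [integral_eq_lintegral_of_nonneg_ae (Eventually.of_forall fun x => by positivity) (by fun_prop),
      hgl]
    simp
  have hpint : IntegrableOn (fun t => t ^ k * p t) (Ioi 0) := by
    have := ((hpolari (fun t => Real.exp (v t))).1 hvi).const_mul A
    refine this.congr (Eventually.of_forall fun t => ?_)
    simp only [hp]; ring
  have hqint : IntegrableOn (fun t => t ^ k * q t) (Ioi 0) := by
    have := ((hpolari (fun t => c * Real.exp (-t^2/2))).1 hgi).const_mul A
    refine this.congr (Eventually.of_forall fun t => ?_)
    simp only [hq]; ring
  have hptot : ∫ t in Ioi (0:ℝ), t ^ k * p t = 1 := by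
    rw [← hV1, hpolar (fun t => Real.exp (v t)), ← integral_const_mul]
    congr 1; ext t; simp only [hp]; ring
  have hqtot : ∫ t in Ioi (0:ℝ), t ^ k * q t = 1 := by
    rw [← hg1, hpolar (fun t => c * Real.exp (-t^2/2)), ← integral_const_mul]
    congr 1; ext t; simp only [hq]; ring
  obtain ⟨s, hs, hsm, hsi, hsb⟩ := radial_map k p q hpc hppos hpint hptot hqc.continuousOn hqpos hqint hqtot
  obtain ⟨K, -, hK⟩ := radial_inverse k q hqc.continuousOn hqpos hqint hqtot
  have hsc : ContinuousOn s (Ioi 0) := fun r hr => (hs r hr).2.2.continuousAt.continuousWithinAt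
  set s' : ℝ → ℝ := fun r => r ^ k * q r / ((s r) ^ k * p (s r)) with hs'
  have hphi : ∀ r, phiRad d v r = ∫ t in (0:ℝ)..r, t ^ k * p t := fun r => by
    rw [phiRad, ← hAh, ← intervalIntegral.integral_const_mul]
    congr 1; ext t; simp only [hp]; ring
  have hPhi : ∀ r, 0 ≤ r → Phi0 d r = ∫ t in (0:ℝ)..r, t ^ k * q t := fun r hr => by
    have e := hpolar ((Iio r).indicator fun t => c * Real.exp (-t^2/2))
    have e1 : ∀ x : EuclideanSpace ℝ (Fin d), (Iio r).indicator (fun t => c * Real.exp (-t^2/2)) ‖x‖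
        = (Metric.ball (0:EuclideanSpace ℝ (Fin d)) r).indicator (fun x => c * Real.exp (-‖x‖^2/2)) x :=
      fun x => by simp [indicator]
    have e2 : ∀ t : ℝ, t ^ k * (Iio r).indicator (fun t => c * Real.exp (-t^2/2)) t
        = (Iio r).indicator (fun t => t ^ k * (c * Real.exp (-t^2/2))) t := fun t => by
      by_cases h : t < r <;> simp [indicator, h]
    simp only [e1, e2] at e
    rw [integral_indicator Metric.isOpen_ball.measurableSet,
      setIntegral_indicator measurableSet_Iio, Ioi_inter_Iio,
      ← integral_Ioc_eq_integral_Ioo, ← intervalIntegral.integral_of_le hr] at e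
    rw [Phi0, ← hc, ← integral_const_mul, e, ← intervalIntegral.integral_const_mul]
    congr 1; ext t; simp only [hq]; ring
  have hPhi0 : Phi0 d 0 = 0 := by rw [hPhi 0 le_rfl]; simp
  have hPm : StrictMonoOn (Phi0 d) (Ici 0) := by
    intro a ha b hb hab
    have hb0 : 0 < b := lt_of_le_of_lt ha hab
    rw [hPhi a ha, hPhi b hb]
    have hii : ∀ x y : ℝ, IntervalIntegrable (fun t => t ^ k * q t) volume x y := fun x y =>
      Continuous.intervalIntegrable (by fun_prop) _ _
    have := intervalIntegral.integral_add_adjacent_intervals (hii 0 a) (hii a b)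
    have hpos : 0 < ∫ t in a..b, t ^ k * q t :=
      intervalIntegral.intervalIntegral_pos_of_pos_on (hii a b) (fun t ht => by
        have h0 : 0 < t := lt_of_le_of_lt ha ht.1
        have := hqpos t h0.le
        positivity) hab
    linarith
  have hInv : ∀ r, 0 ≤ r → Phi0Inv d (Phi0 d r) = r := fun r hr => by
    have : {x : ℝ | 0 ≤ x ∧ Phi0 d r ≤ Phi0 d x} = Ici r := by
      ext x
      simp only [mem_ofPred_eq, mem_Ici]
      constructor
      · rintro ⟨h0, h1⟩; exact (hPm.le_iff_le hr h0).1 h1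
      · intro h; exact ⟨hr.trans h, (hPm.le_iff_le hr (hr.trans h)).2 h⟩
    rw [Phi0Inv, this, csInf_Ici]
  set T : ℝ → ℝ := fun r => Phi0Inv d (phiRad d v r) with hT
  have hTs : ∀ r, 0 < r → T (s r) = r := fun r hr => by
    simp only [hT]
    rw [hphi, (hs r hr).2.1, ← hPhi r hr.le, hInv r hr.le]
  have hTm : StrictMonoOn T (Ioi 0) := by
    intro a ha b hb hab
    rw [← hsi] at ha hb
    obtain ⟨x, hx, rfl⟩ := ha
    obtain ⟨y, hy, rfl⟩ := hb
    rw [hTs x hx, hTs y hy]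
    exact (hsm.lt_iff_lt hx hy).1 hab
  have hTi : T '' Ioi 0 = Ioi 0 := by
    ext x
    constructor
    · rintro ⟨y, hy, rfl⟩
      rw [← hsi] at hy
      obtain ⟨z, hz, rfl⟩ := hy
      rw [hTs z hz]; exact hz
    · intro hx
      exact ⟨s x, (hs x hx).1, hTs x hx⟩
  have hTpos : ∀ r, 0 < r → 0 < T r := fun r hr => by
    have : T r ∈ T '' Ioi 0 := ⟨r, hr, rfl⟩
    rwa [hTi] at this
  have hTc : ContinuousOn T (Ioi 0) := fun r hr =>
    (hTm.continuousAt_of_image_mem_nhds (Ioi_mem_nhds hr)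
      (by rw [hTi]; exact Ioi_mem_nhds (hTpos r hr))).continuousWithinAt
  have hphid : ∀ r, phiRadDeriv d v r = r ^ k * p r := fun r => by
    rw [phiRadDeriv, div_eq_mul_inv, ← hAh]; simp only [hp]; ring
  have hPhid : ∀ r, Phi0Deriv d r = r ^ k * q r := fun r => by
    rw [Phi0Deriv]; simp only [hq, hA]; ring
  refine ⟨s, s', fun r hr => ⟨(hs r hr).1, ?_, (hs r hr).2.2⟩, ?_, hsm, hsi, hsb, ?_, ?_, ?_⟩
  · have h1 := (hs r hr).1
    have h2 := hppos _ h1.le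
    have h3 := hqpos _ hr.le
    simp only [hs']; positivity
  · refine ContinuousOn.div (by fun_prop) ((hsc.pow k).mul (hpc.comp hsc fun r hr => (hs r hr).1.le)) ?_
    intro r hr
    have h1 := (hs r hr).1
    have h2 := hppos _ h1.le
    positivity
  · rw [gE_density]
    refine push_map d (fun t => Real.exp (v t)) (fun t => c * Real.exp (-t^2/2)) s
      (Real.continuous_exp.comp_continuousOn hv) (fun t _ => by positivity) (by fun_prop)
      (fun t _ => by positivity) (fun r hr => (hs r hr).1) (fun r hr => ?_) hsm.injOn hsi
    convert (hs r hr).2.2 using 1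
    have h1 := (hs r hr).1
    rw [← hk]
    simp only [hp, hq]
    field_simp
  · intro y hy
    have hr : 0 < ‖y‖ := norm_pos_iff.2 hy
    have h1 := (hs _ hr).1
    have hn : ‖Smap s y‖ = s ‖y‖ := by
      rw [Smap, norm_smul, Real.norm_of_nonneg (by positivity), div_mul_cancel₀ _ hr.ne']
    have hTT : Phi0Inv d (phiRad d v (s ‖y‖)) = ‖y‖ := hTs _ hr
    rw [alphaRad, hn, hTT, hPhid, hphid, div_pow, ← div_pow (_ * _)]
  · apply measurable_of_continuousOn_compl_singleton 0
    have hnc : ContinuousOn (fun x : EuclideanSpace ℝ (Fin d) => ‖x‖) {0}ᶜ := continuous_norm.continuousOn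
    have hn0 : ∀ x : EuclideanSpace ℝ (Fin d), x ∈ ({0}ᶜ : Set (EuclideanSpace ℝ (Fin d))) → 0 < ‖x‖ :=
      fun x hx => norm_pos_iff.2 hx
    have hTn : ContinuousOn (fun x : EuclideanSpace ℝ (Fin d) => T ‖x‖) {0}ᶜ := hTc.comp hnc hn0
    have hpn : ContinuousOn (fun x : EuclideanSpace ℝ (Fin d) => p ‖x‖) {0}ᶜ :=
      hpc.comp hnc fun x hx => (hn0 x hx).le
    have heq : alphaRad d v = fun x => max (‖x‖ ^ 2 / (T ‖x‖) ^ 2)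
        ((T ‖x‖ ^ k * q (T ‖x‖)) ^ 2 / (‖x‖ ^ k * p ‖x‖) ^ 2) := by
      ext x; rw [alphaRad, hPhid, hphid]
    rw [heq]
    refine ContinuousOn.sup (ContinuousOn.div (hnc.pow 2) (hTn.pow 2) ?_)
      (ContinuousOn.div (((hTn.pow k).mul (hqc.comp_continuousOn hTn)).pow 2)
        (((hnc.pow k).mul hpn).pow 2) ?_)
    · intro x hx
      have := hTpos _ (hn0 x hx)
      positivity
    · intro x hx
      have h1 := hn0 x hx
      have := hppos _ h1.le
      positivity

structure RadOK (s s' : ℝ → ℝ) : Prop where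
  all : ∀ r, 0 < r → 0 < s r ∧ 0 ≤ s' r ∧ HasDerivAt s (s' r) r
  cont : ContinuousOn s' (Ioi 0)
  mono : StrictMonoOn s (Ioi 0)
  img : s '' Ioi 0 = Ioi 0
  bd : ∀ r₁, 0 < r₁ → ∃ C, ∀ r, 0 < r → r ≤ r₁ → s r ≤ C * r ∧ s' r ≤ C

/-- weight on the Gaussian side -/
noncomputable def Awt {d : ℕ} (s s' : ℝ → ℝ) (y : EuclideanSpace ℝ (Fin d)) : ℝ :=
  max ((s ‖y‖ / ‖y‖) ^ 2) ((s' ‖y‖) ^ 2)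

lemma Awt_nonneg {d : ℕ} (s s' : ℝ → ℝ) (y : EuclideanSpace ℝ (Fin d)) : 0 ≤ Awt s s' y :=
  le_max_of_le_left (sq_nonneg _)

lemma RadOK.sc {s s' : ℝ → ℝ} (h : RadOK s s') : ContinuousOn s (Ioi 0) :=
  fun r hr => (h.all r hr).2.2.continuousAt.continuousWithinAt

lemma Awt_meas {d : ℕ} {s s' : ℝ → ℝ} (h : RadOK s s') :
    Measurable (Awt (d := d) s s') := by
  apply measurable_of_continuousOn_compl_singleton 0
  have h1 : ContinuousOn (fun y : EuclideanSpace ℝ (Fin d) => ‖y‖) {0}ᶜ := continuous_norm.continuousOn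
  have h2 : ContinuousOn (fun y : EuclideanSpace ℝ (Fin d) => s ‖y‖) {0}ᶜ :=
    h.sc.comp h1 fun y hy => by simpa using hy
  have h3 : ContinuousOn (fun y : EuclideanSpace ℝ (Fin d) => s' ‖y‖) {0}ᶜ :=
    h.cont.comp h1 fun y hy => by simpa using hy
  exact ((h2.div h1 fun y hy => by simpa using hy).pow 2).sup (h3.pow 2)

lemma Smap_norm {d : ℕ} {s s' : ℝ → ℝ} (h : RadOK s s') {y : EuclideanSpace ℝ (Fin d)} (hy : y ≠ 0) :
    ‖Smap s y‖ = s ‖y‖ := by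
  have hr : 0 < ‖y‖ := norm_pos_iff.2 hy
  have h1 := (h.all _ hr).1
  rw [Smap, norm_smul, Real.norm_of_nonneg (by positivity), div_mul_cancel₀ _ hr.ne']

lemma Awt_bound {d : ℕ} {s s' : ℝ → ℝ} (h : RadOK s s') (R0 : ℝ) (hR : 0 < R0) :
    ∃ C, 0 ≤ C ∧ ∀ y : EuclideanSpace ℝ (Fin d), y ≠ 0 → s ‖y‖ ≤ R0 → Awt s s' y ≤ C := by
  have : R0 ∈ s '' Ioi 0 := by rw [h.img]; exact hR
  obtain ⟨r₁, hr₁, rfl⟩ := this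
  obtain ⟨C, hC⟩ := h.bd r₁ hr₁
  refine ⟨C ^ 2, sq_nonneg _, fun y hy hs => ?_⟩
  have hr : 0 < ‖y‖ := norm_pos_iff.2 hy
  have hle : ‖y‖ ≤ r₁ := (h.mono.le_iff_le hr hr₁).1 hs
  obtain ⟨h1, h2⟩ := hC _ hr hle
  obtain ⟨h3, h4, -⟩ := h.all _ hr
  refine max_le ?_ ?_
  · have : s ‖y‖ / ‖y‖ ≤ C := by rw [div_le_iff₀ hr]; exact h1
    have : 0 ≤ s ‖y‖ / ‖y‖ := by positivity
    gcongr
  · gcongr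

lemma Smap_fderiv {d : ℕ} {s s' : ℝ → ℝ} (h : RadOK s s') {y : EuclideanSpace ℝ (Fin d)} (hy : y ≠ 0) :
    ∃ D : EuclideanSpace ℝ (Fin d) →L[ℝ] EuclideanSpace ℝ (Fin d), HasFDerivAt (Smap s) D y ∧
      ∀ w, ‖D w‖ ^ 2 ≤ Awt s s' y * ‖w‖ ^ 2 := by
  have hr : 0 < ‖y‖ := norm_pos_iff.2 hy
  set r := ‖y‖ with hrdef
  obtain ⟨hs0, hb0, hder⟩ := h.all r hr
  set b := s' r
  have hn : HasFDerivAt (fun y : EuclideanSpace ℝ (Fin d) => ‖y‖) (r⁻¹ • innerSL ℝ y) y := by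
    have h1 := ((hasStrictFDerivAt_norm_sq y).hasFDerivAt).sqrt (by positivity)
    refine (h1.congr_of_eventuallyEq (Eventually.of_forall fun z => ?_)).congr_fderiv ?_
    · simp
    · ext w
      simp [← hrdef, Real.sqrt_sq hr.le]
      field_simp
  have ha : HasDerivAt (fun t => s t / t) ((b * r - s r * 1) / r ^ 2) ‖y‖ :=
    hder.div (hasDerivAt_id r) hr.ne'
  have hcomp := ha.comp_hasFDerivAt y hn
  have hS := hcomp.smul (hasFDerivAt_id y)
  refine ⟨_, hS, fun w => ?_⟩
  set c := inner ℝ y w with hc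
  set a := s r / r with hadef
  have hcW : c ^ 2 ≤ r ^ 2 * ‖w‖ ^ 2 := by
    rw [← mul_pow, ← sq_abs c]
    have := abs_real_inner_le_norm y w
    gcongr
  have hval : ‖a • w + (((b - a) / r) * (c / r)) • y‖ ^ 2 =
      a ^ 2 * (‖w‖ ^ 2 - c ^ 2 / r ^ 2) + b ^ 2 * (c ^ 2 / r ^ 2) := by
    rw [norm_add_sq_real, norm_smul, norm_smul, inner_smul_left, inner_smul_right, real_inner_comm, ← hc,
      ← hrdef, mul_pow, mul_pow, Real.norm_eq_abs, Real.norm_eq_abs, sq_abs, sq_abs]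
    simp only [conj_trivial]
    field_simp
    ring
  have hle : ‖a • w + (((b - a) / r) * (c / r)) • y‖ ^ 2 ≤ Awt s s' y * ‖w‖ ^ 2 := by
    rw [hval]
    have h1 : a ^ 2 ≤ Awt s s' y := le_max_left _ _
    have h2 : b ^ 2 ≤ Awt s s' y := le_max_right _ _
    have h3 : 0 ≤ ‖w‖ ^ 2 - c ^ 2 / r ^ 2 := by
      rw [sub_nonneg, div_le_iff₀ (by positivity)]; linarith
    have h4 : 0 ≤ c ^ 2 / r ^ 2 := by positivity
    nlinarith [mul_le_mul_of_nonneg_right h1 h3, mul_le_mul_of_nonneg_right h2 h4]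
  convert hle using 3
  simp only [ContinuousLinearMap.add_apply, ContinuousLinearMap.smul_apply, ContinuousLinearMap.smulRight_apply,
    innerSL_apply_apply, Function.comp, id, ContinuousLinearMap.id_apply, smul_eq_mul, ← hc, ← hrdef, ← hadef]
  congr 2
  rw [hadef]
  field_simp

lemma Smap_contDiffAt {d : ℕ} {s s' : ℝ → ℝ} (h : RadOK s s') {y : EuclideanSpace ℝ (Fin d)} (hy : y ≠ 0) :
    ContDiffAt ℝ 1 (Smap s) y := by
  have hr : 0 < ‖y‖ := norm_pos_iff.2 hy
  have h1 : ContDiffOn ℝ 1 s (Ioi 0) := by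
    rw [show (1 : WithTop ℕ∞) = 0 + 1 by simp, contDiffOn_succ_iff_deriv_of_isOpen isOpen_Ioi]
    refine ⟨fun r hr => (h.all r hr).2.2.differentiableAt.differentiableWithinAt, by simp, ?_⟩
    rw [contDiffOn_zero]
    exact h.cont.congr fun r hr => (h.all r hr).2.2.deriv
  have h2 : ContDiffAt ℝ 1 (fun y : EuclideanSpace ℝ (Fin d) => ‖y‖) y := contDiffAt_norm ℝ hy
  have h3 : ContDiffAt ℝ 1 s ‖y‖ := h1.contDiffAt (Ioi_mem_nhds hr)
  exact ((h3.comp y h2).div h2 hr.ne').smul contDiffAt_id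

lemma comp_bound {d : ℕ} {s s' : ℝ → ℝ} (h : RadOK s s') {y : EuclideanSpace ℝ (Fin d)} (hy : y ≠ 0)
    (f : EuclideanSpace ℝ (Fin d) → ℝ) (hf : ContDiff ℝ 1 f) :
    ‖fderiv ℝ (fun y => f (Smap s y)) y‖ ^ 2 ≤ Awt s s' y * ‖fderiv ℝ f (Smap s y)‖ ^ 2 := by
  obtain ⟨D, hD, hDb⟩ := Smap_fderiv h hy
  have hff := ((hf.differentiable (by simp)) (Smap s y)).hasFDerivAt
  have hc : HasFDerivAt (fun y => f (Smap s y)) _ y := hff.comp y hD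
  rw [hc.fderiv]
  have hA := Awt_nonneg s s' y
  have hDn : ‖D‖ ≤ √(Awt s s' y) := D.opNorm_le_bound (by positivity) fun w => by
    rw [← Real.sqrt_sq (norm_nonneg (D w)), ← Real.sqrt_sq (norm_nonneg w), ← Real.sqrt_mul hA]
    exact Real.sqrt_le_sqrt (hDb w)
  calc _ ≤ (‖fderiv ℝ f (Smap s y)‖ * ‖D‖) ^ 2 := by
        gcongr; exact ContinuousLinearMap.opNorm_comp_le _ _
    _ ≤ (‖fderiv ℝ f (Smap s y)‖ * √(Awt s s' y)) ^ 2 := by gcongr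
    _ = _ := by rw [mul_pow, Real.sq_sqrt hA]; ring

lemma gE_ae_ne (d : ℕ) (hd : 2 ≤ d) : ∀ᵐ y ∂(gE d), y ≠ 0 := by
  have : Nonempty (Fin d) := ⟨⟨0, by omega⟩⟩
  have h1 : ∀ᵐ y ∂(volume : Measure (EuclideanSpace ℝ (Fin d))), y ≠ 0 :=
    compl_mem_ae_iff.2 (measure_singleton 0)
  rw [gE_density]
  exact (withDensity_absolutelyContinuous _ _).ae_le h1

/-- bound on the integrand on the right -/
lemma rhs_bound {d : ℕ} {s s' : ℝ → ℝ} (h : RadOK s s') (R0 L : ℝ) (hR : 0 < R0) :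
    ∃ M, 0 ≤ M ∧ ∀ f : EuclideanSpace ℝ (Fin d) → ℝ, (∀ x, R0 < ‖x‖ → f x = 0) →
      (∀ x, ‖fderiv ℝ f x‖ ≤ L) → ∀ y, y ≠ 0 → Awt s s' y * ‖fderiv ℝ f (Smap s y)‖ ^ 2 ≤ M := by
  obtain ⟨C, hC0, hC⟩ := Awt_bound (d := d) h R0 hR
  refine ⟨C * L ^ 2, by positivity, fun f hf hL y hy => ?_⟩
  by_cases hc : s ‖y‖ ≤ R0
  · have := hC y hy hc
    have := hL (Smap s y)
    gcongr
  · push Not at hc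
    rw [← Smap_norm h hy] at hc
    have : f =ᶠ[𝓝 (Smap s y)] fun _ => 0 := by
      filter_upwards [(isOpen_lt continuous_const continuous_norm).mem_nhds hc] with x hx
      exact hf x hx
    rw [this.fderiv_eq]
    simp
    positivity

lemma lsi_S_core (d : ℕ) (hd : 2 ≤ d) {s s' : ℝ → ℝ} (h : RadOK s s')
    (f : EuclideanSpace ℝ (Fin d) → ℝ) (hf : ContDiff ℝ 1 f) (R0 B L : ℝ) (hR : 0 < R0)
    (hsupp : ∀ x, R0 < ‖x‖ → f x = 0) (hB : ∀ x, |f x| ≤ B) (hL : ∀ x, ‖fderiv ℝ f x‖ ≤ L)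
    (ε : ℝ) (hε : 0 < ε) (hf0 : ∀ x, ‖x‖ < ε → f x = f 0) :
    (∫ y, f (Smap s y) ^ 2 * log (f (Smap s y) ^ 2) ∂(gE d)) -
      (∫ y, f (Smap s y) ^ 2 ∂(gE d)) * log (∫ y, f (Smap s y) ^ 2 ∂(gE d)) ≤
      2 * ∫ y, Awt s s' y * ‖fderiv ℝ f (Smap s y)‖ ^ 2 ∂(gE d) := by
  obtain ⟨M, hM0, hM⟩ := rhs_bound (d := d) h R0 L hR
  have hloc : (fun y => f (Smap s y)) =ᶠ[𝓝 (0 : EuclideanSpace ℝ (Fin d))] fun _ => f 0 := by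
    obtain ⟨C, hC⟩ := h.bd 1 one_pos
    have hC0 : 0 ≤ C := (h.all 1 one_pos).2.1.trans (hC 1 one_pos le_rfl).2
    have hδ : 0 < min 1 (ε / (C + 1)) := by positivity
    filter_upwards [Metric.ball_mem_nhds (0 : EuclideanSpace ℝ (Fin d)) hδ] with y hy
    rw [mem_ball_zero_iff, lt_min_iff] at hy
    by_cases hy0 : y = 0
    · simp [hy0, Smap]
    · apply hf0
      rw [Smap_norm h hy0]
      have h1 := (hC _ (norm_pos_iff.2 hy0) hy.1.le).1
      have h2 := hy.2
      rw [lt_div_iff₀ (by positivity)] at h2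
      nlinarith [norm_nonneg y]
  have hg : ContDiff ℝ 1 (fun y => f (Smap s y)) := by
    rw [contDiff_iff_contDiffAt]
    intro y
    by_cases hy : y = 0
    · rw [hy]
      exact contDiffAt_const.congr_of_eventuallyEq hloc
    · exact hf.contDiffAt.comp y (Smap_contDiffAt h hy)
  have hgb : ∀ y, ‖fderiv ℝ (fun y => f (Smap s y)) y‖ ^ 2 ≤ M := fun y => by
    by_cases hy : y = 0
    · rw [hy, hloc.fderiv_eq]; simpa using hM0
    · exact (comp_bound h hy f hf).trans (hM f hsupp hL y hy)
  have hmain := lsi_E d (fun y => f (Smap s y)) hg B (√M) (fun y => hB _)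
    (fun y => Real.le_sqrt_of_sq_le (hgb y))
  refine hmain.trans ?_
  have hdc : Continuous (fderiv ℝ f) := hf.continuous_fderiv (by simp)
  have hdc' : Continuous (fderiv ℝ (fun y => f (Smap s y))) := hg.continuous_fderiv (by simp)
  have hSm := Smap_meas (d := d) s h.sc
  have hAm := Awt_meas (d := d) h
  have hmeas : Measurable fun y => Awt s s' y * ‖fderiv ℝ f (Smap s y)‖ ^ 2 :=
    hAm.mul ((hdc.norm.pow 2).measurable.comp hSm)
  have hae := gE_ae_ne d hd
  refine mul_le_mul_of_nonneg_left (integral_mono_ae ?_ ?_ ?_) (by norm_num)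
  · refine Integrable.of_bound (C := M) (hdc'.norm.pow 2).aestronglyMeasurable (Eventually.of_forall fun y => ?_)
    rw [Real.norm_of_nonneg (by positivity)]
    exact hgb y
  · refine Integrable.of_bound (C := M) hmeas.aestronglyMeasurable ?_
    filter_upwards [hae] with y hy
    rw [Real.norm_of_nonneg (mul_nonneg (Awt_nonneg _ _ _) (by positivity))]
    exact hM f hsupp hL y hy
  · filter_upwards [hae] with y hy
    exact comp_bound h hy f hf

lemma exists_approx (d : ℕ) (f : EuclideanSpace ℝ (Fin d) → ℝ) (hf : ContDiff ℝ 1 f)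
    (hs : HasCompactSupport f) :
    ∃ (R0 B L : ℝ) (F : ℕ → EuclideanSpace ℝ (Fin d) → ℝ), 0 < R0 ∧
      (∀ x, R0 < ‖x‖ → f x = 0) ∧ (∀ x, |f x| ≤ B) ∧ (∀ x, ‖fderiv ℝ f x‖ ≤ L) ∧
      (∀ n, ContDiff ℝ 1 (F n) ∧ (∀ x, R0 < ‖x‖ → F n x = 0) ∧ (∀ x, |F n x| ≤ B) ∧
        (∀ x, ‖fderiv ℝ (F n) x‖ ≤ L) ∧ ∃ ε, 0 < ε ∧ ∀ x, ‖x‖ < ε → F n x = F n 0) ∧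
      ∀ x, x ≠ 0 → ∀ᶠ n in atTop, F n =ᶠ[𝓝 x] f := by
  obtain ⟨B, hB⟩ := hf.continuous.bounded_above_of_compact_support hs
  obtain ⟨L, hL⟩ := (hf.continuous_fderiv (by simp)).bounded_above_of_compact_support (hs.fderiv ℝ)
  obtain ⟨R, hR⟩ := hs.isCompact.isBounded.subset_closedBall 0
  have hL0 : 0 ≤ L := (norm_nonneg _).trans (hL 0)
  have hfR : ∀ x, R < ‖x‖ → f x = 0 := fun x hx => by
    by_contra hne
    have := hR (subset_tsupport f hne)
    rw [mem_closedBall_zero_iff] at this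
    linarith
  let χ : ContDiffBump (0 : EuclideanSpace ℝ (Fin d)) := ⟨1, 2, one_pos, one_lt_two⟩
  set ρ : EuclideanSpace ℝ (Fin d) → EuclideanSpace ℝ (Fin d) := fun x => χ x • x with hρ
  have hρd : ContDiff ℝ 1 ρ := χ.contDiff.smul contDiff_id
  have hρs : HasCompactSupport ρ := χ.hasCompactSupport.smul_right
  obtain ⟨K, hK⟩ := (hρd.continuous_fderiv (by simp)).bounded_above_of_compact_support (hρs.fderiv ℝ)
  have hK0 : 0 ≤ K := (norm_nonneg _).trans (hK 0)
  set ε : ℕ → ℝ := fun n => 1 / ((n:ℝ) + 1) with hεdef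
  have hε0 : ∀ n, 0 < ε n := fun n => by positivity
  have hε1 : ∀ n, ε n ≤ 1 := fun n => by
    simp only [hεdef]; rw [div_le_one (by positivity)]; linarith [(Nat.cast_nonneg n : (0:ℝ) ≤ n)]
  have hεl : Tendsto ε atTop (𝓝 0) := tendsto_one_div_add_atTop_nhds_zero_nat
  set G : ℕ → EuclideanSpace ℝ (Fin d) → EuclideanSpace ℝ (Fin d) :=
    fun n x => x - ε n • ρ ((ε n)⁻¹ • x) with hG
  have hGd : ∀ n, ContDiff ℝ 1 (G n) := fun n =>
    contDiff_id.sub ((hρd.comp (contDiff_id.const_smul _)).const_smul _)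
  have hGf : ∀ n x, ‖fderiv ℝ (G n) x‖ ≤ 1 + K := fun n x => by
    have h1 : HasFDerivAt (fun x : EuclideanSpace ℝ (Fin d) => (ε n)⁻¹ • x)
        ((ε n)⁻¹ • ContinuousLinearMap.id ℝ _) x :=
      (hasFDerivAt_id (𝕜 := ℝ) x).const_smul (ε n)⁻¹
    have h2 := ((hρd.differentiable (by simp)) ((ε n)⁻¹ • x)).hasFDerivAt.comp x h1
    have h3 : HasFDerivAt (G n) _ x := (hasFDerivAt_id x).sub (h2.const_smul (ε n))
    rw [h3.fderiv]
    refine (norm_sub_le _ _).trans (add_le_add ContinuousLinearMap.norm_id_le ?_)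
    rw [ContinuousLinearMap.comp_smul, smul_smul, mul_inv_cancel₀ (hε0 n).ne', one_smul,
      ContinuousLinearMap.comp_id]
    exact hK _
  have hGout : ∀ n x, 2 * ε n ≤ ‖x‖ → G n x = x := fun n x hx => by
    have : χ ((ε n)⁻¹ • x) = 0 := χ.zero_of_le_dist (by
      rw [dist_zero_right, norm_smul, norm_inv, Real.norm_of_nonneg (hε0 n).le]
      have := hε0 n
      change 2 ≤ _
      rw [inv_mul_eq_div, le_div_iff₀ this]; exact hx)
    simp [hG, hρ, this]
  have hGin : ∀ n x, ‖x‖ < ε n → G n x = 0 := fun n x hx => by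
    have : χ ((ε n)⁻¹ • x) = 1 := χ.one_of_mem_closedBall (by
      rw [mem_closedBall_zero_iff, norm_smul, norm_inv, Real.norm_of_nonneg (hε0 n).le]
      have := hε0 n
      change _ ≤ 1
      rw [inv_mul_eq_div, div_le_one this]; exact hx.le)
    simp [hG, hρ, this, smul_smul, mul_inv_cancel₀ (hε0 n).ne']
  refine ⟨max R 2, B, L * (1 + K), fun n x => f (G n x), by positivity, fun x hx => hfR x
    ((le_max_left _ _).trans_lt hx), hB, fun x => (hL x).trans (by nlinarith), fun n =>
    ⟨hf.comp (hGd n), fun x hx => ?_, fun x => hB _, fun x => ?_, ε n, hε0 n, fun x hx => ?_⟩, fun x hx => ?_⟩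
  · have h2 : 2 * ε n ≤ ‖x‖ := by linarith [hε1 n, le_max_right R 2]
    simp only [hGout n x h2]
    exact hfR x ((le_max_left _ _).trans_lt hx)
  · have h1 := (hf.differentiable (by simp) (G n x)).hasFDerivAt.comp x
      ((hGd n).differentiable (by simp) x).hasFDerivAt
    have h2 : HasFDerivAt (fun x => f (G n x)) _ x := h1
    rw [h2.fderiv]
    exact (ContinuousLinearMap.opNorm_comp_le _ _).trans (mul_le_mul (hL _) (hGf n x) (norm_nonneg _) hL0)
  · simp only [hGin n x hx, hGin n 0 (by simpa using hε0 n)]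
  · have hx0 : 0 < ‖x‖ := norm_pos_iff.2 hx
    have h2 : Tendsto (fun n => 2 * ε n) atTop (𝓝 0) := by simpa using hεl.const_mul 2
    filter_upwards [h2.eventually (gt_mem_nhds hx0)] with n hn
    filter_upwards [(isOpen_lt continuous_const continuous_norm).mem_nhds hn] with z hz
    rw [hGout n z (le_of_lt hz)]

lemma lsi_S (d : ℕ) (hd : 2 ≤ d) {s s' : ℝ → ℝ} (h : RadOK s s')
    (f : EuclideanSpace ℝ (Fin d) → ℝ) (hf : ContDiff ℝ 1 f) (hs : HasCompactSupport f) :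
    (∫ y, f (Smap s y) ^ 2 * log (f (Smap s y) ^ 2) ∂(gE d)) -
      (∫ y, f (Smap s y) ^ 2 ∂(gE d)) * log (∫ y, f (Smap s y) ^ 2 ∂(gE d)) ≤
      2 * ∫ y, Awt s s' y * ‖fderiv ℝ f (Smap s y)‖ ^ 2 ∂(gE d) := by
  obtain ⟨R0, B, L, F, hR, hfR, hfB, hfL, hF, hFl⟩ := exists_approx d f hf hs
  obtain ⟨M, hM0, hM⟩ := rhs_bound (d := d) h R0 L hR
  have hae := gE_ae_ne d hd
  have hSm := Smap_meas (d := d) s h.sc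
  have hAm := Awt_meas (d := d) h
  obtain ⟨D, hD⟩ := (isCompact_Icc (a := 0) (b := B^2)).exists_bound_of_continuousOn
      (f := fun t => t * log t) (by exact Real.continuous_mul_log.continuousOn)
  have hF2 : ∀ n x, F n x ^ 2 ≤ B^2 := fun n x => by
    rw [← sq_abs]; have := (hF n).2.2.1 x; gcongr
  have hSne : ∀ y, y ≠ 0 → Smap s y ≠ (0 : EuclideanSpace ℝ (Fin d)) := fun y hy => by
    rw [← norm_pos_iff, Smap_norm h hy]
    exact (h.all _ (norm_pos_iff.2 hy)).1
  have hpt : ∀ y, y ≠ 0 → ∀ᶠ n in atTop, F n (Smap s y) = f (Smap s y) ∧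
      fderiv ℝ (F n) (Smap s y) = fderiv ℝ f (Smap s y) := fun y hy => by
    filter_upwards [hFl _ (hSne y hy)] with n hn
    exact ⟨hn.eq_of_nhds, hn.fderiv_eq⟩
  have hFm : ∀ n, Measurable fun y => F n (Smap s y) := fun n =>
    (hF n).1.continuous.measurable.comp hSm
  have l1 : Tendsto (fun n => ∫ y, F n (Smap s y) ^ 2 * log (F n (Smap s y) ^ 2) ∂(gE d)) atTop
      (𝓝 (∫ y, f (Smap s y) ^ 2 * log (f (Smap s y) ^ 2) ∂(gE d))) := by
    refine tendsto_integral_of_dominated_convergence (fun _ => D) (fun n => ?_) (integrable_const _)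
      (fun n => Eventually.of_forall fun y => hD _ ⟨sq_nonneg _, hF2 n _⟩) ?_
    · exact (((hFm n).pow_const 2).mul ((hFm n).pow_const 2).log).aestronglyMeasurable
    · filter_upwards [hae] with y hy
      refine tendsto_const_nhds.congr' ?_
      filter_upwards [hpt y hy] with n hn
      rw [hn.1]
  have l2 : Tendsto (fun n => ∫ y, F n (Smap s y) ^ 2 ∂(gE d)) atTop
      (𝓝 (∫ y, f (Smap s y) ^ 2 ∂(gE d))) := by
    refine tendsto_integral_of_dominated_convergence (fun _ => B ^ 2) (fun n => ?_) (integrable_const _)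
      (fun n => Eventually.of_forall fun y => ?_) ?_
    · exact ((hFm n).pow_const 2).aestronglyMeasurable
    · rw [Real.norm_of_nonneg (sq_nonneg _)]; exact hF2 n _
    · filter_upwards [hae] with y hy
      refine tendsto_const_nhds.congr' ?_
      filter_upwards [hpt y hy] with n hn
      rw [hn.1]
  have l3 : Tendsto (fun n => ∫ y, Awt s s' y * ‖fderiv ℝ (F n) (Smap s y)‖ ^ 2 ∂(gE d)) atTop
      (𝓝 (∫ y, Awt s s' y * ‖fderiv ℝ f (Smap s y)‖ ^ 2 ∂(gE d))) := by
    refine tendsto_integral_of_dominated_convergence (fun _ => M) (fun n => ?_) (integrable_const _)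
      (fun n => ?_) ?_
    · have hdc : Continuous (fderiv ℝ (F n)) := (hF n).1.continuous_fderiv (by simp)
      exact (hAm.mul ((hdc.norm.pow 2).measurable.comp hSm)).aestronglyMeasurable
    · filter_upwards [hae] with y hy
      rw [Real.norm_of_nonneg (mul_nonneg (Awt_nonneg _ _ _) (by positivity))]
      exact hM _ (hF n).2.1 (hF n).2.2.2.1 y hy
    · filter_upwards [hae] with y hy
      refine tendsto_const_nhds.congr' ?_
      filter_upwards [hpt y hy] with n hn
      rw [hn.2]
  have l4 : Tendsto (fun n => (∫ y, F n (Smap s y) ^ 2 ∂(gE d)) *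
      log (∫ y, F n (Smap s y) ^ 2 ∂(gE d))) atTop
      (𝓝 ((∫ y, f (Smap s y) ^ 2 ∂(gE d)) * log (∫ y, f (Smap s y) ^ 2 ∂(gE d)))) :=
    (Real.continuous_mul_log.tendsto _).comp l2
  refine le_of_tendsto_of_tendsto' (l1.sub l4) (l3.const_mul 2) fun n => ?_
  obtain ⟨h1, h2, h3, h4, ε, hε, h5⟩ := hF n
  exact lsi_S_core d hd h (F n) h1 R0 B L hR h2 h3 h4 ε hε h5

theorem stmt15 (d : ℕ) (hd : 2 ≤ d)
    (v : ℝ → ℝ) (hv : ContinuousOn v (Ici 0))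
    (hV1 : ∫ x : EuclideanSpace ℝ (Fin d), Real.exp (v ‖x‖) = 1)
    (μ : Measure (EuclideanSpace ℝ (Fin d)))
    (hμ : μ = volume.withDensity (fun x => ENNReal.ofReal (Real.exp (v ‖x‖)))) :
    ∀ f : EuclideanSpace ℝ (Fin d) → ℝ,
      ContDiff ℝ (⊤ : ℕ∞) f → HasCompactSupport f → ∫ x, f x ^ 2 ∂μ = 1 →
      ∫ x, f x ^ 2 * Real.log (f x ^ 2) ∂μ ≤
        2 * ∫ x, alphaRad d v x * ‖gradient f x‖ ^ 2 ∂μ := by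
  intro f hf hs h1
  obtain ⟨s, s', hall, hc, hm, hi, hb, hmap, hal, ham⟩ := radial_package d hd v hv hV1
  have h : RadOK s s' := ⟨hall, hc, hm, hi, hb⟩
  have hf1 : ContDiff ℝ 1 f := hf.of_le (by exact_mod_cast le_top)
  have hgr : ∀ x, ‖gradient f x‖ = ‖fderiv ℝ f x‖ := fun x => by
    rw [gradient, LinearIsometryEquiv.norm_map]
  have hSm := Smap_meas (d := d) s h.sc
  have hfc := hf1.continuous
  have hfm := hfc.measurable
  have hdc : Continuous (fderiv ℝ f) := hf1.continuous_fderiv (by simp)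
  have hdm : Measurable fun x => ‖fderiv ℝ f x‖ ^ 2 := (hdc.norm.pow 2).measurable
  have key := lsi_S d hd h f hf1 hs
  simp only [hgr]
  rw [hμ, ← hmap] at h1 ⊢
  rw [integral_map hSm.aemeasurable (Measurable.aestronglyMeasurable (by fun_prop))] at h1 ⊢
  have hm2 : Measurable fun x => alphaRad d v x * ‖fderiv ℝ f x‖ ^ 2 := ham.mul hdm
  rw [integral_map hSm.aemeasurable hm2.aestronglyMeasurable]
  rw [h1] at key
  simp only [Real.log_one, mul_zero, sub_zero] at key
  refine key.trans (le_of_eq ?_)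
  congr 1
  refine integral_congr_ae ?_
  filter_upwards [gE_ae_ne d hd] with y hy
  rw [hal y hy]; rfl
end

section
/- Let d ≥ 2 and let V ∈ C¹(ℝ^d) with ∫ e^{V(x)} dx = 1; let μ(dx) = e^{V(x)} dx. Assume there exist constants δ, c₁, c₂ > 0 and R > 0 such that −c₁ |x|^{δ−1} ≤ ⟨∇V(x), x/|x|⟩ ≤ −c₂ |x|^{δ−1} for all |x| ≥ R, and there exists c₃ > 0 such that the angular derivative bound |x| · |∇V(x) − ⟨∇V(x), x/|x|⟩ x/|x|| ≤ c₃ holds for all x ≠ 0. Then there exists a constant c > 0 such that for every f ∈ C_c^∞(ℝ^d) with ∫ f² dμ = 1, one has ∫ f² log f² dμ ≤ c ∫ (1+|x|)^{2−δ} |∇f(x)|² μ(dx). -/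
open MeasureTheory Real Set
open scoped RealInnerProductSpace
open scoped ENNReal



lemma lp_scale {E : Type*} [NormedAddCommGroup E] [NormedSpace ℝ E] [MeasurableSpace E]
    [BorelSpace E] [FiniteDimensional ℝ E] (μ : Measure E) [μ.IsAddHaarMeasure]
    (G : E → ℝ≥0∞) (hG : Measurable G) (s : ℝ) (hs : 1/2 ≤ s) (b : E) :
    ∫⁻ x, G (s • x + b) ∂μ ≤ ENNReal.ofReal (2 ^ Module.finrank ℝ E) * ∫⁻ x, G x ∂μ := by
  have hs0 : s ≠ 0 := by linarith
  have h1 : ∫⁻ x, G (s • x + b) ∂μ = ∫⁻ z, G (z + b) ∂(Measure.map (fun x => s • x) μ) := by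
    rw [lintegral_map (by fun_prop) (by fun_prop)]
  rw [h1, Measure.map_addHaar_smul μ hs0, lintegral_smul_measure, lintegral_add_right_eq_self]
  rw [smul_eq_mul]
  gcongr
  rw [abs_of_nonneg (by positivity), ← inv_pow]
  have : s⁻¹ ≤ 2 := by
    rw [inv_le_comm₀ (by linarith) (by norm_num)]; linarith
  have : 0 ≤ s⁻¹ := by positivity
  gcongr

lemma sq_int_le (φ : ℝ → ℝ) (hφ : Continuous φ) :
    (∫ t in (0:ℝ)..1, φ t) ^ 2 ≤ ∫ t in (0:ℝ)..1, φ t ^ 2 := by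
  set c := ∫ t in (0:ℝ)..1, φ t with hc
  have h : 0 ≤ ∫ t in (0:ℝ)..1, (φ t - c) ^ 2 :=
    intervalIntegral.integral_nonneg (by norm_num) (fun t _ => sq_nonneg _)
  have h2 : ∫ t in (0:ℝ)..1, (φ t - c) ^ 2 = (∫ t in (0:ℝ)..1, φ t ^ 2) - 2 * c * c + c ^ 2 := by
    have : ∀ t, (φ t - c) ^ 2 = φ t ^ 2 - 2 * c * φ t + c ^ 2 := fun t => by ring
    simp_rw [this]
    rw [intervalIntegral.integral_add, intervalIntegral.integral_sub,
      intervalIntegral.integral_const_mul, ← hc]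
    · simp
    all_goals apply Continuous.intervalIntegrable; fun_prop
  nlinarith

lemma lp_segment {E : Type*} [NormedAddCommGroup E] [NormedSpace ℝ E] 
    (f : E → ℝ) (hf : ContDiff ℝ 1 f) (x y : E) :
    (f y - f x) ^ 2 ≤ ‖y - x‖ ^ 2 * ∫ t in (0:ℝ)..1, ‖fderiv ℝ f ((1 - t) • x + t • y)‖ ^ 2 := by
  have hd : ∀ t : ℝ, HasDerivAt (fun t : ℝ => f ((1 - t) • x + t • y))
      (fderiv ℝ f ((1 - t) • x + t • y) (y - x)) t := by
    intro t
    have h1 : HasDerivAt (fun t : ℝ => (1 - t) • x + t • y) (y - x) t := by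
      have := (((hasDerivAt_id t).const_sub 1).smul_const x).add ((hasDerivAt_id t).smul_const y)
      refine this.congr_deriv ?_
      simp; abel
    exact ((hf.differentiable one_ne_zero _).hasFDerivAt).comp_hasDerivAt t h1
  have hcd : Continuous (fderiv ℝ f) := hf.continuous_fderiv one_ne_zero
  have hc : Continuous (fun t : ℝ => fderiv ℝ f ((1 - t) • x + t • y) (y - x)) := by fun_prop
  have hFTC := intervalIntegral.integral_eq_sub_of_hasDerivAt (a := 0) (b := 1)
    (fun t _ => hd t) (hc.intervalIntegrable _ _)
  have hFTC' : f y - f x = ∫ t in (0:ℝ)..1, fderiv ℝ f ((1 - t) • x + t • y) (y - x) := by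
    rw [hFTC]; simp
  rw [hFTC']
  refine (sq_int_le _ hc).trans ?_
  rw [← intervalIntegral.integral_const_mul]
  apply intervalIntegral.integral_mono_on (by norm_num)
  · apply Continuous.intervalIntegrable; fun_prop
  · apply Continuous.intervalIntegrable; fun_prop
  · intro t _
    have := (fderiv ℝ f ((1 - t) • x + t • y)).le_opNorm (y - x)
    rw [← mul_pow, ← sq_abs, mul_comm]
    gcongr
    simpa using this

lemma local_poincare {E : Type*} [NormedAddCommGroup E] [NormedSpace ℝ E] [MeasurableSpace E]
    [BorelSpace E] [FiniteDimensional ℝ E] (μ : Measure E) [μ.IsAddHaarMeasure] (ρ : ℝ)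
    (hρ : 0 < ρ) : ∃ C > (0:ℝ), ∀ f : E → ℝ, ContDiff ℝ 1 f → ∃ a : ℝ,
      ∫ x in Metric.closedBall 0 ρ, (f x - a) ^ 2 ∂μ ≤
        C * ∫ x in Metric.closedBall 0 ρ, ‖fderiv ℝ f x‖ ^ 2 ∂μ := by
  set B : Set E := Metric.closedBall 0 ρ with hB
  have hBm : MeasurableSet B := Metric.isClosed_closedBall.measurableSet
  have hBfin : μ B ≠ ∞ := (isCompact_closedBall _ _).measure_lt_top.ne
  have hB0 : μ B ≠ 0 := (Metric.measure_closedBall_pos μ _ hρ).ne'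
  refine ⟨4 * ρ ^ 2 * 2 ^ Module.finrank ℝ E, by positivity, fun f hf => ?_⟩
  have hcd : Continuous (fderiv ℝ f) := hf.continuous_fderiv one_ne_zero
  have hcf : Continuous f := hf.continuous
  set g : E → ℝ := fun z => ‖fderiv ℝ f z‖ ^ 2 with hg
  have hgc : Continuous g := by fun_prop
  set G : E → ℝ≥0∞ := B.indicator (fun z => ENNReal.ofReal (g z)) with hG
  have hGm : Measurable G := (hgc.measurable.ennreal_ofReal).indicator hBm
  set D : ℝ≥0∞ := ENNReal.ofReal (2 ^ Module.finrank ℝ E) with hD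
  set I : ℝ≥0∞ := ∫⁻ z, G z ∂μ with hI
  -- pointwise
  have hpt : ∀ y ∈ B, ∀ x ∈ B, ENNReal.ofReal ((f x - f y) ^ 2) ≤
      ENNReal.ofReal (4 * ρ ^ 2) * ∫⁻ t in Ioc (0:ℝ) 1, G ((1 - t) • y + t • x) := by
    intro y hy x hx
    have h1 := lp_segment f hf y x
    have h2 : ‖x - y‖ ^ 2 ≤ 4 * ρ ^ 2 := by
      have : ‖x - y‖ ≤ 2 * ρ := by
        have a1 : ‖x‖ ≤ ρ := by simpa [hB] using hx
        have a2 : ‖y‖ ≤ ρ := by simpa [hB] using hy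
        linarith [norm_sub_le x y]
      calc _ ≤ (2 * ρ) ^ 2 := by gcongr
        _ = _ := by ring
    have h3 : 0 ≤ ∫ t in (0:ℝ)..1, g ((1 - t) • y + t • x) :=
      intervalIntegral.integral_nonneg (by norm_num) (fun t _ => by positivity)
    have h4 : (f x - f y) ^ 2 ≤ 4 * ρ ^ 2 * ∫ t in (0:ℝ)..1, g ((1 - t) • y + t • x) :=
      h1.trans (by gcongr)
    refine (ENNReal.ofReal_le_ofReal h4).trans ?_
    rw [ENNReal.ofReal_mul (by positivity)]
    gcongr
    rw [intervalIntegral.integral_of_le (by norm_num)]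
    rw [ofReal_integral_eq_lintegral_ofReal]
    · apply le_of_eq
      apply setLIntegral_congr_fun measurableSet_Ioc
      intro t ht
      have : (1 - t) • y + t • x ∈ B := by
        apply (convex_closedBall (0:E) ρ) hy hx (by linarith [ht.2]) ht.1.le (by ring)
      simp [hG, this]
    · have : Continuous (fun t : ℝ => g ((1 - t) • y + t • x)) := by fun_prop
      exact (this.intervalIntegrable 0 1).1
    · exact Filter.Eventually.of_forall (fun t => by positivity)
  -- double integral
  have hmeas3 : Measurable (fun q : (E × E) × ℝ => G ((1 - q.2) • q.1.1 + q.2 • q.1.2)) :=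
    hGm.comp (by fun_prop)
  have hdbl : ∫⁻ y in B, ∫⁻ x in B, ENNReal.ofReal ((f x - f y) ^ 2) ∂μ ∂μ ≤
      ENNReal.ofReal (4 * ρ ^ 2) * (D * I * μ B) := by
    calc _ ≤ ∫⁻ y in B, ∫⁻ x in B, ENNReal.ofReal (4 * ρ ^ 2) *
            (∫⁻ t in Ioc (0:ℝ) 1, G ((1 - t) • y + t • x)) ∂μ ∂μ := by
          apply setLIntegral_mono' hBm
          intro y hy
          apply setLIntegral_mono' hBm
          intro x hx
          exact hpt y hy x hx
      _ = ENNReal.ofReal (4 * ρ ^ 2) * ∫⁻ y in B, ∫⁻ x in B, 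
            (∫⁻ t in Ioc (0:ℝ) 1, G ((1 - t) • y + t • x)) ∂μ ∂μ := by
          rw [← lintegral_const_mul' _ _ ENNReal.ofReal_ne_top]
          congr 1; ext y
          rw [← lintegral_const_mul' _ _ ENNReal.ofReal_ne_top]
      _ = ENNReal.ofReal (4 * ρ ^ 2) * ∫⁻ t in Ioc (0:ℝ) 1, ∫⁻ y in B, ∫⁻ x in B, 
             G ((1 - t) • y + t • x) ∂μ ∂μ := by
          congr 1
          have e1 : ∀ y, ∫⁻ x in B, (∫⁻ t in Ioc (0:ℝ) 1, G ((1 - t) • y + t • x)) ∂μ 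
              = ∫⁻ t in Ioc (0:ℝ) 1, ∫⁻ x in B, G ((1 - t) • y + t • x) ∂μ := by
            intro y
            rw [lintegral_lintegral_swap]
            exact (hGm.comp (by fun_prop)).aemeasurable
          simp_rw [e1]
          rw [lintegral_lintegral_swap]
          have : Measurable (fun q : (E × ℝ) × E => G ((1 - q.1.2) • q.1.1 + q.1.2 • q.2)) :=
            hGm.comp (by fun_prop)
          exact (this.lintegral_prod_right' (ν := μ.restrict B)).aemeasurable
      _ ≤ ENNReal.ofReal (4 * ρ ^ 2) * ∫⁻ t in Ioc (0:ℝ) 1, D * I * μ B := by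
          gcongr with t
          by_cases ht : 1 / 2 ≤ t
          · calc _ ≤ ∫⁻ y in B, D * I ∂μ := by
                  gcongr with y
                  refine (setLIntegral_le_lintegral _ _).trans ?_
                  have := lp_scale μ G hGm t ht ((1 - t) • y)
                  simpa only [add_comm] using this
              _ = _ := by simp
          · rw [lintegral_lintegral_swap]
            · calc _ ≤ ∫⁻ x in B, D * I ∂μ := by
                    gcongr with x
                    refine (setLIntegral_le_lintegral _ _).trans ?_
                    exact lp_scale μ G hGm (1 - t) (by linarith) (t • x)
                _ = _ := by simp
            · exact (hGm.comp (by fun_prop)).aemeasurable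
      _ = _ := by simp
  obtain ⟨y, hy, hyle⟩ := exists_le_setLAverage (μ := μ) (s := B)
    (f := fun y => ∫⁻ x in B, ENNReal.ofReal ((f x - f y) ^ 2) ∂μ) hB0 hBfin (by
      have : Measurable (fun q : E × E => ENNReal.ofReal ((f q.2 - f q.1) ^ 2)) := by
        apply Measurable.ennreal_ofReal
        have := hcf.measurable
        fun_prop
      exact (this.lintegral_prod_right' (ν := μ.restrict B)).aemeasurable)
  refine ⟨f y, ?_⟩
  rw [setLAverage_eq] at hyle
  have hfinal : ∫⁻ x in B, ENNReal.ofReal ((f x - f y) ^ 2) ∂μ ≤ 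
      ENNReal.ofReal (4 * ρ ^ 2) * (D * I) := by
    refine hyle.trans ?_
    rw [ENNReal.div_le_iff hB0 hBfin]
    refine hdbl.trans (le_of_eq (by ring))
  have i1 : IntegrableOn g B μ := hgc.continuousOn.integrableOn_compact (isCompact_closedBall _ _)
  have i2 : IntegrableOn (fun x => (f x - f y) ^ 2) B μ :=
    (by fun_prop : Continuous (fun x => (f x - f y) ^ 2)).continuousOn.integrableOn_compact
      (isCompact_closedBall _ _)
  have hIeq : I = ENNReal.ofReal (∫ x in B, g x ∂μ) := by
    rw [ofReal_integral_eq_lintegral_ofReal i1 (Filter.Eventually.of_forall fun t => by positivity)]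
    rw [hI, hG, lintegral_indicator hBm]
  have hg0 : 0 ≤ ∫ x in B, g x ∂μ := integral_nonneg (fun t => by positivity)
  rw [← ofReal_integral_eq_lintegral_ofReal i2
    (Filter.Eventually.of_forall fun t => by positivity), hIeq, hD,
    ← ENNReal.ofReal_mul (by positivity), ← ENNReal.ofReal_mul (by positivity),
    ENNReal.ofReal_le_ofReal_iff (by positivity)] at hfinal
  linarith


lemma vb_ball {E : Type*} [NormedAddCommGroup E] [NormedSpace ℝ E] [FiniteDimensional ℝ E]
    (g : E → ℝ) (hg : Continuous g) (ρ : ℝ) : ∃ M > (0:ℝ), ∀ x, ‖x‖ ≤ ρ → |g x| ≤ M := by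
  obtain ⟨M, hM⟩ := (isCompact_closedBall (0:E) ρ).exists_bound_of_continuousOn hg.continuousOn
  refine ⟨max M 1, by positivity, fun x hx => ?_⟩
  exact (hM x (by simpa using hx)).trans (le_max_left _ _)

lemma one_le_w {E : Type*} [NormedAddCommGroup E] {δ : ℝ} (hδ : 0 < δ) (x : E) :
    1 ≤ (1 + ‖x‖) ^ δ :=
  Real.one_le_rpow (by linarith [norm_nonneg x]) hδ.le

lemma norm_le_w {E : Type*} [NormedAddCommGroup E] {δ : ℝ} (hδ : 0 < δ) (x : E) :
    ‖x‖ ^ δ ≤ (1 + ‖x‖) ^ δ := by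
  gcongr; linarith

lemma w_le_norm {E : Type*} [NormedAddCommGroup E] {δ R : ℝ} (hδ : 0 < δ) (hR : 0 < R) (x : E)
    (hx : R ≤ ‖x‖) : (1 + ‖x‖) ^ δ ≤ (1 + 1 / R) ^ δ * ‖x‖ ^ δ := by
  rw [← Real.mul_rpow (by positivity) (by positivity)]
  gcongr
  have : 1 ≤ ‖x‖ / R := by rw [le_div_iff₀ hR]; linarith
  calc 1 + ‖x‖ ≤ ‖x‖ / R + ‖x‖ := by linarith
    _ = _ := by ring

section
variable {E : Type*} [NormedAddCommGroup E] [InnerProductSpace ℝ E] [FiniteDimensional ℝ E]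

lemma vb_rad (V : E → ℝ) (hV : ContDiff ℝ 1 V) (δ c₁ c₂ R : ℝ) (hR : 0 < R)
    (hrad : ∀ x : E, R ≤ ‖x‖ →
      -c₁ * ‖x‖ ^ (δ - 1) ≤ ⟪gradient V x, ‖x‖⁻¹ • x⟫ ∧
      ⟪gradient V x, ‖x‖⁻¹ • x⟫ ≤ -c₂ * ‖x‖ ^ (δ - 1)) (x : E) (hx : R ≤ ‖x‖) :
    -c₁ * ‖x‖ ^ δ ≤ fderiv ℝ V x x ∧ fderiv ℝ V x x ≤ -c₂ * ‖x‖ ^ δ := by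
  have hx0 : 0 < ‖x‖ := by linarith
  have h1 : fderiv ℝ V x x = ‖x‖ * ⟪gradient V x, ‖x‖⁻¹ • x⟫ := by
    rw [inner_smul_right, ← mul_assoc, mul_inv_cancel₀ hx0.ne', one_mul]
    simp [gradient]
  have h2 : ‖x‖ ^ δ = ‖x‖ * ‖x‖ ^ (δ - 1) := by
    rw [Real.rpow_sub_one hx0.ne']; field_simp
  obtain ⟨a, b⟩ := hrad x hx
  rw [h1, h2]
  constructor <;> nlinarith

lemma vb_val (V : E → ℝ) (hV : ContDiff ℝ 1 V) (δ c₁ c₂ R : ℝ) (hδ : 0 < δ) (hR : 0 < R)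
    (hc₁ : 0 < c₁) (hc₂ : 0 < c₂)
    (hrad : ∀ x : E, R ≤ ‖x‖ →
      -c₁ * ‖x‖ ^ δ ≤ fderiv ℝ V x x ∧ fderiv ℝ V x x ≤ -c₂ * ‖x‖ ^ δ) :
    ∃ K > (0:ℝ), ∃ c > (0:ℝ), (∀ x, -V x ≤ K * (1 + ‖x‖) ^ δ) ∧ (∀ x, V x ≤ K - c * ‖x‖ ^ δ) := by
  obtain ⟨M, hM0, hM⟩ := vb_ball V hV.continuous R
  have key : ∀ x : E, R ≤ ‖x‖ → -M - c₁ / δ * ‖x‖ ^ δ ≤ V x ∧ 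
      V x ≤ M + c₂ / δ * R ^ δ - c₂ / δ * ‖x‖ ^ δ := by
    intro x hx
    have hx0 : 0 < ‖x‖ := by linarith
    set θ : E := ‖x‖⁻¹ • x with hθ
    have hθn : ‖θ‖ = 1 := by rw [hθ, norm_smul]; simp [hx0.ne']
    have hxθ : ‖x‖ • θ = x := by rw [hθ, smul_smul, mul_inv_cancel₀ hx0.ne', one_smul]
    have hd : ∀ r : ℝ, HasDerivAt (fun r : ℝ => V (r • θ)) (fderiv ℝ V (r • θ) θ) r := by
      intro r
      have h1 : HasDerivAt (fun r : ℝ => r • θ) θ r := by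
        simpa using (hasDerivAt_id r).smul_const θ
      exact ((hV.differentiable one_ne_zero _).hasFDerivAt).comp_hasDerivAt r h1
    have hp : ∀ r : ℝ, 0 < r → ∀ c : ℝ, HasDerivAt (fun r : ℝ => c / δ * r ^ δ) (c * r ^ (δ - 1)) r := by
      intro r hr c
      have := (Real.hasDerivAt_rpow_const (x := r) (p := δ) (Or.inl hr.ne')).const_mul (c / δ)
      refine this.congr_deriv ?_
      field_simp
    have hb : ∀ r : ℝ, R ≤ r → -c₁ * r ^ (δ - 1) ≤ fderiv ℝ V (r • θ) θ ∧ 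
        fderiv ℝ V (r • θ) θ ≤ -c₂ * r ^ (δ - 1) := by
      intro r hr
      have hr0 : 0 < r := by linarith
      have hn : ‖r • θ‖ = r := by rw [norm_smul, hθn, mul_one, Real.norm_of_nonneg hr0.le]
      have := hrad (r • θ) (by rw [hn]; exact hr)
      rw [hn, map_smul, smul_eq_mul] at this
      have h2 : r ^ δ = r * r ^ (δ - 1) := by
        rw [Real.rpow_sub_one hr0.ne']; field_simp
      rw [h2] at this
      constructor
      · have := this.1
        have : r * (-c₁ * r ^ (δ - 1)) ≤ r * fderiv ℝ V (r • θ) θ := by linarith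
        exact le_of_mul_le_mul_left this hr0
      · have := this.2
        have : r * fderiv ℝ V (r • θ) θ ≤ r * (-c₂ * r ^ (δ - 1)) := by linarith
        exact le_of_mul_le_mul_left this hr0
    have hMR := abs_le.1 (hM (R • θ) (by rw [norm_smul, hθn, mul_one, Real.norm_of_nonneg hR.le]))
    have hcont : ∀ c : ℝ, ContinuousOn (fun r : ℝ => V (r • θ) + c / δ * r ^ δ) (Ici R) := by
      intro c r hr
      have hr0 : 0 < r := lt_of_lt_of_le hR hr
      exact ((hd r).add (hp r hr0 c)).continuousAt.continuousWithinAt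
    have hmono : MonotoneOn (fun r : ℝ => V (r • θ) + c₁ / δ * r ^ δ) (Ici R) := by
      apply monotoneOn_of_deriv_nonneg (convex_Ici R) (hcont c₁)
      · intro r hr
        simp only [interior_Ici, mem_Ioi] at hr
        exact ((hd r).add (hp r (hR.trans hr) c₁)).differentiableAt.differentiableWithinAt
      · intro r hr
        simp only [interior_Ici, mem_Ioi] at hr
        rw [show (fun r : ℝ => V (r • θ) + c₁ / δ * r ^ δ) = (fun r : ℝ => V (r • θ)) + (fun r : ℝ => c₁ / δ * r ^ δ) from rfl, ((hd r).add (hp r (hR.trans hr) c₁)).deriv]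
        linarith [(hb r hr.le).1]
    have hanti : AntitoneOn (fun r : ℝ => V (r • θ) + c₂ / δ * r ^ δ) (Ici R) := by
      apply antitoneOn_of_deriv_nonpos (convex_Ici R) (hcont c₂)
      · intro r hr
        simp only [interior_Ici, mem_Ioi] at hr
        exact ((hd r).add (hp r (hR.trans hr) c₂)).differentiableAt.differentiableWithinAt
      · intro r hr
        simp only [interior_Ici, mem_Ioi] at hr
        rw [show (fun r : ℝ => V (r • θ) + c₂ / δ * r ^ δ) = (fun r : ℝ => V (r • θ)) + (fun r : ℝ => c₂ / δ * r ^ δ) from rfl, ((hd r).add (hp r (hR.trans hr) c₂)).deriv]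
        linarith [(hb r hr.le).2]
    have m1 := hmono (mem_Ici.2 le_rfl) (mem_Ici.2 hx) hx
    have m2 := hanti (mem_Ici.2 le_rfl) (mem_Ici.2 hx) hx
    simp only [hxθ] at m1 m2
    have : 0 ≤ c₁ / δ * R ^ δ := by positivity
    constructor <;> linarith
  refine ⟨M + c₁ / δ + c₂ / δ * R ^ δ, by positivity, c₂ / δ, by positivity, fun x => ?_, fun x => ?_⟩
  · have h1 := one_le_w hδ x
    have h2 := norm_le_w hδ x
    have p1 : 0 ≤ c₁ / δ := by positivity
    have p2 : 0 ≤ c₂ / δ * R ^ δ := by positivity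
    rcases le_total R ‖x‖ with hx | hx
    · have := (key x hx).1
      nlinarith [mul_le_mul_of_nonneg_left h1 hM0.le, mul_le_mul_of_nonneg_left h2 p1, mul_le_mul_of_nonneg_left h1 p2]
    · have := (abs_le.1 (hM x hx)).1
      nlinarith [mul_le_mul_of_nonneg_left h1 hM0.le, mul_le_mul_of_nonneg_left h1 p1, mul_le_mul_of_nonneg_left h1 p2]
  · have p1 : 0 ≤ c₁ / δ := by positivity
    rcases le_total R ‖x‖ with hx | hx
    · have := (key x hx).2
      linarith
    · have := (abs_le.1 (hM x hx)).2
      have : c₂ / δ * ‖x‖ ^ δ ≤ c₂ / δ * R ^ δ := by gcongr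
      linarith

lemma vb_grad (V : E → ℝ) (hV : ContDiff ℝ 1 V) (δ c₁ c₂ R : ℝ) (hδ : 0 < δ) (hR : 0 < R)
    (hc₁ : 0 < c₁) (hc₂ : 0 < c₂)
    (hrad : ∀ x : E, R ≤ ‖x‖ →
      -c₁ * ‖x‖ ^ δ ≤ fderiv ℝ V x x ∧ fderiv ℝ V x x ≤ -c₂ * ‖x‖ ^ δ) (c₃ : ℝ) (hc₃ : 0 < c₃)
    (hang : ∀ x : E, x ≠ 0 →
      ‖x‖ * ‖gradient V x - ⟪gradient V x, ‖x‖⁻¹ • x⟫ • (‖x‖⁻¹ • x)‖ ≤ c₃) :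
    ∃ K > (0:ℝ), ∀ x, ‖fderiv ℝ V x‖ ≤ K * (1 + ‖x‖) ^ δ := by
  obtain ⟨M, hM0, hM⟩ := vb_ball (fun x => ‖fderiv ℝ V x‖)
    (hV.continuous_fderiv one_ne_zero).norm R
  refine ⟨M + c₃ / R + c₁ / R, by positivity, fun x => ?_⟩
  have h1 := one_le_w hδ x
  have h2 := norm_le_w hδ x
  have p1 : 0 ≤ c₃ / R := by positivity
  have p2 : 0 ≤ c₁ / R := by positivity
  rcases le_total R ‖x‖ with hx | hx
  · have hx0 : 0 < ‖x‖ := by linarith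
    have e1 : ‖fderiv ℝ V x‖ = ‖gradient V x‖ := by simp [gradient]
    have e2 : ‖gradient V x‖ ≤ ‖gradient V x - ⟪gradient V x, ‖x‖⁻¹ • x⟫ • (‖x‖⁻¹ • x)‖ + 
        ‖⟪gradient V x, ‖x‖⁻¹ • x⟫ • (‖x‖⁻¹ • x)‖ := by
      simpa using norm_add_le (gradient V x - ⟪gradient V x, ‖x‖⁻¹ • x⟫ • (‖x‖⁻¹ • x)) (⟪gradient V x, ‖x‖⁻¹ • x⟫ • (‖x‖⁻¹ • x))
    have e3 : ‖gradient V x - ⟪gradient V x, ‖x‖⁻¹ • x⟫ • (‖x‖⁻¹ • x)‖ ≤ c₃ / R := by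
      rw [le_div_iff₀ hR]
      refine le_trans ?_ (hang x (norm_pos_iff.1 hx0))
      rw [mul_comm]; gcongr
    have e4 : ‖⟪gradient V x, ‖x‖⁻¹ • x⟫ • (‖x‖⁻¹ • x)‖ = ‖x‖⁻¹ * |fderiv ℝ V x x| := by
      rw [norm_smul, norm_smul, norm_inv, norm_norm, inv_mul_cancel₀ hx0.ne', mul_one,
        inner_smul_right, norm_mul, norm_inv, norm_norm]
      simp [gradient]
    have e5 : |fderiv ℝ V x x| ≤ c₁ * ‖x‖ ^ δ := by
      have := hrad x hx
      have : 0 ≤ ‖x‖ ^ δ := by positivity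
      rw [abs_le]; constructor <;> nlinarith
    have e6 : ‖x‖⁻¹ * |fderiv ℝ V x x| ≤ R⁻¹ * (c₁ * (1 + ‖x‖) ^ δ) := by
      gcongr
      exact e5.trans (by gcongr)
    have e7 : R⁻¹ * (c₁ * (1 + ‖x‖) ^ δ) = c₁ / R * (1 + ‖x‖) ^ δ := by ring
    rw [e1]
    nlinarith [mul_le_mul_of_nonneg_left h1 hM0.le, mul_le_mul_of_nonneg_left h1 p1]
  · have := hM x hx
    rw [abs_norm] at this
    nlinarith [mul_le_mul_of_nonneg_left h1 hM0.le, mul_le_mul_of_nonneg_left h1 p1, mul_le_mul_of_nonneg_left h1 p2]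

lemma vb_lyap (d : ℕ) (V : E → ℝ) (hV : ContDiff ℝ 1 V) (δ c₁ c₂ R : ℝ) (hδ : 0 < δ) (hR : 0 < R)
    (hc₂ : 0 < c₂)
    (hrad : ∀ x : E, R ≤ ‖x‖ →
      -c₁ * ‖x‖ ^ δ ≤ fderiv ℝ V x x ∧ fderiv ℝ V x x ≤ -c₂ * ‖x‖ ^ δ) :
    ∃ l > (0:ℝ), ∃ K > (0:ℝ), ∃ ρ > (0:ℝ), ∀ x, d + fderiv ℝ V x x ≤ 
      -l * (1 + ‖x‖) ^ δ + (Metric.closedBall (0:E) ρ).indicator (fun _ => K) x := by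
  set ρ := max R ((2 * d / c₂) ^ (1 / δ)) with hρ
  have hρ0 : 0 < ρ := lt_of_lt_of_le hR (le_max_left _ _)
  set l := c₂ / 2 / (1 + 1 / R) ^ δ with hl
  have hl0 : 0 < l := by positivity
  have hcd : Continuous (fderiv ℝ V) := hV.continuous_fderiv one_ne_zero
  obtain ⟨M, hM0, hM⟩ := vb_ball (fun x => fderiv ℝ V x x) (by fun_prop) ρ
  refine ⟨l, hl0, d + M + l * (1 + ρ) ^ δ, by positivity, ρ, hρ0, fun x => ?_⟩
  by_cases hx : ‖x‖ ≤ ρ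
  · rw [indicator_of_mem (by simpa using hx)]
    have := (abs_le.1 (hM x hx)).2
    have : l * (1 + ‖x‖) ^ δ ≤ l * (1 + ρ) ^ δ := by gcongr
    linarith
  · rw [indicator_of_notMem (by simpa using hx)]
    push Not at hx
    have hxR : R ≤ ‖x‖ := (le_max_left _ _).trans hx.le
    have h1 := (hrad x hxR).2
    have h2 := w_le_norm hδ hR x hxR
    have h3 : (2 * d / c₂ : ℝ) ≤ ‖x‖ ^ δ := by
      have : ((2 * d / c₂ : ℝ) ^ (1 / δ)) ^ δ = 2 * d / c₂ := by
        rw [← Real.rpow_mul (by positivity)]; simp [hδ.ne']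
      rw [← this]
      have := (le_max_right R ((2 * d / c₂ : ℝ) ^ (1 / δ))).trans hx.le
      gcongr
    rw [div_le_iff₀ hc₂] at h3
    have h4 : l * (1 + ‖x‖) ^ δ ≤ c₂ / 2 * ‖x‖ ^ δ := by
      calc _ ≤ l * ((1 + 1 / R) ^ δ * ‖x‖ ^ δ) := by gcongr
        _ = _ := by rw [hl]; field_simp
    linarith
end


lemma exp_decay (δ c N : ℝ) (hδ : 0 < δ) (hc : 0 < c) : ∃ C > (0:ℝ), ∀ r : ℝ, 0 ≤ r →
    (1 + r) ^ N * Real.exp (-(c * r ^ δ)) ≤ C := by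
  obtain ⟨n, hn⟩ := exists_nat_ge (N / δ)
  have hn' : N ≤ δ * n := by rw [div_le_iff₀ hδ] at hn; linarith
  refine ⟨2 ^ (δ * n) * (1 + n.factorial / c ^ n), by positivity, fun r hr => ?_⟩
  have h1 : (1 + r) ^ N ≤ (1 + r) ^ (δ * n) := Real.rpow_le_rpow_of_exponent_le (by linarith) hn'
  have h2 : (1 + r) ^ (δ * n) ≤ 2 ^ (δ * n) * (1 + (r ^ δ) ^ n) := by
    have e : (r ^ δ) ^ n = r ^ (δ * n) := by rw [Real.rpow_mul hr, Real.rpow_natCast]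
    rw [e]
    rcases le_total r 1 with h | h
    · calc (1 + r) ^ (δ * n) ≤ 2 ^ (δ * n) := by gcongr; linarith
        _ ≤ _ := by
          have : 0 ≤ (2:ℝ) ^ (δ * n) * r ^ (δ * n) := by positivity
          linarith
    · calc (1 + r) ^ (δ * n) ≤ (2 * r) ^ (δ * n) := by gcongr; linarith
        _ = 2 ^ (δ * n) * r ^ (δ * n) := by rw [Real.mul_rpow (by norm_num) hr]
        _ ≤ _ := by gcongr; linarith
  have hy : 0 ≤ c * r ^ δ := by positivity
  have h3 : (r ^ δ) ^ n ≤ n.factorial / c ^ n * Real.exp (c * r ^ δ) := by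
    have := Real.pow_div_factorial_le_exp _ hy n
    rw [mul_pow] at this
    rw [div_le_iff₀ (by positivity)] at this
    rw [div_mul_eq_mul_div, le_div_iff₀ (by positivity)]
    linarith
  have h4 : 1 ≤ Real.exp (c * r ^ δ) := Real.one_le_exp hy
  rw [Real.exp_neg, ← div_eq_mul_inv, div_le_iff₀ (Real.exp_pos _)]
  calc (1 + r) ^ N ≤ 2 ^ (δ * n) * (1 + (r ^ δ) ^ n) := h1.trans h2
    _ ≤ 2 ^ (δ * n) * (Real.exp (c * r ^ δ) + n.factorial / c ^ n * Real.exp (c * r ^ δ)) := by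
      gcongr
    _ = _ := by ring

lemma int_weight {E : Type*} [NormedAddCommGroup E] [NormedSpace ℝ E] [MeasurableSpace E]
    [BorelSpace E] [FiniteDimensional ℝ E] (μ : Measure E) [μ.IsAddHaarMeasure]
    (V : E → ℝ) (hV : Continuous V) (δ c K : ℝ) (hδ : 0 < δ) (hc : 0 < c)
    (hVb : ∀ x, V x ≤ K - c * ‖x‖ ^ δ) (N : ℝ) :
    Integrable (fun x => (1 + ‖x‖) ^ N * Real.exp (V x)) μ := by
  obtain ⟨C, hC0, hC⟩ := exp_decay δ c (N + (Module.finrank ℝ E + 1)) hδ hc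
  have hpos : ∀ x : E, 0 < 1 + ‖x‖ := fun x => by positivity
  refine Integrable.mono' (g := fun x => Real.exp K * C * (1 + ‖x‖) ^ (-((Module.finrank ℝ E : ℝ) + 1)))
    ((integrable_one_add_norm (by linarith)).const_mul _) ?_ ?_
  · apply Continuous.aestronglyMeasurable
    refine Continuous.mul ?_ (by fun_prop)
    exact Continuous.rpow_const (by fun_prop) (fun x => Or.inl (hpos x).ne')
  · refine Filter.Eventually.of_forall fun x => ?_
    rw [Real.norm_of_nonneg (by have := hpos x; positivity)]
    have h1 := hC ‖x‖ (norm_nonneg x)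
    rw [Real.rpow_add (hpos x)] at h1
    rw [Real.rpow_neg (hpos x).le, ← div_eq_mul_inv, le_div_iff₀ (by have := hpos x; positivity)]
    calc _ ≤ (1 + ‖x‖) ^ N * Real.exp (K - c * ‖x‖ ^ δ) * (1 + ‖x‖) ^ ((Module.finrank ℝ E : ℝ) + 1) := by
          have := hpos x
          gcongr; exact hVb x
      _ = Real.exp K * ((1 + ‖x‖) ^ N * (1 + ‖x‖) ^ ((Module.finrank ℝ E : ℝ) + 1) * Real.exp (-(c * ‖x‖ ^ δ))) := by
          rw [sub_eq_add_neg, Real.exp_add]; ring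
      _ ≤ Real.exp K * C := by gcongr

/-- dominated integrability -/
lemma int_dom {E : Type*} [NormedAddCommGroup E] [NormedSpace ℝ E] [MeasurableSpace E]
    [BorelSpace E] [FiniteDimensional ℝ E] (μ : Measure E) [μ.IsAddHaarMeasure]
    (V : E → ℝ) (N A : ℝ)
    (hI : Integrable (fun x => (1 + ‖x‖) ^ N * Real.exp (V x)) μ)
    (g : E → ℝ) (hg : AEStronglyMeasurable g μ) (hb : ∀ x, |g x| ≤ A * (1 + ‖x‖) ^ N * Real.exp (V x)) :
    Integrable g μ := by
  refine (hI.const_mul A).mono' hg (Filter.Eventually.of_forall fun x => ?_)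
  rw [← mul_assoc]; exact hb x

lemma fderiv_g {E : Type*} [NormedAddCommGroup E] [NormedSpace ℝ E] (V h : E → ℝ)
    (hV : ContDiff ℝ 1 V) (hh : ContDiff ℝ 1 h) (x v : E) :
    fderiv ℝ (fun x => h x ^ 2 * Real.exp (V x)) x v =
      Real.exp (V x) * (2 * h x * fderiv ℝ h x v + h x ^ 2 * fderiv ℝ V x v) := by
  have h1 := (hV.differentiable one_ne_zero x).hasFDerivAt
  have h2 := (hh.differentiable one_ne_zero x).hasFDerivAt
  have h3 := (h2.pow 2).mul h1.exp
  have h4 : HasFDerivAt (fun x => h x ^ 2 * Real.exp (V x)) _ x := h3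
  rw [h4.fderiv]
  simp
  ring

lemma ibp_x (d : ℕ) (g : EuclideanSpace ℝ (Fin d) → ℝ) (hg : ContDiff ℝ 1 g)
    (h1 : Integrable g) (h2 : Integrable (fun x => ‖x‖ * |g x|))
    (h3 : Integrable (fun x => ‖x‖ * ‖fderiv ℝ g x‖)) :
    ∫ x, (d * g x + fderiv ℝ g x x) = 0 := by
  have hgc := hg.continuous
  have hcd : Continuous (fderiv ℝ g) := hg.continuous_fderiv one_ne_zero
  let e : Fin d → EuclideanSpace ℝ (Fin d) := fun i => EuclideanSpace.single i 1
  have hen : ∀ i, ‖e i‖ = 1 := fun i => by simp [e]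
  have hxi : ∀ (i : Fin d) (x : EuclideanSpace ℝ (Fin d)), |x i| ≤ ‖x‖ := fun i x => by
    simpa using PiLp.norm_apply_le x i
  have hfx : ∀ (i : Fin d) (x v : EuclideanSpace ℝ (Fin d)),
      fderiv ℝ (fun x : EuclideanSpace ℝ (Fin d) => x i) x v = v i := by
    intro i x v
    have : HasFDerivAt (fun x : EuclideanSpace ℝ (Fin d) => x i) (EuclideanSpace.proj i : EuclideanSpace ℝ (Fin d) →L[ℝ] ℝ) x :=
      (EuclideanSpace.proj i : EuclideanSpace ℝ (Fin d) →L[ℝ] ℝ).hasFDerivAt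
    rw [this.fderiv]; simp
  have hdi : ∀ i : Fin d, Differentiable ℝ (fun x : EuclideanSpace ℝ (Fin d) => x i) := fun i => by fun_prop
  have i2 : ∀ i, Integrable (fun x : EuclideanSpace ℝ (Fin d) => x i * fderiv ℝ g x (e i)) := by
    intro i
    refine h3.mono' (by apply Continuous.aestronglyMeasurable; fun_prop) (Filter.Eventually.of_forall fun x => ?_)
    rw [norm_mul]
    have := (fderiv ℝ g x).le_opNorm (e i)
    rw [hen, mul_one] at this
    have h' := hxi i x
    rw [← Real.norm_eq_abs] at h'
    gcongr
  have i3 : ∀ i, Integrable (fun x : EuclideanSpace ℝ (Fin d) => x i * g x) := by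
    intro i
    refine h2.mono' (by apply Continuous.aestronglyMeasurable; fun_prop) (Filter.Eventually.of_forall fun x => ?_)
    rw [norm_mul]
    have h' := hxi i x
    rw [← Real.norm_eq_abs] at h'
    rw [← Real.norm_eq_abs]
    gcongr
  have hi : ∀ i : Fin d, ∫ x : EuclideanSpace ℝ (Fin d), x i * fderiv ℝ g x (e i) = - ∫ x, g x := by
    intro i
    have e1 : (fun x : EuclideanSpace ℝ (Fin d) => (fderiv ℝ (fun x : EuclideanSpace ℝ (Fin d) => x i) x) (e i) * g x) = g := by
      ext x; rw [hfx]; simp [e]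
    have := integral_mul_fderiv_eq_neg_fderiv_mul_of_integrable (μ := volume)
      (f := fun x : EuclideanSpace ℝ (Fin d) => x i) (g := g) (v := e i) (by rw [e1]; exact h1) (i2 i) (i3 i)
      (fun x _ => hdi i x) (fun x _ => hg.differentiable one_ne_zero x)
    rw [this, e1]
  have hsum : ∀ x : EuclideanSpace ℝ (Fin d), fderiv ℝ g x x = ∑ i, x i * fderiv ℝ g x (e i) := by
    intro x
    have : x = ∑ i, x i • e i := by
      have := (EuclideanSpace.basisFun (Fin d) ℝ).sum_repr x
      simpa [e] using this.symm
    conv_lhs => rw [this]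
    rw [map_sum]
    simp [← this]
  simp_rw [hsum]
  rw [integral_add (h1.const_mul _) (integrable_finsetSum _ fun i _ => i2 i), integral_const_mul,
    integral_finsetSum _ (fun i _ => i2 i)]
  simp [hi]

lemma lyap (d : ℕ) (V : EuclideanSpace ℝ (Fin d) → ℝ) (hV : ContDiff ℝ 1 V) (δ K l Kb ρ : ℝ)
    (hδ : 0 < δ) (hl : 0 < l) (hKb : 0 < Kb) (hK : 0 < K)
    (hI : ∀ N : ℝ, Integrable (fun x => (1 + ‖x‖) ^ N * Real.exp (V x)))
    (hVg : ∀ x, ‖fderiv ℝ V x‖ ≤ K * (1 + ‖x‖) ^ δ)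
    (hVl : ∀ x, d + fderiv ℝ V x x ≤ 
      -l * (1 + ‖x‖) ^ δ + (Metric.closedBall (0:EuclideanSpace ℝ (Fin d)) ρ).indicator (fun _ => Kb) x)
    (h : EuclideanSpace ℝ (Fin d) → ℝ) (hh : ContDiff ℝ 1 h) (A : ℝ) (hA : ∀ x, |h x| ≤ A)
    (hA' : ∀ x, ‖fderiv ℝ h x‖ ≤ A) :
    Integrable (fun x => (1 + ‖x‖) ^ δ * h x ^ 2 * Real.exp (V x)) ∧
    Integrable (fun x => (1 + ‖x‖) ^ (2 - δ) * ‖fderiv ℝ h x‖ ^ 2 * Real.exp (V x)) ∧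
    l / 2 * ∫ x, (1 + ‖x‖) ^ δ * h x ^ 2 * Real.exp (V x) ≤ 
      2 / l * (∫ x, (1 + ‖x‖) ^ (2 - δ) * ‖fderiv ℝ h x‖ ^ 2 * Real.exp (V x)) + 
      Kb * ∫ x in Metric.closedBall 0 ρ, h x ^ 2 * Real.exp (V x) := by
  have hA0 : 0 ≤ A := (abs_nonneg _).trans (hA 0)
  have hVc := hV.continuous
  have hhc := hh.continuous
  have hcd : Continuous (fderiv ℝ h) := hh.continuous_fderiv one_ne_zero
  have hpos : ∀ x : EuclideanSpace ℝ (Fin d), 0 < 1 + ‖x‖ := fun x => by positivity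
  have hwc : ∀ N : ℝ, Continuous (fun x : EuclideanSpace ℝ (Fin d) => (1 + ‖x‖) ^ N) := fun N =>
    Continuous.rpow_const (by fun_prop) (fun x => Or.inl (hpos x).ne')
  have hA2 : ∀ x, h x ^ 2 ≤ A ^ 2 := fun x => by rw [← sq_abs]; have := hA x; gcongr
  have hA2' : ∀ x, ‖fderiv ℝ h x‖ ^ 2 ≤ A ^ 2 := fun x => by have := hA' x; gcongr
  have J1 : Integrable (fun x => (1 + ‖x‖) ^ δ * h x ^ 2 * Real.exp (V x)) := by
    have := hwc δ
    refine int_dom _ V δ (A ^ 2) (hI δ) _ (by apply Continuous.aestronglyMeasurable; fun_prop) fun x => ?_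
    have := hpos x
    rw [abs_of_nonneg (by positivity), mul_comm (A ^ 2)]
    gcongr _ * ?_ * _
    exact hA2 x
  have J2 : Integrable (fun x => (1 + ‖x‖) ^ (2 - δ) * ‖fderiv ℝ h x‖ ^ 2 * Real.exp (V x)) := by
    have := hwc (2 - δ)
    refine int_dom _ V (2 - δ) (A ^ 2) (hI _) _ (by apply Continuous.aestronglyMeasurable; fun_prop) fun x => ?_
    have := hpos x
    rw [abs_of_nonneg (by positivity), mul_comm (A ^ 2)]
    gcongr _ * ?_ * _
    exact hA2' x
  refine ⟨J1, J2, ?_⟩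
  set g : EuclideanSpace ℝ (Fin d) → ℝ := fun x => h x ^ 2 * Real.exp (V x) with hg
  have hgC : ContDiff ℝ 1 g := (hh.pow 2).mul hV.exp
  have hgc := hgC.continuous
  have hgd : Continuous (fderiv ℝ g) := hgC.continuous_fderiv one_ne_zero
  have G1 : Integrable g := by
    refine int_dom _ V 0 (A ^ 2) (hI _) _ (by apply Continuous.aestronglyMeasurable; fun_prop) fun x => ?_
    rw [abs_of_nonneg (by positivity)]
    simp only [Real.rpow_zero, mul_one]
    exact mul_le_mul_of_nonneg_right (hA2 x) (Real.exp_pos _).le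
  have G2 : Integrable (fun x => ‖x‖ * |g x|) := by
    refine int_dom _ V 1 (A ^ 2) (hI _) _ (by apply Continuous.aestronglyMeasurable; fun_prop) fun x => ?_
    rw [abs_of_nonneg (by positivity), abs_of_nonneg (by positivity), ← mul_assoc, Real.rpow_one, mul_comm (A ^ 2)]
    refine mul_le_mul_of_nonneg_right ?_ (Real.exp_pos _).le
    exact mul_le_mul (by linarith) (hA2 x) (sq_nonneg _) (hpos x).le
  have G3 : Integrable (fun x => ‖x‖ * ‖fderiv ℝ g x‖) := by
    refine int_dom _ V (1 + δ) (2 * A ^ 2 + A ^ 2 * K) (hI _) _ (by apply Continuous.aestronglyMeasurable; fun_prop) fun x => ?_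
    rw [abs_of_nonneg (by positivity)]
    have h1 : 1 ≤ (1 + ‖x‖) ^ δ := Real.one_le_rpow (by linarith [norm_nonneg x]) hδ.le
    have : ‖fderiv ℝ g x‖ ≤ Real.exp (V x) * ((2 * A ^ 2 + A ^ 2 * K) * (1 + ‖x‖) ^ δ) := by
      apply ContinuousLinearMap.opNorm_le_bound _ (by have := hpos x; positivity)
      intro v
      rw [fderiv_g V h hV hh, norm_mul, Real.norm_of_nonneg (Real.exp_pos _).le, mul_assoc (Real.exp (V x))]
      refine mul_le_mul_of_nonneg_left ?_ (Real.exp_pos _).le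
      have a1 : ‖2 * h x * fderiv ℝ h x v‖ ≤ 2 * A * (A * ‖v‖) := by
        rw [norm_mul, norm_mul]
        have b1 := (fderiv ℝ h x).le_of_opNorm_le (hA' x) v
        have b2 := hA x
        rw [← Real.norm_eq_abs] at b2
        have b3 : ‖(2:ℝ)‖ = 2 := by simp
        rw [b3]
        gcongr
      have a2 : ‖h x ^ 2 * fderiv ℝ V x v‖ ≤ A ^ 2 * (K * (1 + ‖x‖) ^ δ * ‖v‖) := by
        rw [norm_mul, Real.norm_of_nonneg (sq_nonneg _)]
        have b1 := (fderiv ℝ V x).le_of_opNorm_le (hVg x) v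
        have b2 := hA2 x
        gcongr
      calc _ ≤ 2 * A * (A * ‖v‖) * 1 + A ^ 2 * (K * (1 + ‖x‖) ^ δ * ‖v‖) := by
            rw [mul_one]
            exact (norm_add_le _ _).trans (add_le_add a1 a2)
        _ ≤ 2 * A * (A * ‖v‖) * (1 + ‖x‖) ^ δ + A ^ 2 * (K * (1 + ‖x‖) ^ δ * ‖v‖) := by gcongr
        _ = _ := by ring
    calc _ ≤ (1 + ‖x‖) * (Real.exp (V x) * ((2 * A ^ 2 + A ^ 2 * K) * (1 + ‖x‖) ^ δ)) := by
          gcongr; linarith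
      _ = _ := by rw [Real.rpow_add (hpos x), Real.rpow_one]; ring
  have hibp := ibp_x d g hgC G1 G2 G3
  have J3 : Integrable ((Metric.closedBall (0:EuclideanSpace ℝ (Fin d)) ρ).indicator g) :=
    G1.indicator Metric.isClosed_closedBall.measurableSet
  have hpt : ∀ x, d * g x + fderiv ℝ g x x ≤ 
      2 / l * ((1 + ‖x‖) ^ (2 - δ) * ‖fderiv ℝ h x‖ ^ 2 * Real.exp (V x)) + 
      Kb * (Metric.closedBall (0:EuclideanSpace ℝ (Fin d)) ρ).indicator g x 
       - l / 2 * ((1 + ‖x‖) ^ δ * h x ^ 2 * Real.exp (V x)) := by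
    intro x
    rw [fderiv_g V h hV hh]
    have e1 : Kb * (Metric.closedBall (0:EuclideanSpace ℝ (Fin d)) ρ).indicator g x = 
       (Metric.closedBall (0:EuclideanSpace ℝ (Fin d)) ρ).indicator (fun _ => Kb) x * h x ^ 2 * Real.exp (V x) := by
      by_cases hx : x ∈ Metric.closedBall (0:EuclideanSpace ℝ (Fin d)) ρ
      · rw [indicator_of_mem hx, indicator_of_mem hx, hg]; ring
      · rw [indicator_of_notMem hx, indicator_of_notMem hx]; ring
    rw [e1]
    set Ind := (Metric.closedBall (0:EuclideanSpace ℝ (Fin d)) ρ).indicator (fun _ => Kb) x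
    have b1 : fderiv ℝ h x x ≤ ‖fderiv ℝ h x‖ * (1 + ‖x‖) := by
      refine (le_abs_self _).trans (((fderiv ℝ h x).le_opNorm x).trans ?_)
      gcongr; linarith
    have b1' : |fderiv ℝ h x x| ≤ ‖fderiv ℝ h x‖ * (1 + ‖x‖) := by
      refine (((fderiv ℝ h x).le_opNorm x).trans ?_)
      gcongr; linarith
    have b2 : 2 * h x * fderiv ℝ h x x ≤ l / 2 * ((1 + ‖x‖) ^ δ * h x ^ 2) + 
        2 / l * ((1 + ‖x‖) ^ (2 - δ) * ‖fderiv ℝ h x‖ ^ 2) := by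
      set W := (1 + ‖x‖) ^ δ with hW
      have hW0 : 0 < W := by have := hpos x; positivity
      have e2 : (1 + ‖x‖) ^ (2 - δ) = (1 + ‖x‖) ^ 2 / W := by
        rw [Real.rpow_sub (hpos x)]; norm_cast
      rw [e2]
      have c1 : (fderiv ℝ h x x) ^ 2 ≤ (1 + ‖x‖) ^ 2 * ‖fderiv ℝ h x‖ ^ 2 := by
        rw [← sq_abs, ← mul_pow, mul_comm (1 + ‖x‖)]; gcongr
      have c2 : 2 * h x * fderiv ℝ h x x ≤ l / 2 * (W * h x ^ 2) + 2 / l * ((fderiv ℝ h x x) ^ 2 / W) := by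
        have : 0 ≤ 2 / (l * W) * (l * W / 2 * h x - fderiv ℝ h x x) ^ 2 := by positivity
        have e3 : 2 / (l * W) * (l * W / 2 * h x - fderiv ℝ h x x) ^ 2 = 
          l / 2 * (W * h x ^ 2) + 2 / l * ((fderiv ℝ h x x) ^ 2 / W) - 2 * h x * fderiv ℝ h x x := by
          field_simp; ring
        linarith
      refine c2.trans ?_
      gcongr
      rw [div_mul_eq_mul_div]
      gcongr
    have b3 : (d + fderiv ℝ V x x) * h x ^ 2 ≤ (-l * (1 + ‖x‖) ^ δ + Ind) * h x ^ 2 := by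
      exact mul_le_mul_of_nonneg_right (hVl x) (sq_nonneg _)
    have b4 : Real.exp (V x) * (2 * h x * fderiv ℝ h x x + (d + fderiv ℝ V x x) * h x ^ 2) ≤ 
      Real.exp (V x) * (l / 2 * ((1 + ‖x‖) ^ δ * h x ^ 2) + 
        2 / l * ((1 + ‖x‖) ^ (2 - δ) * ‖fderiv ℝ h x‖ ^ 2) + (-l * (1 + ‖x‖) ^ δ + Ind) * h x ^ 2) := by
      gcongr
    simp only [hg]
    linarith
  have hint : ∫ x, (d * g x + fderiv ℝ g x x) ≤ ∫ x, (2 / l * ((1 + ‖x‖) ^ (2 - δ) * ‖fderiv ℝ h x‖ ^ 2 * Real.exp (V x)) + 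
      Kb * (Metric.closedBall (0:EuclideanSpace ℝ (Fin d)) ρ).indicator g x 
       - l / 2 * ((1 + ‖x‖) ^ δ * h x ^ 2 * Real.exp (V x))) := by
    apply integral_mono
    · refine (G1.const_mul _).add (G3.mono' (by apply Continuous.aestronglyMeasurable; fun_prop) (Filter.Eventually.of_forall fun x => ?_))
      rw [mul_comm]
      exact (fderiv ℝ g x).le_opNorm x
    · exact ((J2.const_mul _).add (J3.const_mul _)).sub (J1.const_mul _)
    · exact hpt
  have J23 : Integrable (fun x => 2 / l * ((1 + ‖x‖) ^ (2 - δ) * ‖fderiv ℝ h x‖ ^ 2 * Real.exp (V x)) + 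
      Kb * (Metric.closedBall (0:EuclideanSpace ℝ (Fin d)) ρ).indicator g x) :=
    (J2.const_mul _).add (J3.const_mul _)
  rw [hibp, integral_sub J23 (J1.const_mul _), integral_add (J2.const_mul _) (J3.const_mul _), integral_const_mul, integral_const_mul,
    integral_const_mul, integral_indicator Metric.isClosed_closedBall.measurableSet] at hint
  linarith

lemma sob_ent (d : ℕ) (hd : 2 ≤ d) : ∃ S > (0:ℝ), ∀ u : EuclideanSpace ℝ (Fin d) → ℝ,
    ContDiff ℝ 1 u → HasCompactSupport u → (∀ x, 0 ≤ u x) → ∫ x, u x = 1 →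
    ∫ x, u x * Real.log (u x) ≤ S * ∫ x, ‖fderiv ℝ u x‖ := by
  have hd1 : (1:ℝ) < d := by exact_mod_cast hd
  have hd1' : (1:NNReal) < d := by exact_mod_cast hd
  set p : NNReal := NNReal.conjExponent d with hp
  have hpc : NNReal.HolderConjugate (d : NNReal) p := NNReal.HolderConjugate.conjExponent hd1'
  have hp1 : 1 < (p : ℝ) := by exact_mod_cast hpc.symm.lt
  set q : ℝ := (p : ℝ) with hq
  set N : ℝ := (eLpNormLESNormFDerivOneConst (volume : Measure (EuclideanSpace ℝ (Fin d))) q : ℝ) with hN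
  have hN0 : 0 ≤ N := by rw [hN]; positivity
  refine ⟨q / (q - 1) * (N + 1), mul_pos (div_pos (by linarith) (by linarith)) (by linarith), fun u hu hus hu0 hu1 => ?_⟩
  have huc := hu.continuous
  have hcd : Continuous (fderiv ℝ u) := hu.continuous_fderiv one_ne_zero
  have hq0 : 0 < q := by linarith
  -- integrability
  have hpc' : Continuous (fun x => u x ^ q) := Continuous.rpow_const huc (fun x => Or.inr hq0.le)
  have Iu : Integrable u := huc.integrable_of_hasCompactSupport hus
  have Iup : Integrable (fun x => u x ^ q) := by
    apply hpc'.integrable_of_hasCompactSupport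
    exact hus.comp_left (g := fun t : ℝ => t ^ q) (Real.zero_rpow hq0.ne')
  have Iul : Integrable (fun x => u x * Real.log (u x)) := by
    apply (Real.continuous_mul_log.comp huc).integrable_of_hasCompactSupport
    exact hus.comp_left (g := fun t : ℝ => t * Real.log t) (by simp)
  have Id : Integrable (fun x => ‖fderiv ℝ u x‖) := by
    apply hcd.norm.integrable_of_hasCompactSupport
    exact (hus.fderiv (𝕜 := ℝ)).norm
  set T := ∫ x, u x ^ q with hT
  have hTpos : 0 < T := by
    rw [hT, integral_pos_iff_support_of_nonneg (fun x => Real.rpow_nonneg (hu0 x) _) Iup]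
    have h1 : 0 < ∫ x, u x := by rw [hu1]; norm_num
    rw [integral_pos_iff_support_of_nonneg hu0 Iu] at h1
    convert h1 using 2
    ext x
    simp [Real.rpow_eq_zero (hu0 x) hq0.ne']
  set A := T ^ (1 / q) with hA
  have hA0 : 0 < A := by positivity
  have hAT : T = A ^ q := by rw [hA, ← Real.rpow_mul hTpos.le]; simp [hq0.ne']
  have hsob : A ≤ N * ∫ x, ‖fderiv ℝ u x‖ := by
    have h1 := eLpNorm_le_eLpNorm_fderiv_one (volume : Measure (EuclideanSpace ℝ (Fin d))) hu hus (p := p) (by simpa using hpc)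
    have h2 : eLpNorm u p volume = ENNReal.ofReal A := by
      have hm : MemLp u p := huc.memLp_of_hasCompactSupport hus
      rw [hm.eLpNorm_eq_integral_rpow_norm (by simpa using hpc.symm.pos.ne') (by simp)]
      rw [hA, hT]
      congr 1
      simp only [ENNReal.coe_toReal, one_div]
      congr 2
      ext x
      rw [Real.norm_of_nonneg (hu0 x)]
    have h3 : eLpNorm (fderiv ℝ u) 1 volume = ENNReal.ofReal (∫ x, ‖fderiv ℝ u x‖) := by
      rw [eLpNorm_one_eq_lintegral_enorm, ofReal_integral_eq_lintegral_ofReal Id (Filter.Eventually.of_forall fun x => norm_nonneg _)]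
      simp
    rw [h2, h3, ← ENNReal.ofReal_coe_nnreal, ← ENNReal.ofReal_mul (by positivity), ENNReal.ofReal_le_ofReal_iff (mul_nonneg (by positivity) (by positivity))] at h1
    exact h1
  have hpt : ∀ x, u x * Real.log (u x) ≤ Real.log A * u x + A ^ (1 - q) / (q - 1) * u x ^ q := by
    intro x
    rcases (hu0 x).eq_or_lt with h | h
    · rw [← h]; simp [Real.zero_rpow hq0.ne']
    · have h1 := Real.log_le_rpow_div (div_pos h hA0).le (sub_pos.2 hp1)
      rw [Real.log_div h.ne' hA0.ne', Real.div_rpow h.le hA0.le] at h1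
      have h2 : u x ^ q = u x * u x ^ (q - 1) := by rw [Real.rpow_sub_one h.ne']; field_simp
      have h3 : A ^ (1 - q) = (A ^ (q - 1))⁻¹ := by rw [← Real.rpow_neg hA0.le]; ring_nf
      rw [h2, h3]
      have h4 := mul_le_mul_of_nonneg_left h1 h.le
      have h5 : u x * (u x ^ (q - 1) / A ^ (q - 1) / (q - 1)) = (A ^ (q - 1))⁻¹ / (q - 1) * (u x * u x ^ (q - 1)) := by
        ring
      linarith
  have hint : ∫ x, u x * Real.log (u x) ≤ ∫ x, (Real.log A * u x + A ^ (1 - q) / (q - 1) * u x ^ q) :=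
    integral_mono Iul ((Iu.const_mul _).add (Iup.const_mul _)) hpt
  rw [integral_add (Iu.const_mul _) (Iup.const_mul _), integral_const_mul, integral_const_mul, hu1, ← hT, hAT] at hint
  have e1 : A ^ (1 - q) / (q - 1) * A ^ q = A / (q - 1) := by
    rw [div_mul_eq_mul_div, ← Real.rpow_add hA0]; simp
  rw [e1] at hint
  have h6 : Real.log A ≤ A := (Real.log_le_sub_one_of_pos hA0).trans (by linarith)
  have hq1 : 0 < q - 1 := by linarith
  have h7 : ∫ x, u x * Real.log (u x) ≤ q / (q - 1) * A := by
    have : q / (q - 1) * A = A + A / (q - 1) := by field_simp; ring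
    linarith
  have h8 : 0 ≤ ∫ x, ‖fderiv ℝ u x‖ := integral_nonneg fun x => norm_nonneg _
  have h9 : 0 ≤ q / (q - 1) := by positivity
  calc _ ≤ _ := h7
    _ ≤ q / (q - 1) * (N * ∫ x, ‖fderiv ℝ u x‖) := by gcongr
    _ ≤ _ := by
      rw [mul_assoc]
      gcongr
      linarith

lemma pt_ineq (s a : ℝ) (ha1 : 9 / 16 ≤ a ^ 2) (ha2 : a ^ 2 ≤ 25 / 16) :
    s ^ 2 * Real.log (s ^ 2) - s ^ 2 * Real.log (a ^ 2) - s ^ 2 + a ^ 2 ≤ 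
     49 * ((s - a) ^ 2 + (s ^ 2 * (s - a) / (1 + s ^ 2)) ^ 2 * Real.log (1 + (s ^ 2 * (s - a) / (1 + s ^ 2)) ^ 2)) := by
  set F := s ^ 2 * (s - a) / (1 + s ^ 2) with hF
  have hL : 0 ≤ F ^ 2 * Real.log (1 + F ^ 2) :=
    mul_nonneg (sq_nonneg _) (Real.log_nonneg (by nlinarith [sq_nonneg F]))
  have ha0 : 0 < a ^ 2 := by linarith
  have haa : |a| ≤ 5 / 4 := by
    apply abs_le_of_sq_le_sq _ (by norm_num); linarith
  have haa' := abs_le.1 haa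
  rcases le_total (|s|) 4 with hs | hs
  · rcases eq_or_ne s 0 with h0 | h0
    · have : s ^ 2 * Real.log (s ^ 2) - s ^ 2 * Real.log (a ^ 2) - s ^ 2 + a ^ 2 = (s - a) ^ 2 := by
        rw [h0]; simp
      rw [this]
      nlinarith [sq_nonneg (s - a)]
    · have hs0 : 0 < s ^ 2 := by positivity
      have h1 := Real.log_le_sub_one_of_pos (div_pos hs0 ha0)
      rw [Real.log_div hs0.ne' ha0.ne'] at h1
      have h2 := mul_le_mul_of_nonneg_left h1 hs0.le
      have h3 : s ^ 2 * (s ^ 2 / a ^ 2 - 1) - s ^ 2 + a ^ 2 = (s - a) ^ 2 * ((s + a) ^ 2 / a ^ 2) := by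
        have : a ≠ 0 := by rintro rfl; norm_num at ha0
        field_simp; ring
      have h4 : (s + a) ^ 2 / a ^ 2 ≤ 49 := by
        rw [div_le_iff₀ ha0]
        have := abs_le.1 hs
        have : (s + a) ^ 2 ≤ (21 / 4) ^ 2 := by
          apply sq_le_sq' <;> linarith
        linarith
      have h5 := mul_le_mul_of_nonneg_left h4 (sq_nonneg (s - a))
      linarith
  · have hs2 : 16 ≤ s ^ 2 := by rw [← sq_abs]; nlinarith
    have h1 : (1/2) * |s| ≤ |F| := by
      have e : |F| = s ^ 2 / (1 + s ^ 2) * |s - a| := by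
        rw [hF, abs_div, abs_mul, abs_of_nonneg (sq_nonneg s), abs_of_nonneg (by positivity : 0 ≤ 1 + s ^ 2)]; ring
      rw [e]
      have e2 : 16 / 17 ≤ s ^ 2 / (1 + s ^ 2) := by
        rw [div_le_div_iff₀ (by norm_num) (by positivity)]; linarith
      have e3 : |s| - 5 / 4 ≤ |s - a| := by
        have := abs_sub_abs_le_abs_sub s a; linarith
      calc _ ≤ 16 / 17 * (|s| - 5/4) := by linarith
        _ ≤ _ := by gcongr; linarith
    have h2 : s ^ 2 ≤ 4 * F ^ 2 := by
      rw [← sq_abs s, ← sq_abs F]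
      nlinarith [abs_nonneg s, abs_nonneg F]
    have hF2 : 4 ≤ F ^ 2 := by linarith
    have hs0 : 0 < s ^ 2 := by linarith
    have l1 : Real.log (s ^ 2) ≤ Real.log 4 + Real.log (1 + F ^ 2) := by
      rw [← Real.log_mul (by norm_num) (by positivity)]
      apply Real.log_le_log hs0; linarith
    have l2 : -Real.log (a ^ 2) ≤ Real.log 4 := by
      rw [← Real.log_inv]
      apply Real.log_le_log (by positivity)
      rw [inv_le_comm₀ ha0 (by norm_num)]; linarith
    have l3 : Real.log 4 ≤ Real.log (1 + F ^ 2) := by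
      apply Real.log_le_log (by norm_num); linarith
    have l4 : 0 ≤ Real.log 4 := Real.log_nonneg (by norm_num)
    have l5 : s ^ 2 * (Real.log (s ^ 2) - Real.log (a ^ 2)) ≤ 4 * F ^ 2 * (3 * Real.log (1 + F ^ 2)) := by
      calc _ ≤ s ^ 2 * (3 * Real.log (1 + F ^ 2)) := by gcongr; linarith
        _ ≤ _ := by
          gcongr
          linarith
    nlinarith [sq_nonneg (s - a)]

/-- weighted energy -/
noncomputable def wEn {d : ℕ} (V : EuclideanSpace ℝ (Fin d) → ℝ) (δ : ℝ)
    (f : EuclideanSpace ℝ (Fin d) → ℝ) : ℝ :=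
  ∫ x, (1 + ‖x‖) ^ (2 - δ) * ‖fderiv ℝ f x‖ ^ 2 * Real.exp (V x)

lemma wEn_nonneg {d : ℕ} (V : EuclideanSpace ℝ (Fin d) → ℝ) (δ : ℝ)
    (f : EuclideanSpace ℝ (Fin d) → ℝ) : 0 ≤ wEn V δ f :=
  integral_nonneg fun x => by positivity

lemma w_cont {E : Type*} [NormedAddCommGroup E] (N : ℝ) :
    Continuous (fun x : E => (1 + ‖x‖) ^ N) :=
  Continuous.rpow_const (by fun_prop)
    (fun x => Or.inl (by have := norm_nonneg x; linarith))

lemma cs_bound {d : ℕ} (f : EuclideanSpace ℝ (Fin d) → ℝ) (hf : ContDiff ℝ 1 f)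
    (hs : HasCompactSupport f) : ∃ A : ℝ, (∀ x, |f x| ≤ A) ∧ ∀ x, ‖fderiv ℝ f x‖ ≤ A := by
  obtain ⟨A, hA⟩ := hs.exists_bound_of_continuous hf.continuous
  obtain ⟨B, hB⟩ := (hs.fderiv (𝕜 := ℝ)).exists_bound_of_continuous
    (hf.continuous_fderiv one_ne_zero)
  exact ⟨max A B, fun x => (hA x).trans (le_max_left _ _), fun x => (hB x).trans (le_max_right _ _)⟩

lemma defective (d : ℕ) (hd : 2 ≤ d) (V : EuclideanSpace ℝ (Fin d) → ℝ) (hV : ContDiff ℝ 1 V)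
    (δ K l Kb ρ : ℝ)
    (hδ : 0 < δ) (hl : 0 < l) (hKb : 0 < Kb) (hK : 0 < K)
    (hI : ∀ N : ℝ, Integrable (fun x => (1 + ‖x‖) ^ N * Real.exp (V x)))
    (hVm : ∀ x, -V x ≤ K * (1 + ‖x‖) ^ δ)
    (hVg : ∀ x, ‖fderiv ℝ V x‖ ≤ K * (1 + ‖x‖) ^ δ)
    (hVl : ∀ x, d + fderiv ℝ V x x ≤ 
      -l * (1 + ‖x‖) ^ δ + (Metric.closedBall (0:EuclideanSpace ℝ (Fin d)) ρ).indicator (fun _ => Kb) x) :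
    ∃ C₁ > (0:ℝ), ∃ C₂ > (0:ℝ), ∀ f : EuclideanSpace ℝ (Fin d) → ℝ, ContDiff ℝ 1 f →
      HasCompactSupport f → ∫ x, f x ^ 2 * Real.exp (V x) = 1 →
      ∫ x, f x ^ 2 * Real.log (f x ^ 2) * Real.exp (V x) ≤ C₁ * wEn V δ f + C₂ := by
  obtain ⟨S, hS0, hS⟩ := sob_ent d hd
  refine ⟨S + (S * (1 + K) + K) * (2 / l * (2 / l)), by positivity, (S * (1 + K) + K) * (2 / l * Kb), by positivity,
    fun f hf hfs hf1 => ?_⟩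
  obtain ⟨A, hA, hA'⟩ := cs_bound f hf hfs
  obtain ⟨J1, J2, hly⟩ := lyap d V hV δ K l Kb ρ hδ hl hKb hK hI hVg hVl f hf A hA hA'
  have hVc := hV.continuous
  have hfc := hf.continuous
  set u : EuclideanSpace ℝ (Fin d) → ℝ := fun x => f x ^ 2 * Real.exp (V x) with hu
  have huC : ContDiff ℝ 1 u := (hf.pow 2).mul hV.exp
  have huc := huC.continuous
  have hus : HasCompactSupport u := by
    have : HasCompactSupport (fun x => f x ^ 2) := hfs.comp_left (g := fun t : ℝ => t ^ 2) (by simp)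
    exact this.mul_right
  have hu0 : ∀ x, 0 ≤ u x := fun x => by positivity
  have hent := hS u huC hus hu0 hf1
  have hcdu : Continuous (fderiv ℝ u) := huC.continuous_fderiv one_ne_zero
  have Iu : Integrable u := huc.integrable_of_hasCompactSupport hus
  have Iul : Integrable (fun x => u x * Real.log (u x)) := by
    apply (Real.continuous_mul_log.comp huc).integrable_of_hasCompactSupport
    exact hus.comp_left (g := fun t : ℝ => t * Real.log t) (by simp)
  have IV : Integrable (fun x => V x * u x) :=
    (hVc.mul huc).integrable_of_hasCompactSupport hus.mul_left
  have Idu : Integrable (fun x => ‖fderiv ℝ u x‖) :=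
    hcdu.norm.integrable_of_hasCompactSupport (hus.fderiv (𝕜 := ℝ)).norm
  set W := ∫ x, (1 + ‖x‖) ^ δ * f x ^ 2 * Real.exp (V x) with hW
  change l / 2 * W ≤ 2 / l * wEn V δ f + _ at hly
  have hball : ∫ x in Metric.closedBall 0 ρ, f x ^ 2 * Real.exp (V x) ≤ 1 := by
    rw [← hf1]
    exact setIntegral_le_integral Iu (Filter.Eventually.of_forall hu0)
  have hWle : W ≤ 2 / l * (2 / l * wEn V δ f + Kb) := by
    have h1 : l / 2 * W ≤ 2 / l * wEn V δ f + Kb := by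
      have := mul_le_mul_of_nonneg_left hball hKb.le
      linarith
    calc W = 2 / l * (l / 2 * W) := by field_simp
      _ ≤ _ := by gcongr
  have hpt1 : ∀ x, f x ^ 2 * Real.log (f x ^ 2) * Real.exp (V x) = u x * Real.log (u x) - V x * u x := by
    intro x
    simp only [hu]
    rcases eq_or_ne (f x) 0 with h | h
    · simp [h]
    · rw [Real.log_mul (by positivity) (Real.exp_pos _).ne', Real.log_exp]; ring
  have hsplit : ∫ x, f x ^ 2 * Real.log (f x ^ 2) * Real.exp (V x) = (∫ x, u x * Real.log (u x)) - ∫ x, V x * u x := by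
    simp_rw [hpt1]
    rw [integral_sub Iul IV]
  have hVint : - ∫ x, V x * u x ≤ K * W := by
    rw [← integral_neg, hW, ← integral_const_mul]
    apply integral_mono IV.neg (J1.const_mul _)
    intro x
    have := mul_le_mul_of_nonneg_right (hVm x) (hu0 x)
    simp only [hu, Pi.neg_apply] at this ⊢
    linarith
  have hgrad : ∫ x, ‖fderiv ℝ u x‖ ≤ wEn V δ f + (1 + K) * W := by
    rw [wEn, hW, ← integral_const_mul, ← integral_add J2 (J1.const_mul _)]
    apply integral_mono Idu (J2.add (J1.const_mul _))
    intro x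
    have hpos : 0 < 1 + ‖x‖ := by positivity
    apply ContinuousLinearMap.opNorm_le_bound _ (by simp only [Pi.add_apply]; positivity)
    intro v
    rw [hu, fderiv_g V f hV hf, norm_mul, Real.norm_of_nonneg (Real.exp_pos _).le]
    have a1 : ‖2 * f x * fderiv ℝ f x v‖ ≤ 2 * |f x| * (‖fderiv ℝ f x‖ * ‖v‖) := by
      rw [norm_mul, norm_mul]
      have b1 := (fderiv ℝ f x).le_opNorm v
      have b3 : ‖(2:ℝ)‖ = 2 := by simp
      rw [b3, Real.norm_eq_abs (f x)]
      gcongr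
    have a2 : ‖f x ^ 2 * fderiv ℝ V x v‖ ≤ f x ^ 2 * (K * (1 + ‖x‖) ^ δ * ‖v‖) := by
      rw [norm_mul, Real.norm_of_nonneg (sq_nonneg _)]
      have b1 := (fderiv ℝ V x).le_of_opNorm_le (hVg x) v
      gcongr
    have a3 : 2 * |f x| * ‖fderiv ℝ f x‖ ≤ (1 + ‖x‖) ^ (2 - δ) * ‖fderiv ℝ f x‖ ^ 2 + (1 + ‖x‖) ^ δ * f x ^ 2 := by
      have e1 : 1 ≤ (1 + ‖x‖) ^ (2 - δ) * (1 + ‖x‖) ^ δ := by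
        rw [← Real.rpow_add hpos]
        apply Real.one_le_rpow (by linarith [norm_nonneg x]); norm_num
      have p1 : 0 < (1 + ‖x‖) ^ (2 - δ) := by positivity
      have p2 : 0 < (1 + ‖x‖) ^ δ := by positivity
      set α := (1 + ‖x‖) ^ (2 - δ)
      set β := (1 + ‖x‖) ^ δ
      rw [← sq_abs (f x)]
      set y := |f x|
      set z := ‖fderiv ℝ f x‖
      have hy : 0 ≤ y := abs_nonneg _
      have e2 : 1 / α ≤ β := by rw [div_le_iff₀ p1]; linarith
      have e3 : 0 ≤ α * (z - y / α) ^ 2 := by positivity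
      have e4 : α * (z - y / α) ^ 2 = α * z ^ 2 - 2 * y * z + (1 / α) * y ^ 2 := by field_simp; ring
      have e5 := mul_le_mul_of_nonneg_right e2 (sq_nonneg y)
      linarith
    have a4 := (norm_add_le (2 * f x * fderiv ℝ f x v) (f x ^ 2 * fderiv ℝ V x v)).trans (add_le_add a1 a2)
    calc _ ≤ Real.exp (V x) * (((1 + ‖x‖) ^ (2 - δ) * ‖fderiv ℝ f x‖ ^ 2 + (1 + ‖x‖) ^ δ * f x ^ 2) * ‖v‖ + f x ^ 2 * (K * (1 + ‖x‖) ^ δ * ‖v‖)) := by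
          apply mul_le_mul_of_nonneg_left _ (Real.exp_pos _).le
          have := mul_le_mul_of_nonneg_right a3 (norm_nonneg v)
          linarith
      _ = _ := by simp only [Pi.add_apply]; ring
  rw [hsplit]
  have f1 := mul_le_mul_of_nonneg_left hgrad hS0.le
  have f2 := mul_le_mul_of_nonneg_left hWle (by positivity : 0 ≤ S * (1 + K) + K)
  linarith

lemma homog (d : ℕ) (V : EuclideanSpace ℝ (Fin d) → ℝ) (hV : ContDiff ℝ 1 V)
    (hV1 : ∫ x, Real.exp (V x) = 1) (IV : Integrable (fun x => Real.exp (V x)))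
    (δ C₁ C₂ : ℝ) (h1 : 0 < C₁) (h2 : 0 < C₂)
    (hdef : ∀ f : EuclideanSpace ℝ (Fin d) → ℝ, ContDiff ℝ 1 f →
      HasCompactSupport f → ∫ x, f x ^ 2 * Real.exp (V x) = 1 →
      ∫ x, f x ^ 2 * Real.log (f x ^ 2) * Real.exp (V x) ≤ C₁ * wEn V δ f + C₂)
    (F : EuclideanSpace ℝ (Fin d) → ℝ) (hF : ContDiff ℝ 1 F) (hFs : HasCompactSupport F)
    (hs1 : ∫ x, F x ^ 2 * Real.exp (V x) ≤ 1) :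
    ∫ x, F x ^ 2 * Real.log (1 + F x ^ 2) * Real.exp (V x) ≤ 
      C₁ * wEn V δ F + (C₂ + 1) * ∫ x, F x ^ 2 * Real.exp (V x) := by
  have hVc := hV.continuous
  have hFc := hF.continuous
  have hlc : Continuous (fun x => Real.log (1 + F x ^ 2)) :=
    Continuous.log (by fun_prop) (fun x => by positivity)
  have hsup : HasCompactSupport (fun x => F x ^ 2) := hFs.comp_left (g := fun t : ℝ => t ^ 2) (by simp)
  have I1 : Integrable (fun x => F x ^ 2 * Real.exp (V x)) :=
    (by fun_prop : Continuous _).integrable_of_hasCompactSupport hsup.mul_right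
  have I2 : Integrable (fun x => F x ^ 2 * Real.log (1 + F x ^ 2) * Real.exp (V x)) :=
    (by fun_prop : Continuous _).integrable_of_hasCompactSupport hsup.mul_right.mul_right
  set s := ∫ x, F x ^ 2 * Real.exp (V x) with hs
  have hs0 : 0 ≤ s := integral_nonneg fun x => by positivity
  rcases hs0.eq_or_lt with h0 | h0
  · have hz := (integral_eq_zero_iff_of_nonneg (fun x => by positivity) I1).1 (hs.symm.trans h0.symm)
    have : ∫ x, F x ^ 2 * Real.log (1 + F x ^ 2) * Real.exp (V x) = 0 := by
      rw [integral_eq_zero_of_ae]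
      filter_upwards [hz] with x hx
      have : F x ^ 2 * Real.log (1 + F x ^ 2) * Real.exp (V x) = Real.log (1 + F x ^ 2) * (F x ^ 2 * Real.exp (V x)) := by ring
      rw [this, hx]; simp
    rw [this, ← h0]
    have := wEn_nonneg V δ F
    simp; positivity
  · set k := (Real.sqrt s)⁻¹ with hk
    have hk2 : k ^ 2 = s⁻¹ := by rw [hk, inv_pow, Real.sq_sqrt hs0]
    set g : EuclideanSpace ℝ (Fin d) → ℝ := fun x => k * F x with hg
    have hgC : ContDiff ℝ 1 g := contDiff_const.mul hF
    have hgs : HasCompactSupport g := hFs.mul_left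
    have hgc := hgC.continuous
    have hg2 : ∀ x, g x ^ 2 = s⁻¹ * F x ^ 2 := fun x => by rw [hg]; simp only; rw [mul_pow, hk2]
    have hF2 : ∀ x, F x ^ 2 = s * g x ^ 2 := fun x => by rw [hg2]; field_simp
    have hg1 : ∫ x, g x ^ 2 * Real.exp (V x) = 1 := by
      simp_rw [hg2, mul_assoc]
      rw [integral_const_mul, ← hs, inv_mul_cancel₀ h0.ne']
    have hEg : wEn V δ g = s⁻¹ * wEn V δ F := by
      rw [wEn, wEn, ← integral_const_mul]
      congr 1; ext x
      have : fderiv ℝ g x = k • fderiv ℝ F x := by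
        rw [hg, fderiv_const_mul (hF.differentiable one_ne_zero x)]
      rw [this, norm_smul, mul_pow, Real.norm_eq_abs, sq_abs, hk2]; ring
    have hd := hdef g hgC hgs hg1
    have I3 : Integrable (fun x => g x ^ 2 * Real.log (g x ^ 2) * Real.exp (V x)) := by
      have : HasCompactSupport (fun x => g x ^ 2 * Real.log (g x ^ 2)) := hgs.comp_left (g := fun t : ℝ => t ^ 2 * Real.log (t ^ 2)) (by simp)
      refine Continuous.integrable_of_hasCompactSupport ?_ this.mul_right
      exact (Real.continuous_mul_log.comp (hgc.pow 2)).mul (by fun_prop)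
    have hpt : ∀ x, F x ^ 2 * Real.log (1 + F x ^ 2) * Real.exp (V x) ≤ 
        s * (g x ^ 2 * Real.log (g x ^ 2) * Real.exp (V x) + Real.exp (V x)) := by
      intro x
      have key : ∀ t : ℝ, 0 ≤ t → t * Real.log (1 + t) ≤ t * Real.log t + 1 := by
        intro t ht
        rcases ht.eq_or_lt with h | h
        · rw [← h]; simp
        · have e : Real.log (1 + t) = Real.log t + Real.log (1 + 1 / t) := by
            rw [← Real.log_mul h.ne' (by positivity)]; congr 1; field_simp; ring
          have := Real.log_le_sub_one_of_pos (by positivity : 0 < 1 + 1 / t)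
          have h3 : Real.log (1 + 1 / t) ≤ 1 / t := by linarith
          have h4 := mul_le_mul_of_nonneg_left h3 ht
          rw [mul_one_div_cancel h.ne'] at h4
          rw [e]; linarith
      have a1 : Real.log (1 + F x ^ 2) ≤ Real.log (1 + g x ^ 2) := by
        apply Real.log_le_log (by positivity)
        rw [hF2 x]; nlinarith [sq_nonneg (g x)]
      have a2 := key (g x ^ 2) (sq_nonneg _)
      have a3 : F x ^ 2 * Real.log (1 + F x ^ 2) ≤ s * (g x ^ 2 * Real.log (g x ^ 2) + 1) := by
        calc _ ≤ F x ^ 2 * Real.log (1 + g x ^ 2) := by gcongr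
          _ = s * (g x ^ 2 * Real.log (1 + g x ^ 2)) := by rw [hF2 x]; ring
          _ ≤ _ := by gcongr
      have := mul_le_mul_of_nonneg_right a3 (Real.exp_pos (V x)).le
      linarith
    have hint := integral_mono I2 ((I3.add IV).const_mul s) hpt
    simp only [Pi.add_apply] at hint
    rw [integral_const_mul, integral_add I3 IV, hV1] at hint
    rw [hEg] at hd
    have := mul_le_mul_of_nonneg_left hd hs0
    have e : s * (C₁ * (s⁻¹ * wEn V δ F) + C₂) = C₁ * wEn V δ F + C₂ * s := by field_simp
    linarith

lemma poinc (d : ℕ) (V : EuclideanSpace ℝ (Fin d) → ℝ) (hV : ContDiff ℝ 1 V)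
    (δ K l Kb ρ : ℝ)
    (hδ : 0 < δ) (hl : 0 < l) (hKb : 0 < Kb) (hK : 0 < K) (hρ : 0 < ρ)
    (hI : ∀ N : ℝ, Integrable (fun x => (1 + ‖x‖) ^ N * Real.exp (V x)))
    (hVg : ∀ x, ‖fderiv ℝ V x‖ ≤ K * (1 + ‖x‖) ^ δ)
    (hVl : ∀ x, d + fderiv ℝ V x x ≤ 
      -l * (1 + ‖x‖) ^ δ + (Metric.closedBall (0:EuclideanSpace ℝ (Fin d)) ρ).indicator (fun _ => Kb) x) :
    ∃ C > (0:ℝ), ∀ f : EuclideanSpace ℝ (Fin d) → ℝ, ContDiff ℝ 1 f →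
      HasCompactSupport f → ∃ a : ℝ, ∫ x, (f x - a) ^ 2 * Real.exp (V x) ≤ C * wEn V δ f := by
  obtain ⟨P, hP0, hP⟩ := local_poincare (volume : Measure (EuclideanSpace ℝ (Fin d))) ρ hρ
  have hVc := hV.continuous
  have hwc := w_cont (E := EuclideanSpace ℝ (Fin d)) (2 - δ)
  obtain ⟨M1, hM10, hM1⟩ := vb_ball (fun x => Real.exp (V x)) (by fun_prop) ρ
  obtain ⟨M2, hM20, hM2⟩ := vb_ball (fun x => ((1 + ‖x‖) ^ (2 - δ) * Real.exp (V x))⁻¹)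
    (Continuous.inv₀ (by fun_prop) (fun x => by positivity)) ρ
  refine ⟨2 / l * (2 / l + Kb * (M1 * (P * M2))), by positivity, fun f hf hfs => ?_⟩
  obtain ⟨a, ha⟩ := hP f hf
  refine ⟨a, ?_⟩
  obtain ⟨A, hA, hA'⟩ := cs_bound f hf hfs
  have hfc := hf.continuous
  have hcd : Continuous (fderiv ℝ f) := hf.continuous_fderiv one_ne_zero
  have hfd : ∀ x, fderiv ℝ (fun x => f x - a) x = fderiv ℝ f x := fun x => by
    exact fderiv_sub_const a
  obtain ⟨J1, J2, hly⟩ := lyap d V hV δ K l Kb ρ hδ hl hKb hK hI hVg hVl (fun x => f x - a) (hf.sub contDiff_const)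
    (A + |a|) (fun x => (abs_sub _ _).trans (by linarith [hA x])) (fun x => by rw [hfd]; linarith [hA' x, abs_nonneg a])
  simp_rw [hfd] at hly J2
  change _ ≤ 2 / l * wEn V δ f + _ at hly
  set B := Metric.closedBall (0:EuclideanSpace ℝ (Fin d)) ρ with hB
  have hBm : MeasurableSet B := Metric.isClosed_closedBall.measurableSet
  have hBc : IsCompact B := isCompact_closedBall _ _
  have s1 : ∫ x in B, (f x - a) ^ 2 * Real.exp (V x) ≤ M1 * ∫ x in B, (f x - a) ^ 2 := by
    rw [← integral_const_mul]
    apply setIntegral_mono_on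
    · exact (by fun_prop : Continuous _).continuousOn.integrableOn_compact hBc
    · exact (by fun_prop : Continuous _).continuousOn.integrableOn_compact hBc
    · exact hBm
    · intro x hx
      have := (le_abs_self _).trans (hM1 x (by simpa [hB] using hx))
      rw [mul_comm]
      gcongr
  have s2 : ∫ x in B, ‖fderiv ℝ f x‖ ^ 2 ≤ M2 * wEn V δ f := by
    calc _ ≤ ∫ x in B, M2 * ((1 + ‖x‖) ^ (2 - δ) * ‖fderiv ℝ f x‖ ^ 2 * Real.exp (V x)) := by
          apply setIntegral_mono_on
          · exact (by fun_prop : Continuous _).continuousOn.integrableOn_compact hBc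
          · exact (by fun_prop : Continuous _).continuousOn.integrableOn_compact hBc
          · exact hBm
          · intro x hx
            have := (le_abs_self _).trans (hM2 x (by simpa [hB] using hx))
            have hp : 0 < (1 + ‖x‖) ^ (2 - δ) * Real.exp (V x) := by positivity
            rw [inv_le_iff_one_le_mul₀ hp] at this
            have := mul_le_mul_of_nonneg_right this (sq_nonneg ‖fderiv ℝ f x‖)
            linarith
      _ = M2 * ∫ x in B, ((1 + ‖x‖) ^ (2 - δ) * ‖fderiv ℝ f x‖ ^ 2 * Real.exp (V x)) := integral_const_mul _ _
      _ ≤ _ := by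
          gcongr
          exact setIntegral_le_integral J2 (Filter.Eventually.of_forall fun x => by positivity)
  have s3 : ∫ x in B, (f x - a) ^ 2 * Real.exp (V x) ≤ M1 * (P * (M2 * wEn V δ f)) := by
    refine s1.trans ?_
    gcongr
    refine ha.trans ?_
    gcongr
  set W := ∫ x, (1 + ‖x‖) ^ δ * (f x - a) ^ 2 * Real.exp (V x) with hW
  have s4 : ∫ x, (f x - a) ^ 2 * Real.exp (V x) ≤ W := by
    apply integral_mono_of_nonneg (Filter.Eventually.of_forall fun x => by positivity) J1
    refine Filter.Eventually.of_forall fun x => ?_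
    have := one_le_w hδ x
    have h := mul_le_mul_of_nonneg_right this (by positivity : 0 ≤ (f x - a) ^ 2 * Real.exp (V x))
    simp only
    linarith
  have s5 : l / 2 * W ≤ (2 / l + Kb * (M1 * (P * M2))) * wEn V δ f := by
    have := mul_le_mul_of_nonneg_left s3 hKb.le
    linarith
  calc _ ≤ W := s4
    _ = 2 / l * (l / 2 * W) := by field_simp
    _ ≤ 2 / l * ((2 / l + Kb * (M1 * (P * M2))) * wEn V δ f) := by gcongr
    _ = _ := by ring

lemma cs_int {d : ℕ} (V f g : EuclideanSpace ℝ (Fin d) → ℝ) (hV : Continuous V) (hfs : HasCompactSupport f)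
    (hg : Continuous g) (h0 : ∀ x, f x = 0 → g x = 0) : Integrable (fun x => g x * Real.exp (V x)) := by
  apply Continuous.integrable_of_hasCompactSupport (by fun_prop)
  refine hfs.mono ?_
  intro x hx hfx
  exact hx (by simp [h0 x hfx])

lemma psi_deriv (a t : ℝ) : HasDerivAt (fun s : ℝ => s ^ 2 * (s - a) / (1 + s ^ 2))
    ((t ^ 4 + 3 * t ^ 2 - 2 * a * t) / (1 + t ^ 2) ^ 2) t := by
  have h0 : (1 + t ^ 2) ≠ 0 := by positivity
  have h1 : HasDerivAt (fun s : ℝ => s ^ 2) (2 * t) t := by simpa using hasDerivAt_pow 2 t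
  have := (h1.mul ((hasDerivAt_id t).sub_const a)).div (h1.const_add 1) h0
  refine this.congr_deriv ?_
  simp only [id, Pi.mul_apply]
  field_simp
  ring

lemma psi_bound (a t : ℝ) (ha : a ^ 2 ≤ 25 / 16) :
    |(t ^ 4 + 3 * t ^ 2 - 2 * a * t) / (1 + t ^ 2) ^ 2| ≤ 8 := by
  have h0 : 0 < (1 + t ^ 2) ^ 2 := by positivity
  rw [abs_div, abs_of_pos h0, div_le_iff₀ h0, abs_le]
  constructor <;> nlinarith [sq_nonneg (a - t), sq_nonneg (a + t), sq_nonneg t, sq_nonneg (t ^ 2)]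

lemma tight (d : ℕ) (V : EuclideanSpace ℝ (Fin d) → ℝ) (hV : ContDiff ℝ 1 V)
    (hV1 : ∫ x, Real.exp (V x) = 1) (IV : Integrable (fun x => Real.exp (V x)))
    (δ C₁ C₂ C : ℝ) (h1 : 0 < C₁) (h2 : 0 < C₂) (hC : 0 < C)
    (hdef : ∀ f : EuclideanSpace ℝ (Fin d) → ℝ, ContDiff ℝ 1 f →
      HasCompactSupport f → ∫ x, f x ^ 2 * Real.exp (V x) = 1 →
      ∫ x, f x ^ 2 * Real.log (f x ^ 2) * Real.exp (V x) ≤ C₁ * wEn V δ f + C₂)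
    (f : EuclideanSpace ℝ (Fin d) → ℝ) (hf : ContDiff ℝ 1 f) (hfs : HasCompactSupport f)
    (hf1 : ∫ x, f x ^ 2 * Real.exp (V x) = 1) (a : ℝ)
    (ha : ∫ x, (f x - a) ^ 2 * Real.exp (V x) ≤ C * wEn V δ f) :
    ∫ x, f x ^ 2 * Real.log (f x ^ 2) * Real.exp (V x) ≤ 
      (C₁ + 16 * C * C₂ + 49 * (C + C₁ * 64 + (C₂ + 1) * C)) * wEn V δ f := by
  have hVc := hV.continuous
  have hfc := hf.continuous
  have hE := wEn_nonneg V δ f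
  set s := ∫ x, (f x - a) ^ 2 * Real.exp (V x) with hs
  have Iff : Integrable (fun x => f x ^ 2 * Real.exp (V x)) :=
    cs_int V f _ hVc hfs (by fun_prop) (fun x hx => by simp [hx])
  have If : Integrable (fun x => f x * Real.exp (V x)) :=
    cs_int V f _ hVc hfs (by fun_prop) (fun x hx => by simp [hx])
  have Is : Integrable (fun x => (f x - a) ^ 2 * Real.exp (V x)) := by
    refine ((Iff.sub (If.const_mul (2 * a))).add (IV.const_mul (a ^ 2))).congr ?_
    refine Filter.Eventually.of_forall fun x => ?_
    simp only [Pi.add_apply, Pi.sub_apply]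
    ring
  rcases lt_or_ge (1 / 16) s with hs1 | hs1
  · have := hdef f hf hfs hf1
    have p1 : 0 ≤ 49 * (C + C₁ * 64 + (C₂ + 1) * C) * wEn V δ f := by positivity
    have p2 : 1 ≤ 16 * (C * wEn V δ f) := by linarith
    have p3 := mul_le_mul_of_nonneg_left p2 h2.le
    nlinarith
  have ha2 : a ^ 2 ≤ 25 / 16 := by
    have : ∫ x, a ^ 2 * Real.exp (V x) ≤ ∫ x, (5 / 4 * (f x ^ 2 * Real.exp (V x)) + 5 * ((f x - a) ^ 2 * Real.exp (V x))) := by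
      apply integral_mono (IV.const_mul _) ((Iff.const_mul _).add (Is.const_mul _))
      intro x
      have : a ^ 2 ≤ 5 / 4 * f x ^ 2 + 5 * (f x - a) ^ 2 := by nlinarith [sq_nonneg (5 * f x - 4 * a)]
      have := mul_le_mul_of_nonneg_right this (Real.exp_pos (V x)).le
      simp only [Pi.add_apply]
      linarith
    rw [integral_const_mul, integral_add (Iff.const_mul _) (Is.const_mul _), integral_const_mul, integral_const_mul, hV1, hf1, ← hs] at this
    linarith
  have ha1 : 9 / 16 ≤ a ^ 2 := by
    have : ∫ x, f x ^ 2 * Real.exp (V x) ≤ ∫ x, (4 / 3 * a ^ 2 * Real.exp (V x) + 4 * ((f x - a) ^ 2 * Real.exp (V x))) := by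
      apply integral_mono Iff ((IV.const_mul _).add (Is.const_mul _))
      intro x
      have : f x ^ 2 ≤ 4 / 3 * a ^ 2 + 4 * (f x - a) ^ 2 := by nlinarith [sq_nonneg (3 * f x - 4 * a)]
      have := mul_le_mul_of_nonneg_right this (Real.exp_pos (V x)).le
      simp only [Pi.add_apply]
      linarith
    rw [integral_add (IV.const_mul _) (Is.const_mul _), integral_const_mul, integral_const_mul, hV1, hf1, ← hs] at this
    linarith
  set F : EuclideanSpace ℝ (Fin d) → ℝ := fun x => f x ^ 2 * (f x - a) / (1 + f x ^ 2) with hF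
  have hFC : ContDiff ℝ 1 F := by
    apply ContDiff.div
    · exact (hf.pow 2).mul (hf.sub contDiff_const)
    · exact contDiff_const.add (hf.pow 2)
    · intro x; positivity
  have hF0 : ∀ x, f x = 0 → F x = 0 := fun x hx => by simp [hF, hx]
  have hFs : HasCompactSupport F := hfs.mono (fun x hx hfx => hx (hF0 x hfx))
  have hFc := hFC.continuous
  have hFle : ∀ x, F x ^ 2 ≤ (f x - a) ^ 2 := by
    intro x
    have e : F x = f x ^ 2 / (1 + f x ^ 2) * (f x - a) := by simp only [hF]; ring
    have q0 : 0 ≤ f x ^ 2 / (1 + f x ^ 2) := by positivity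
    have q1 : f x ^ 2 / (1 + f x ^ 2) ≤ 1 := by
      rw [div_le_one (by positivity)]; linarith
    rw [e, mul_pow]
    have : (f x ^ 2 / (1 + f x ^ 2)) ^ 2 ≤ 1 := pow_le_one₀ q0 q1
    nlinarith [sq_nonneg (f x - a)]
  have IF : Integrable (fun x => F x ^ 2 * Real.exp (V x)) :=
    cs_int V f _ hVc hfs (by fun_prop) (fun x hx => by simp [hF0 x hx])
  have hFs2 : ∫ x, F x ^ 2 * Real.exp (V x) ≤ s := by
    apply integral_mono IF Is
    intro x
    exact mul_le_mul_of_nonneg_right (hFle x) (Real.exp_pos _).le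
  have hFd : ∀ x, ‖fderiv ℝ F x‖ ≤ 8 * ‖fderiv ℝ f x‖ := by
    intro x
    have := (psi_deriv a (f x)).comp_hasFDerivAt x (hf.differentiable one_ne_zero x).hasFDerivAt
    have e : fderiv ℝ F x = _ := this.fderiv
    rw [e, norm_smul]
    gcongr
    exact psi_bound a (f x) ha2
  have hwc := w_cont (E := EuclideanSpace ℝ (Fin d)) (2 - δ)
  have hwI : ∀ g : EuclideanSpace ℝ (Fin d) → ℝ, ContDiff ℝ 1 g → HasCompactSupport g →
      Integrable (fun x => (1 + ‖x‖) ^ (2 - δ) * ‖fderiv ℝ g x‖ ^ 2 * Real.exp (V x)) := by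
    intro g hg hgs
    have hcd : Continuous (fderiv ℝ g) := hg.continuous_fderiv one_ne_zero
    apply Continuous.integrable_of_hasCompactSupport (by fun_prop)
    refine (hgs.fderiv ℝ).mono ?_
    intro x hx hfx
    exact hx (by simp [hfx])
  have hwF : wEn V δ F ≤ 64 * wEn V δ f := by
    rw [wEn, wEn, ← integral_const_mul]
    apply integral_mono (hwI F hFC hFs) ((hwI f hf hfs).const_mul _)
    intro x
    have h8 : ‖fderiv ℝ F x‖ ^ 2 ≤ 64 * ‖fderiv ℝ f x‖ ^ 2 := by
      have := pow_le_pow_left₀ (norm_nonneg _) (hFd x) 2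
      linarith [mul_pow 8 ‖fderiv ℝ f x‖ 2]
    have p : 0 ≤ (1 + ‖x‖) ^ (2 - δ) * Real.exp (V x) := by positivity
    have := mul_le_mul_of_nonneg_left h8 p
    simp only
    linarith
  have hh := homog d V hV hV1 IV δ C₁ C₂ h1 h2 hdef F hFC hFs (by linarith)
  have hlogc : Continuous (fun x => f x ^ 2 * Real.log (f x ^ 2)) :=
    Real.continuous_mul_log.comp (hfc.pow 2)
  have Iel : Integrable (fun x => f x ^ 2 * Real.log (f x ^ 2) * Real.exp (V x)) :=
    cs_int V f _ hVc hfs hlogc (fun x hx => by simp [hx])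
  have IFl : Integrable (fun x => F x ^ 2 * Real.log (1 + F x ^ 2) * Real.exp (V x)) := by
    refine cs_int V f _ hVc hfs ?_ (fun x hx => by simp [hF0 x hx])
    refine (hFc.pow 2).mul (Continuous.log (by fun_prop) (fun x => by positivity))
  have hmain : ∫ x, (f x ^ 2 * Real.log (f x ^ 2) * Real.exp (V x) - (Real.log (a ^ 2) + 1) * (f x ^ 2 * Real.exp (V x)) + a ^ 2 * Real.exp (V x)) ≤ 
      ∫ x, 49 * ((f x - a) ^ 2 * Real.exp (V x) + F x ^ 2 * Real.log (1 + F x ^ 2) * Real.exp (V x)) := by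
    apply integral_mono ((Iel.sub (Iff.const_mul _)).add (IV.const_mul _)) ((Is.add IFl).const_mul _)
    intro x
    have := mul_le_mul_of_nonneg_right (pt_ineq (f x) a ha1 ha2) (Real.exp_pos (V x)).le
    simp only [Pi.add_apply, Pi.sub_apply, hF]
    linarith
  have Isub : Integrable (fun x => f x ^ 2 * Real.log (f x ^ 2) * Real.exp (V x) - (Real.log (a ^ 2) + 1) * (f x ^ 2 * Real.exp (V x))) :=
    Iel.sub (Iff.const_mul _)
  rw [integral_add Isub (IV.const_mul _), integral_sub Iel (Iff.const_mul _),
    integral_const_mul, integral_const_mul, integral_const_mul, integral_add Is IFl, hV1, hf1, ← hs] at hmain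
  have hlog : Real.log (a ^ 2) ≤ a ^ 2 - 1 := Real.log_le_sub_one_of_pos (by linarith)
  have t1 : C₁ * wEn V δ F ≤ C₁ * (64 * wEn V δ f) := mul_le_mul_of_nonneg_left hwF h1.le
  have t2 : (C₂ + 1) * ∫ x, F x ^ 2 * Real.exp (V x) ≤ (C₂ + 1) * (C * wEn V δ f) :=
    mul_le_mul_of_nonneg_left (hFs2.trans ha) (by linarith)
  have t3 : 0 ≤ C₁ * wEn V δ f := by positivity
  have t4 : 0 ≤ 16 * C * C₂ * wEn V δ f := by positivity
  linarith

theorem stmt18 (d : ℕ) (hd : 2 ≤ d)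
    (V : EuclideanSpace ℝ (Fin d) → ℝ) (hV : ContDiff ℝ 1 V)
    (hV1 : ∫ x, Real.exp (V x) = 1)
    (μ : Measure (EuclideanSpace ℝ (Fin d)))
    (hμ : μ = volume.withDensity (fun x => ENNReal.ofReal (Real.exp (V x))))
    (δ c₁ c₂ R : ℝ) (hδ : 0 < δ) (hc₁ : 0 < c₁) (hc₂ : 0 < c₂) (hR : 0 < R)
    (hrad : ∀ x : EuclideanSpace ℝ (Fin d), R ≤ ‖x‖ →
      -c₁ * ‖x‖ ^ (δ - 1) ≤ ⟪gradient V x, ‖x‖⁻¹ • x⟫ ∧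
      ⟪gradient V x, ‖x‖⁻¹ • x⟫ ≤ -c₂ * ‖x‖ ^ (δ - 1))
    (c₃ : ℝ) (hc₃ : 0 < c₃)
    (hang : ∀ x : EuclideanSpace ℝ (Fin d), x ≠ 0 →
      ‖x‖ * ‖gradient V x - ⟪gradient V x, ‖x‖⁻¹ • x⟫ • (‖x‖⁻¹ • x)‖ ≤ c₃) :
    ∃ c > (0:ℝ), ∀ f : EuclideanSpace ℝ (Fin d) → ℝ,
      ContDiff ℝ (⊤ : ℕ∞) f → HasCompactSupport f → ∫ x, f x ^ 2 ∂μ = 1 →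
      ∫ x, f x ^ 2 * Real.log (f x ^ 2) ∂μ ≤
        c * ∫ x, (1 + ‖x‖) ^ (2 - δ) * ‖gradient f x‖ ^ 2 ∂μ := by
  have hVc := hV.continuous
  have hr := vb_rad V hV δ c₁ c₂ R hR hrad
  obtain ⟨K1, hK1, c, hc, hVm, hVu⟩ := vb_val V hV δ c₁ c₂ R hδ hR hc₁ hc₂ hr
  obtain ⟨K2, hK2, hVg⟩ := vb_grad V hV δ c₁ c₂ R hδ hR hc₁ hc₂ hr c₃ hc₃ hang
  obtain ⟨l, hl, Kb, hKb, ρ, hρ, hVl⟩ := vb_lyap d V hV δ c₁ c₂ R hδ hR hc₂ hr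
  have hI := int_weight volume V hVc δ c K1 hδ hc hVu
  have hVm' : ∀ x, -V x ≤ (K1 + K2) * (1 + ‖x‖) ^ δ := fun x => (hVm x).trans (by gcongr; linarith)
  have hVg' : ∀ x, ‖fderiv ℝ V x‖ ≤ (K1 + K2) * (1 + ‖x‖) ^ δ := fun x => (hVg x).trans (by gcongr; linarith)
  have IV : Integrable (fun x => Real.exp (V x)) := by simpa using hI 0
  obtain ⟨C₁, h1, C₂, h2, hdef⟩ := defective d hd V hV δ (K1 + K2) l Kb ρ hδ hl hKb (by linarith) hI hVm' hVg' hVl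
  obtain ⟨C, hC, hp⟩ := poinc d V hV δ (K1 + K2) l Kb ρ hδ hl hKb (by linarith) hρ hI hVg' hVl
  have conv : ∀ g : EuclideanSpace ℝ (Fin d) → ℝ, ∫ x, g x ∂μ = ∫ x, g x * Real.exp (V x) := by
    intro g
    rw [hμ, integral_withDensity_eq_integral_toReal_smul (by fun_prop) (by simp)]
    congr 1
    ext x
    rw [ENNReal.toReal_ofReal (Real.exp_pos _).le, smul_eq_mul, mul_comm]
  refine ⟨C₁ + 16 * C * C₂ + 49 * (C + C₁ * 64 + (C₂ + 1) * C), by positivity, fun f hf hfs hf1 => ?_⟩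
  rw [conv] at hf1 ⊢
  rw [conv]
  have hf' : ContDiff ℝ 1 f := hf.of_le (by exact_mod_cast le_top)
  obtain ⟨a, ha⟩ := hp f hf' hfs
  have hg : ∀ x, ‖gradient f x‖ = ‖fderiv ℝ f x‖ := fun x => by simp [gradient]
  simp_rw [hg]
  exact tight d V hV hV1 IV δ C₁ C₂ C h1 h2 hC hdef f hf' hfs hf1 a ha
end
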